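/- arXiv:2108.02608 — 7 statements merged into one kernel-verified Lean document; each statement's English description precedes it below -/
import Mathlib

section
/- Let B be the quotient of the free associative algebra k⟨x1,x2,x3,x4⟩ by the two-sided ideal generated by: x1², x2², x3², x_i·x_j + x_j·x_i for all i ≠ j in {1,2,3}, x4², x1·x4 − q·x4·x1, z3·z2 − z2·z3 + (1/2)·z2², and z2·w + q⁻¹·w·z2. Then the images in B of the monomials x1^{m1}·x2^{m2}·x3^{m3}·w^{p}·z2^{n2}·z3^{n3}·x4^{m4}, where m1,m2,m3,m4,p ∈ {0,1} and n2,n3 ∈ ℕ, form a k-vector space basis of B. -/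
/- Statement 0: PBW basis of the Nichols algebra 𝔅(𝔈_{3,−}(q)) (Theorem 4.2 of the paper). -/

noncomputable section
namespace Stmt0

variable (k : Type*) [Field k] (q : k)

/-- The generators of the free algebra: `x1, x2, x3, x4`. -/
def x1 : FreeAlgebra k (Fin 4) := FreeAlgebra.ι k 0
def x2 : FreeAlgebra k (Fin 4) := FreeAlgebra.ι k 1
def x3 : FreeAlgebra k (Fin 4) := FreeAlgebra.ι k 2
def x4 : FreeAlgebra k (Fin 4) := FreeAlgebra.ι k 3

/-- z2 := x4·x2 − q⁻¹·(x2+x1)·x4 -/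
def z2 : FreeAlgebra k (Fin 4) := x4 k * x2 k - q⁻¹ • ((x2 k + x1 k) * x4 k)
/-- z3 := x4·x3 − q⁻¹·(x3+x2)·x4 -/
def z3 : FreeAlgebra k (Fin 4) := x4 k * x3 k - q⁻¹ • ((x3 k + x2 k) * x4 k)
/-- w := z2·x3 + q⁻¹·(x3+x2)·z2 -/
def w : FreeAlgebra k (Fin 4) :=
  z2 k q * x3 k + q⁻¹ • ((x3 k + x2 k) * z2 k q)

/-- The defining relations. -/
def rels : Set (FreeAlgebra k (Fin 4)) :=
  { x1 k ^ 2, x2 k ^ 2, x3 k ^ 2,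
    x1 k * x2 k + x2 k * x1 k,
    x1 k * x3 k + x3 k * x1 k,
    x2 k * x3 k + x3 k * x2 k,
    x4 k ^ 2,
    x1 k * x4 k - q • (x4 k * x1 k),
    z3 k q * z2 k q - z2 k q * z3 k q + (2 : k)⁻¹ • z2 k q ^ 2,
    z2 k q * w k q + q⁻¹ • (w k q * z2 k q) }

/-- The relation whose `RingQuot` is the quotient by the two-sided ideal generated by `rels`. -/
def rel (a b : FreeAlgebra k (Fin 4)) : Prop := a ∈ rels k q ∧ b = 0

/-- The index set of the PBW monomials. -/
structure Idx where
  m1 : Fin 2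
  m2 : Fin 2
  m3 : Fin 2
  p : Fin 2
  n2 : ℕ
  n3 : ℕ
  m4 : Fin 2

/-- The PBW monomials x1^{m1}·x2^{m2}·x3^{m3}·w^{p}·z2^{n2}·z3^{n3}·x4^{m4} in the quotient. -/
def mon (i : Idx) : RingQuot (rel k q) :=
  RingQuot.mkAlgHom k (rel k q)
    (x1 k ^ (i.m1 : ℕ) * x2 k ^ (i.m2 : ℕ) * x3 k ^ (i.m3 : ℕ) * w k q ^ (i.p : ℕ) *
      z2 k q ^ i.n2 * z3 k q ^ i.n3 * x4 k ^ (i.m4 : ℕ))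

section Exterior

variable {k N : Type*} [Field k] [AddCommGroup N] [Module k N]

/-- Left multiplication by `x1` on `Λ(x1, x2, x3) ⊗ N`; the coordinates are taken with respect to
`1, x3, x2, x2x3, x1, x1x3, x1x2, x1x2x3`. -/
def extX1 : Module.End k (Fin 8 → N) where
  toFun v := ![0, 0, 0, 0, v 0, v 1, v 2, v 3]
  map_add' v v' := by ext i; fin_cases i <;> simp
  map_smul' a v := by ext i; fin_cases i <;> simp

/-- Left multiplication by `x2` on `Λ(x1, x2, x3) ⊗ N`. -/
def extX2 : Module.End k (Fin 8 → N) where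
  toFun v := ![0, 0, v 0, v 1, 0, 0, -v 4, -v 5]
  map_add' v v' := by ext i; fin_cases i <;> simp <;> abel
  map_smul' a v := by ext i; fin_cases i <;> simp

/-- Left multiplication by `x3` on `Λ(x1, x2, x3) ⊗ N`. -/
def extX3 : Module.End k (Fin 8 → N) where
  toFun v := ![0, v 0, 0, -v 2, 0, -v 4, 0, v 6]
  map_add' v v' := by ext i; fin_cases i <;> simp <;> abel
  map_smul' a v := by ext i; fin_cases i <;> simp

/-- The action of `x4` on `Λ(x1, x2, x3) ⊗ N` induced by the action of `w, z2, z3, x4` on `N`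
through `w, y, z, u`. -/
def extX4 (c : k) (w y z u : Module.End k N) : Module.End k (Fin 8 → N) where
  toFun v := ![u (v 0) + z (v 1) + y (v 2) + w (v 3),
    c • u (v 1) - c • y (v 3),
    c • u (v 1) + c • u (v 2) - c • y (v 3) + c • z (v 3),
    c ^ 2 • u (v 3),
    c • u (v 2) + c • z (v 3) + c • u (v 4) + c • z (v 5) + c • y (v 6) + c • w (v 7),
    c ^ 2 • u (v 3) + c ^ 2 • u (v 5) - c ^ 2 • y (v 7),
    c ^ 2 • u (v 3) + c ^ 2 • u (v 5) + c ^ 2 • u (v 6) - c ^ 2 • y (v 7) + c ^ 2 • z (v 7),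
    c ^ 3 • u (v 7)]
  map_add' v v' := by ext i; fin_cases i <;> simp <;> module
  map_smul' a v := by ext i; fin_cases i <;> simp <;> module

/-- The action of `z2` on `Λ(x1, x2, x3) ⊗ N`. -/
def extZ2 (c : k) (w y : Module.End k N) : Module.End k (Fin 8 → N) where
  toFun v := ![y (v 0) + w (v 1),
    -c • y (v 1),
    -c • y (v 1) - c • y (v 2) - c • w (v 3),
    c ^ 2 • y (v 3),
    -c • y (v 2) - c • w (v 3) - c • y (v 4) - c • w (v 5),
    c ^ 2 • y (v 3) + c ^ 2 • y (v 5),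
    c ^ 2 • y (v 3) + c ^ 2 • y (v 5) + c ^ 2 • y (v 6) + c ^ 2 • w (v 7),
    -c ^ 3 • y (v 7)]
  map_add' v v' := by ext i; fin_cases i <;> simp <;> module
  map_smul' a v := by ext i; fin_cases i <;> simp <;> module

/-- The action of `z3` on `Λ(x1, x2, x3) ⊗ N`. -/
def extZ3 (c : k) (w z : Module.End k N) : Module.End k (Fin 8 → N) where
  toFun v := ![z (v 0) - w (v 2),
    -c • z (v 1) - c • w (v 3),
    -c • z (v 1) - c • z (v 2) - c • w (v 3),
    c ^ 2 • z (v 3),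
    -c • z (v 2) - c • z (v 4) + c • w (v 6),
    c ^ 2 • z (v 3) + c ^ 2 • z (v 5) + c ^ 2 • w (v 7),
    c ^ 2 • z (v 3) + c ^ 2 • z (v 5) + c ^ 2 • z (v 6) + c ^ 2 • w (v 7),
    -c ^ 3 • z (v 7)]
  map_add' v v' := by ext i; fin_cases i <;> simp <;> module
  map_smul' a v := by ext i; fin_cases i <;> simp <;> module

/-- The action of `w` on `Λ(x1, x2, x3) ⊗ N`. -/
def extW (c : k) (w : Module.End k N) : Module.End k (Fin 8 → N) where
  toFun v := ![w (v 0),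
    c • w (v 1),
    c • w (v 1) + c • w (v 2),
    c ^ 2 • w (v 3),
    c • w (v 2) + c • w (v 4),
    c ^ 2 • w (v 3) + c ^ 2 • w (v 5),
    c ^ 2 • w (v 3) + c ^ 2 • w (v 5) + c ^ 2 • w (v 6),
    c ^ 3 • w (v 7)]
  map_add' v v' := by ext i; fin_cases i <;> simp <;> module
  map_smul' a v := by ext i; fin_cases i <;> simp <;> module

lemma extX1_sq : (extX1 : Module.End k (Fin 8 → N)) ^ 2 = 0 := by
  refine LinearMap.ext fun v ↦ funext fun i ↦ ?_
  fin_cases i <;> simp [pow_two, extX1]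

lemma extX2_sq : (extX2 : Module.End k (Fin 8 → N)) ^ 2 = 0 := by
  refine LinearMap.ext fun v ↦ funext fun i ↦ ?_
  fin_cases i <;> simp [pow_two, extX2]

lemma extX3_sq : (extX3 : Module.End k (Fin 8 → N)) ^ 2 = 0 := by
  refine LinearMap.ext fun v ↦ funext fun i ↦ ?_
  fin_cases i <;> simp [pow_two, extX3]

lemma extX1_extX2 : (extX1 * extX2 + extX2 * extX1 : Module.End k (Fin 8 → N)) = 0 := by
  refine LinearMap.ext fun v ↦ funext fun i ↦ ?_
  fin_cases i <;> simp [extX1, extX2]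

lemma extX1_extX3 : (extX1 * extX3 + extX3 * extX1 : Module.End k (Fin 8 → N)) = 0 := by
  refine LinearMap.ext fun v ↦ funext fun i ↦ ?_
  fin_cases i <;> simp [extX1, extX3]

lemma extX2_extX3 : (extX2 * extX3 + extX3 * extX2 : Module.End k (Fin 8 → N)) = 0 := by
  refine LinearMap.ext fun v ↦ funext fun i ↦ ?_
  fin_cases i <;> simp [extX2, extX3]

lemma extX4_extX1 (c : k) (w y z u : Module.End k N) :
    extX4 c w y z u * extX1 = c • (extX1 * extX4 c w y z u) := by
  refine LinearMap.ext fun v ↦ funext fun i ↦ ?_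
  fin_cases i <;> simp [extX1, extX4] <;> module

lemma extX4_extX2 (c : k) (w y z u : Module.End k N) :
    extX4 c w y z u * extX2 - c • ((extX2 + extX1) * extX4 c w y z u) = extZ2 c w y := by
  refine LinearMap.ext fun v ↦ funext fun i ↦ ?_
  fin_cases i <;> simp [extX1, extX2, extX4, extZ2] <;> module

lemma extX4_extX3 (c : k) (w y z u : Module.End k N) :
    extX4 c w y z u * extX3 - c • ((extX3 + extX2) * extX4 c w y z u) = extZ3 c w z := by
  refine LinearMap.ext fun v ↦ funext fun i ↦ ?_
  fin_cases i <;> simp [extX2, extX3, extX4, extZ3] <;> module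

lemma extZ2_extX3 (c : k) (w y : Module.End k N) :
    extZ2 c w y * extX3 + c • ((extX3 + extX2) * extZ2 c w y) = extW c w := by
  refine LinearMap.ext fun v ↦ funext fun i ↦ ?_
  fin_cases i <;> simp [extX2, extX3, extZ2, extW] <;> module

/-- The relations satisfied by the actions `w, y, z, u` of `w, z2, z3, x4`. -/
structure IsTwisted (c : k) (w y z u : Module.End k N) : Prop where
  w_w : ∀ n, w (w n) = 0
  y_w : ∀ n, y (w n) = -c • w (y n)
  z_w : ∀ n, z (w n) = -c • w (z n)
  u_w : ∀ n, u (w n) = -c ^ 2 • w (u n) + (c * 2⁻¹) • y (y n)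
  z_y : ∀ n, z (y n) = y (z n) - (2 : k)⁻¹ • y (y n)
  u_y : ∀ n, u (y n) = -c • y (u n)
  u_z : ∀ n, u (z n) = -c • (z (u n) + y (u n))
  u_u : ∀ n, u (u n) = 0

variable {c : k} {w y z u : Module.End k N}

lemma extX4_sq [CharZero k] (h : IsTwisted c w y z u) : extX4 c w y z u ^ 2 = 0 := by
  refine LinearMap.ext fun v ↦ funext fun i ↦ ?_
  fin_cases i <;>
    simp [pow_two, extX4, h.u_w, h.z_y, h.u_y, h.u_z, h.u_u] <;> module

lemma extZ3_extZ2 [CharZero k] (h : IsTwisted c w y z u) :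
    extZ3 c w z * extZ2 c w y - extZ2 c w y * extZ3 c w z + (2 : k)⁻¹ • extZ2 c w y ^ 2 = 0 := by
  refine LinearMap.ext fun v ↦ funext fun i ↦ ?_
  fin_cases i <;>
    simp [pow_two, extZ2, extZ3, h.w_w, h.y_w, h.z_w, h.z_y] <;> module

lemma extZ2_extW (h : IsTwisted c w y z u) :
    extZ2 c w y * extW c w + c • (extW c w * extZ2 c w y) = 0 := by
  refine LinearMap.ext fun v ↦ funext fun i ↦ ?_
  fin_cases i <;>
    simp [extZ2, extW, h.w_w, h.y_w] <;> module

end Exterior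

section Twisted

variable {k P : Type*} [Field k] [AddCommGroup P] [Module k P]

/-- The action of `w` on `⟨1, w⟩ ⊗ P ⊗ ⟨1, x4⟩`; the coordinates are taken with respect to
`1, x4, w, w x4`. -/
def twW : Module.End k (Fin 4 → P) where
  toFun n := ![0, 0, n 0, n 1]
  map_add' n n' := by ext i; fin_cases i <;> simp
  map_smul' a n := by ext i; fin_cases i <;> simp

/-- The action on `⟨1, w⟩ ⊗ P ⊗ ⟨1, x4⟩` of an element `t` of the Jordan plane,
homogeneous of degree one. -/
def twJ (c : k) (t : Module.End k P) : Module.End k (Fin 4 → P) where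
  toFun n := ![t (n 0), t (n 1), -c • t (n 2), -c • t (n 3)]
  map_add' n n' := by ext i; fin_cases i <;> simp
  map_smul' a n := by ext i; fin_cases i <;> simp <;> module

/-- The action of `x4` on `⟨1, w⟩ ⊗ P ⊗ ⟨1, x4⟩`, where `f` is the twist of `P` by `x4`. -/
def twU (c : k) (y f : Module.End k P) : Module.End k (Fin 4 → P) where
  toFun n := ![(c * 2⁻¹) • y (y (n 2)), f (n 0) + (c * 2⁻¹) • y (y (n 3)), 0, -c ^ 2 • f (n 2)]
  map_add' n n' := by ext i; fin_cases i <;> simp; module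
  map_smul' a n := by ext i; fin_cases i <;> simp <;> module

/-- Operators `y, z` satisfying the relation of the Jordan plane, together with a twist `f`. -/
structure IsTwistedJordan (c : k) (y z f : Module.End k P) : Prop where
  z_y : ∀ n, z (y n) = y (z n) - (2 : k)⁻¹ • y (y n)
  f_y : ∀ n, f (y n) = -c • y (f n)
  f_z : ∀ n, f (z n) = -c • (z (f n) + y (f n))

lemma IsTwistedJordan.isTwisted [CharZero k] {c : k} {y z f : Module.End k P}
    (h : IsTwistedJordan c y z f) : IsTwisted c twW (twJ c y) (twJ c z) (twU c y f) where
  w_w n := by ext i; fin_cases i <;> simp [twW]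
  y_w n := by ext i; fin_cases i <;> simp [twW, twJ]
  z_w n := by ext i; fin_cases i <;> simp [twW, twJ]
  u_w n := by ext i; fin_cases i <;> simp [twW, twJ, twU] <;> module
  z_y n := by ext i; fin_cases i <;> simp [twJ, h.z_y] <;> module
  u_y n := by ext i; fin_cases i <;> simp [twJ, twU, h.f_y] <;> module
  u_z n := by ext i; fin_cases i <;> simp [twJ, twU, h.f_z, h.z_y] <;> module
  u_u n := by ext i; fin_cases i <;> simp [twU, h.f_y]; module

end Twisted

section Jordan

variable {k : Type*} [Field k]

/-- Left multiplication by `z2` on the Jordan plane, in the basis `z2 ^ a * z3 ^ b`. -/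
def jordanY : Module.End k (ℕ × ℕ →₀ k) :=
  Finsupp.linearCombination k fun i ↦ Finsupp.single (i.1 + 1, i.2) 1

/-- Left multiplication by `z3` on the Jordan plane, in the basis `z2 ^ a * z3 ^ b`. -/
def jordanZ : Module.End k (ℕ × ℕ →₀ k) :=
  Finsupp.linearCombination k fun i ↦
    Finsupp.single (i.1, i.2 + 1) 1 - (i.1 * (2 : k)⁻¹) • Finsupp.single (i.1 + 1, i.2) 1

/-- The algebra endomorphism `z2 ↦ -c z2`, `z3 ↦ -c (z3 + z2)` of the Jordan plane. -/
def jordanF (c : k) : Module.End k (ℕ × ℕ →₀ k) :=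
  Finsupp.linearCombination k fun i ↦ (-c) ^ (i.1 + i.2) •
    (jordanY ^ i.1) (((jordanZ + jordanY : Module.End k (ℕ × ℕ →₀ k)) ^ i.2) (Finsupp.single (0, 0) 1))

lemma jordanY_single (a b : ℕ) :
    jordanY (Finsupp.single (a, b) (1 : k)) = Finsupp.single (a + 1, b) 1 := by
  simp [jordanY]

lemma jordanZ_single (a b : ℕ) :
    jordanZ (Finsupp.single (a, b) (1 : k)) =
      Finsupp.single (a, b + 1) 1 - (a * (2 : k)⁻¹) • Finsupp.single (a + 1, b) 1 := by
  simp [jordanZ]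

lemma jordanF_single (c : k) (a b : ℕ) :
    jordanF c (Finsupp.single (a, b) (1 : k)) = (-c) ^ (a + b) •
      (jordanY ^ a) (((jordanZ + jordanY : Module.End k (ℕ × ℕ →₀ k)) ^ b) (Finsupp.single (0, 0) 1)) := by
  simp [jordanF]

/-- Two linear maps on the Jordan plane agree if they agree on the basis. -/
lemma jordan_ext {M : Type*} [AddCommGroup M] [Module k M] {f g : (ℕ × ℕ →₀ k) →ₗ[k] M}
    (h : ∀ a b, f (Finsupp.single (a, b) 1) = g (Finsupp.single (a, b) 1)) (n : ℕ × ℕ →₀ k) :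
    f n = g n := by
  congr 1
  exact Finsupp.lhom_ext' fun i ↦ LinearMap.ext_ring (h i.1 i.2)

lemma jordanZ_jordanY (n : ℕ × ℕ →₀ k) :
    jordanZ (jordanY n) = jordanY (jordanZ n) - (2 : k)⁻¹ • jordanY (jordanY n) := by
  refine jordan_ext (f := jordanZ * jordanY)
    (g := jordanY * jordanZ - (2 : k)⁻¹ • (jordanY * jordanY)) (fun a b ↦ ?_) n
  simp only [Module.End.mul_apply, LinearMap.sub_apply, LinearMap.smul_apply, jordanY_single,
    jordanZ_single, map_sub, map_smul]
  push_cast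
  module

lemma jordanZ_jordanY_pow (a : ℕ) (n : ℕ × ℕ →₀ k) :
    jordanZ ((jordanY ^ a) n) =
      (jordanY ^ a) (jordanZ n) - (a * (2 : k)⁻¹) • (jordanY ^ (a + 1)) n := by
  induction a with
  | zero => simp
  | succ a ih =>
    simp only [pow_succ' jordanY, Module.End.mul_apply] at ih ⊢
    rw [jordanZ_jordanY, ih, map_sub, map_smul]
    push_cast
    module

lemma isTwistedJordan (c : k) :
    IsTwistedJordan c jordanY jordanZ (jordanF c) where
  z_y := jordanZ_jordanY
  f_y := by
    refine jordan_ext (f := jordanF c * jordanY) (g := -c • (jordanY * jordanF c)) fun a b ↦ ?_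
    simp only [Module.End.mul_apply, LinearMap.smul_apply, jordanY_single, jordanF_single,
      map_smul, pow_succ' jordanY]
    module
  f_z := by
    refine jordan_ext (f := jordanF c * jordanZ)
      (g := -c • (jordanZ * jordanF c + jordanY * jordanF c)) fun a b ↦ ?_
    simp only [Module.End.mul_apply, LinearMap.smul_apply, LinearMap.add_apply, jordanZ_single,
      jordanF_single, map_smul, map_sub, map_add, jordanZ_jordanY_pow, pow_succ' jordanY,
      pow_succ' (jordanZ + jordanY)]
    rw [← Module.End.mul_apply jordanY (jordanY ^ a), ← pow_succ', pow_succ, Module.End.mul_apply]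
    module

lemma jordanZ_pow_single (b : ℕ) :
    (jordanZ ^ b) (Finsupp.single (0, 0) (1 : k)) = Finsupp.single (0, b) 1 := by
  induction b with
  | zero => simp
  | succ b ih => simp [pow_succ', ih, jordanZ_single]

lemma jordanY_pow_single (a b : ℕ) :
    (jordanY ^ a) (Finsupp.single (0, b) (1 : k)) = Finsupp.single (a, b) 1 := by
  induction a with
  | zero => simp
  | succ a ih => simp [pow_succ', ih, jordanY_single]

end Jordan

section Spanning

variable {k A : Type*} [Field k] [Ring A] [Algebra k A]

/-- The defining relations of the quotient algebra, as rewriting rules for left multiplication;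
`a1, a2, a3, u, y, z, w` stand for `x1, x2, x3, x4, z2, z3, w`. -/
structure DefiningRules (c : k) (a1 a2 a3 u y z w : A) : Prop where
  a1_a1 : ∀ v, a1 * (a1 * v) = 0
  a2_a2 : ∀ v, a2 * (a2 * v) = 0
  a3_a3 : ∀ v, a3 * (a3 * v) = 0
  a2_a1 : ∀ v, a2 * (a1 * v) = -(a1 * (a2 * v))
  a3_a1 : ∀ v, a3 * (a1 * v) = -(a1 * (a3 * v))
  a3_a2 : ∀ v, a3 * (a2 * v) = -(a2 * (a3 * v))
  u_u : ∀ v, u * (u * v) = 0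
  u_a1 : ∀ v, u * (a1 * v) = c • (a1 * (u * v))
  u_a2 : ∀ v, u * (a2 * v) = y * v + c • (a2 * (u * v)) + c • (a1 * (u * v))
  u_a3 : ∀ v, u * (a3 * v) = z * v + c • (a3 * (u * v)) + c • (a2 * (u * v))
  y_a3 : ∀ v, y * (a3 * v) = w * v - c • (a3 * (y * v)) - c • (a2 * (y * v))
  z_y : ∀ v, z * (y * v) = y * (z * v) - (2 : k)⁻¹ • (y * (y * v))
  y_w : ∀ v, y * (w * v) = -c • (w * (y * v))

namespace DefiningRules

variable {c : k} {a1 a2 a3 u y z w : A}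

lemma y_a1 (h : DefiningRules c a1 a2 a3 u y z w) (v : A) :
    y * (a1 * v) = -c • (a1 * (y * v)) := by
  have := h.u_a2 (a1 * v)
  simp only [h.a2_a1, h.u_a1, h.u_a2, h.a1_a1, mul_neg, mul_add, mul_smul_comm] at this
  linear_combination (norm := module) -this

lemma y_a2 (h : DefiningRules c a1 a2 a3 u y z w) (v : A) :
    y * (a2 * v) = -c • (a2 * (y * v)) - c • (a1 * (y * v)) := by
  have := h.u_a2 (a2 * v)
  simp only [h.a2_a1, h.a2_a2, h.u_a2, h.a1_a1, mul_add, mul_smul_comm, mul_zero] at this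
  linear_combination (norm := module) -this

lemma z_a1 (h : DefiningRules c a1 a2 a3 u y z w) (v : A) :
    z * (a1 * v) = -c • (a1 * (z * v)) := by
  have := h.u_a3 (a1 * v)
  simp only [h.a3_a1, h.a2_a1, h.u_a1, h.u_a3, mul_neg, mul_add, mul_smul_comm] at this
  linear_combination (norm := module) -this

lemma z_a3 (h : DefiningRules c a1 a2 a3 u y z w) (v : A) :
    z * (a3 * v) = -c • (a3 * (z * v)) - c • (a2 * (z * v)) := by
  have := h.u_a3 (a3 * v)
  simp only [h.a3_a3, h.a3_a2, h.a2_a2, h.u_a3, mul_add, mul_smul_comm, mul_zero] at this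
  linear_combination (norm := module) -this

lemma z_a2 (h : DefiningRules c a1 a2 a3 u y z w) (v : A) :
    z * (a2 * v) = -(w * v) - c • (a2 * (z * v)) - c • (a1 * (z * v)) := by
  have := h.u_a3 (a2 * v)
  simp only [h.a3_a2, h.a2_a2, h.a3_a1, h.a2_a1, h.u_a2, h.u_a3, h.y_a3, mul_neg, mul_add,
    mul_smul_comm] at this
  linear_combination (norm := module) -this

lemma u_y (h : DefiningRules c a1 a2 a3 u y z w) (v : A) :
    u * (y * v) = -c • (y * (u * v)) := by
  have := h.u_u (a2 * v)
  simp only [h.u_u, h.u_a2, h.u_a1, mul_add, mul_smul_comm, mul_zero] at this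
  linear_combination (norm := module) this

lemma u_z (h : DefiningRules c a1 a2 a3 u y z w) (v : A) :
    u * (z * v) = -c • (z * (u * v) + y * (u * v)) := by
  have := h.u_u (a3 * v)
  simp only [h.u_u, h.u_a3, h.u_a2, mul_add, mul_smul_comm, mul_zero] at this
  linear_combination (norm := module) this

lemma w_a3 (h : DefiningRules c a1 a2 a3 u y z w) (v : A) :
    w * (a3 * v) = c • (a3 * (w * v)) + c • (a2 * (w * v)) := by
  have := h.y_a3 (a3 * v)
  simp only [h.a3_a3, h.a3_a2, h.a2_a2, h.y_a3, mul_sub, mul_smul_comm, mul_zero] at this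
  linear_combination (norm := module) -this

lemma w_a2 (h : DefiningRules c a1 a2 a3 u y z w) (v : A) :
    w * (a2 * v) = c • (a2 * (w * v)) + c • (a1 * (w * v)) := by
  have := h.y_a3 (a2 * v)
  simp only [h.a3_a2, h.a2_a2, h.a3_a1, h.a2_a1, h.y_a3, h.y_a2, mul_sub, mul_neg, mul_smul_comm] at this
  linear_combination (norm := module) -this

lemma w_w [CharZero k] (hc : c ≠ 0) (h : DefiningRules c a1 a2 a3 u y z w) (v : A) :
    w * (w * v) = 0 := by
  have := h.y_w (a3 * v)
  simp only [h.w_a3, h.y_a3, h.y_a2, h.y_w, h.w_a2, mul_sub, mul_add, mul_smul_comm] at this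
  have h2 : (2 * c) • (w * (w * v)) = 0 := by
    linear_combination (norm := module) this
  simpa [hc] using h2

lemma z_w [CharZero k] (h : DefiningRules c a1 a2 a3 u y z w) (v : A) :
    z * (w * v) = -c • (w * (z * v)) := by
  have := h.z_y (a3 * v)
  simp only [h.z_y, h.z_a3, h.z_a2, h.y_a3, h.y_a2, h.y_w, mul_sub, mul_smul_comm] at this
  linear_combination (norm := module) this

lemma u_w [CharZero k] (h : DefiningRules c a1 a2 a3 u y z w) (v : A) :
    u * (w * v) = -c ^ 2 • (w * (u * v)) + (c * 2⁻¹) • (y * (y * v)) := by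
  have := h.u_y (a3 * v)
  simp only [h.z_y, h.u_a3, h.u_a2, h.u_y, h.y_a3, h.y_a2, mul_sub, mul_add, mul_smul_comm] at this
  linear_combination (norm := module) this

variable (k) in
/-- The span of the monomials `z2 ^ a * z3 ^ b * x4 ^ e`. -/
def spanYZU (u y z : A) : Submodule k A :=
  Submodule.span k (Set.range fun i : ℕ × ℕ × Fin 2 ↦ y ^ i.1 * (z ^ i.2.1 * u ^ (i.2.2 : ℕ)))

lemma mem_spanYZU (u y z : A) (a b : ℕ) (e : Fin 2) :
    y ^ a * (z ^ b * u ^ (e : ℕ)) ∈ spanYZU k u y z :=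
  Submodule.subset_span ⟨(a, b, e), rfl⟩

/-- A submodule spanned by a family is stable under left multiplication by `t` as soon as `t`
maps the family into it. -/
lemma mul_mem_span_range {ι : Type*} {f : ι → A} {S : Submodule k A} {t : A}
    (hf : ∀ i, t * f i ∈ S) {n : A} (hn : n ∈ Submodule.span k (Set.range f)) : t * n ∈ S := by
  have : Submodule.span k (Set.range f) ≤ S.comap (LinearMap.mulLeft k t) :=
    Submodule.span_le.2 (by rintro _ ⟨i, rfl⟩; exact hf i)
  exact this hn

lemma y_mul_mem_spanYZU {u y z n : A} (hn : n ∈ spanYZU k u y z) : y * n ∈ spanYZU k u y z :=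
  mul_mem_span_range (fun i ↦ by
    rw [← mul_assoc, ← pow_succ']; exact mem_spanYZU u y z _ _ _) hn

lemma y_pow_mul_mem_spanYZU {u y z n : A} (a : ℕ) (hn : n ∈ spanYZU k u y z) :
    y ^ a * n ∈ spanYZU k u y z := by
  induction a with
  | zero => simpa using hn
  | succ a ih => rw [pow_succ', mul_assoc]; exact y_mul_mem_spanYZU ih

lemma z_mul_y_pow (h : DefiningRules c a1 a2 a3 u y z w) (a : ℕ) (v : A) :
    z * (y ^ a * v) = y ^ a * (z * v) - (a * (2 : k)⁻¹) • (y ^ (a + 1) * v) := by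
  induction a with
  | zero => simp
  | succ a ih =>
    rw [pow_succ', mul_assoc, h.z_y, ih, pow_succ' y (a + 1), pow_succ' y a]
    simp only [mul_sub, mul_smul_comm, mul_assoc]
    push_cast
    module

lemma u_mul_y_pow (h : DefiningRules c a1 a2 a3 u y z w) (a : ℕ) (v : A) :
    u * (y ^ a * v) = (-c) ^ a • (y ^ a * (u * v)) := by
  induction a with
  | zero => simp
  | succ a ih =>
    rw [pow_succ', mul_assoc, h.u_y, ih]
    simp only [mul_smul_comm, mul_assoc]
    module

lemma z_mul_mem_spanYZU (h : DefiningRules c a1 a2 a3 u y z w) {n : A}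
    (hn : n ∈ spanYZU k u y z) : z * n ∈ spanYZU k u y z := by
  refine mul_mem_span_range (fun i ↦ ?_) hn
  rw [h.z_mul_y_pow, ← mul_assoc z, ← pow_succ']
  exact sub_mem (mem_spanYZU _ _ _ _ _ _) (Submodule.smul_mem _ _ (mem_spanYZU _ _ _ _ _ _))

lemma u_mul_z_pow_mem_spanYZU (h : DefiningRules c a1 a2 a3 u y z w) (b : ℕ) (e : Fin 2) :
    u * (z ^ b * u ^ (e : ℕ)) ∈ spanYZU k u y z := by
  induction b with
  | zero =>
    fin_cases e
    · simpa using mem_spanYZU (k := k) u y z 0 0 1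
    · have := h.u_u 1
      simp_all
  | succ b ih =>
    rw [pow_succ', mul_assoc, h.u_z]
    exact Submodule.smul_mem _ _ (add_mem (h.z_mul_mem_spanYZU ih) (y_mul_mem_spanYZU ih))

lemma u_mul_mem_spanYZU (h : DefiningRules c a1 a2 a3 u y z w) {n : A}
    (hn : n ∈ spanYZU k u y z) : u * n ∈ spanYZU k u y z := by
  refine mul_mem_span_range (fun i ↦ ?_) hn
  rw [h.u_mul_y_pow]
  exact Submodule.smul_mem _ _ (y_pow_mul_mem_spanYZU _ (h.u_mul_z_pow_mem_spanYZU _ _))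

variable (k) in
/-- The span of the monomials `w ^ p * z2 ^ a * z3 ^ b * x4 ^ e`. -/
def spanWYZU (u y z w : A) : Submodule k A :=
  Submodule.span k (Set.range fun i : Fin 2 × ℕ × ℕ × Fin 2 ↦
    w ^ (i.1 : ℕ) * (y ^ i.2.1 * (z ^ i.2.2.1 * u ^ (i.2.2.2 : ℕ))))

lemma w_pow_mul_mem_spanWYZU (w : A) (p : Fin 2) {u y z n : A} (hn : n ∈ spanYZU k u y z) :
    w ^ (p : ℕ) * n ∈ spanWYZU k u y z w :=
  mul_mem_span_range (S := spanWYZU k u y z w)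
    (fun i ↦ Submodule.subset_span (Set.mem_range_self (p, i))) hn

lemma mem_spanWYZU (w : A) {u y z n : A} (hn : n ∈ spanYZU k u y z) :
    n ∈ spanWYZU k u y z w := by
  simpa using w_pow_mul_mem_spanWYZU w 0 hn

lemma w_mul_mem_spanWYZU_of_mem_spanYZU (w : A) {u y z n : A} (hn : n ∈ spanYZU k u y z) :
    w * n ∈ spanWYZU k u y z w := by
  simpa using w_pow_mul_mem_spanWYZU w 1 hn

lemma mul_mem_spanWYZU {t : A} (h0 : ∀ n ∈ spanYZU k u y z, t * n ∈ spanWYZU k u y z w)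
    (h1 : ∀ n ∈ spanYZU k u y z, t * (w * n) ∈ spanWYZU k u y z w)
    {n : A} (hn : n ∈ spanWYZU k u y z w) : t * n ∈ spanWYZU k u y z w := by
  refine mul_mem_span_range ?_ hn
  rintro ⟨p, a, b, e⟩
  fin_cases p
  · simpa using h0 _ (mem_spanYZU u y z a b e)
  · simpa using h1 _ (mem_spanYZU u y z a b e)

lemma w_mul_mem_spanWYZU [CharZero k] (hc : c ≠ 0) (h : DefiningRules c a1 a2 a3 u y z w) {n : A}
    (hn : n ∈ spanWYZU k u y z w) : w * n ∈ spanWYZU k u y z w :=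
  mul_mem_spanWYZU (fun _ hn ↦ w_mul_mem_spanWYZU_of_mem_spanYZU w hn)
    (fun _ _ ↦ by rw [h.w_w hc]; exact zero_mem _) hn

lemma y_mul_mem_spanWYZU (h : DefiningRules c a1 a2 a3 u y z w) {n : A}
    (hn : n ∈ spanWYZU k u y z w) : y * n ∈ spanWYZU k u y z w :=
  mul_mem_spanWYZU (fun _ hn ↦ mem_spanWYZU w (y_mul_mem_spanYZU hn))
    (fun _ hn ↦ by
      rw [h.y_w]
      exact Submodule.smul_mem _ _ (w_mul_mem_spanWYZU_of_mem_spanYZU w (y_mul_mem_spanYZU hn))) hn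

lemma z_mul_mem_spanWYZU [CharZero k] (h : DefiningRules c a1 a2 a3 u y z w) {n : A}
    (hn : n ∈ spanWYZU k u y z w) : z * n ∈ spanWYZU k u y z w :=
  mul_mem_spanWYZU (fun _ hn ↦ mem_spanWYZU w (h.z_mul_mem_spanYZU hn))
    (fun _ hn ↦ by
      rw [h.z_w]
      exact Submodule.smul_mem _ _ (w_mul_mem_spanWYZU_of_mem_spanYZU w (h.z_mul_mem_spanYZU hn))) hn

lemma u_mul_mem_spanWYZU [CharZero k] (h : DefiningRules c a1 a2 a3 u y z w) {n : A}
    (hn : n ∈ spanWYZU k u y z w) : u * n ∈ spanWYZU k u y z w :=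
  mul_mem_spanWYZU (fun _ hn ↦ mem_spanWYZU w (h.u_mul_mem_spanYZU hn))
    (fun _ hn ↦ by
      rw [h.u_w]
      exact add_mem (Submodule.smul_mem _ _ (w_mul_mem_spanWYZU_of_mem_spanYZU w (h.u_mul_mem_spanYZU hn)))
        (Submodule.smul_mem _ _ (mem_spanWYZU w (y_mul_mem_spanYZU (y_mul_mem_spanYZU hn))))) hn

variable (k) in
/-- The span of all PBW monomials. -/
def spanPBW (a1 a2 a3 u y z w : A) : Submodule k A :=
  Submodule.span k (Set.range fun i : (Fin 2 × Fin 2 × Fin 2) × Fin 2 × ℕ × ℕ × Fin 2 ↦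
    a1 ^ (i.1.1 : ℕ) * (a2 ^ (i.1.2.1 : ℕ) * (a3 ^ (i.1.2.2 : ℕ) *
      (w ^ (i.2.1 : ℕ) * (y ^ i.2.2.1 * (z ^ i.2.2.2.1 * u ^ (i.2.2.2.2 : ℕ)))))))

lemma ext_mul_mem_spanPBW (a1 a2 a3 : A) (m1 m2 m3 : Fin 2) {u y z w n : A}
    (hn : n ∈ spanWYZU k u y z w) :
    a1 ^ (m1 : ℕ) * (a2 ^ (m2 : ℕ) * (a3 ^ (m3 : ℕ) * n)) ∈ spanPBW k a1 a2 a3 u y z w := by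
  rw [← mul_assoc, ← mul_assoc]
  refine mul_mem_span_range (fun i ↦ ?_) hn
  rw [mul_assoc, mul_assoc]
  exact Submodule.subset_span ⟨((m1, m2, m3), i), rfl⟩

lemma mul_mem_spanPBW {t : A}
    (ht : ∀ m1 m2 m3 : Fin 2, ∀ n ∈ spanWYZU k u y z w,
      t * (a1 ^ (m1 : ℕ) * (a2 ^ (m2 : ℕ) * (a3 ^ (m3 : ℕ) * n))) ∈ spanPBW k a1 a2 a3 u y z w)
    {v : A} (hv : v ∈ spanPBW k a1 a2 a3 u y z w) : t * v ∈ spanPBW k a1 a2 a3 u y z w := by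
  refine mul_mem_span_range ?_ hv
  rintro ⟨⟨m1, m2, m3⟩, i⟩
  exact ht m1 m2 m3 _ (Submodule.subset_span ⟨i, rfl⟩)

lemma a1_mul_mem_spanPBW (h : DefiningRules c a1 a2 a3 u y z w) {v : A}
    (hv : v ∈ spanPBW k a1 a2 a3 u y z w) : a1 * v ∈ spanPBW k a1 a2 a3 u y z w := by
  refine mul_mem_spanPBW (fun m1 m2 m3 n hn ↦ ?_) hv
  fin_cases m1
  · simpa using ext_mul_mem_spanPBW a1 a2 a3 1 m2 m3 hn
  · simp [h.a1_a1]

lemma a2_mul_mem_spanPBW (h : DefiningRules c a1 a2 a3 u y z w) {v : A}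
    (hv : v ∈ spanPBW k a1 a2 a3 u y z w) : a2 * v ∈ spanPBW k a1 a2 a3 u y z w := by
  refine mul_mem_spanPBW (fun m1 m2 m3 n hn ↦ ?_) hv
  have := ext_mul_mem_spanPBW a1 a2 a3 m1 1 m3 hn
  fin_cases m1 <;> fin_cases m2 <;> simp_all [h.a2_a1, h.a2_a2]

lemma a3_mul_mem_spanPBW (h : DefiningRules c a1 a2 a3 u y z w) {v : A}
    (hv : v ∈ spanPBW k a1 a2 a3 u y z w) : a3 * v ∈ spanPBW k a1 a2 a3 u y z w := by
  refine mul_mem_spanPBW (fun m1 m2 m3 n hn ↦ ?_) hv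
  have := ext_mul_mem_spanPBW a1 a2 a3 m1 m2 1 hn
  fin_cases m1 <;> fin_cases m2 <;> fin_cases m3 <;>
    simp_all [h.a3_a1, h.a3_a2, h.a3_a3]

lemma u_mul_mem_spanPBW [CharZero k] (hc : c ≠ 0) (h : DefiningRules c a1 a2 a3 u y z w) {v : A}
    (hv : v ∈ spanPBW k a1 a2 a3 u y z w) : u * v ∈ spanPBW k a1 a2 a3 u y z w := by
  refine mul_mem_spanPBW (fun m1 m2 m3 n hn ↦ ?_) hv
  have e0 {n} (hn : n ∈ spanWYZU k u y z w) := ext_mul_mem_spanPBW a1 a2 a3 0 0 0 hn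
  have e3 {n} (hn : n ∈ spanWYZU k u y z w) := ext_mul_mem_spanPBW a1 a2 a3 0 0 1 hn
  have e2 {n} (hn : n ∈ spanWYZU k u y z w) := ext_mul_mem_spanPBW a1 a2 a3 0 1 0 hn
  have e23 {n} (hn : n ∈ spanWYZU k u y z w) := ext_mul_mem_spanPBW a1 a2 a3 0 1 1 hn
  have e1 {n} (hn : n ∈ spanWYZU k u y z w) := ext_mul_mem_spanPBW a1 a2 a3 1 0 0 hn
  have e13 {n} (hn : n ∈ spanWYZU k u y z w) := ext_mul_mem_spanPBW a1 a2 a3 1 0 1 hn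
  have e12 {n} (hn : n ∈ spanWYZU k u y z w) := ext_mul_mem_spanPBW a1 a2 a3 1 1 0 hn
  have e123 {n} (hn : n ∈ spanWYZU k u y z w) := ext_mul_mem_spanPBW a1 a2 a3 1 1 1 hn
  have hw := h.w_mul_mem_spanWYZU hc hn
  have hy := h.y_mul_mem_spanWYZU hn
  have hz := h.z_mul_mem_spanWYZU hn
  have hu := h.u_mul_mem_spanWYZU hn
  simp only [Fin.val_zero, Fin.val_one, pow_zero, pow_one, one_mul] at e0 e1 e2 e3 e12 e13 e23 e123
  fin_cases m1 <;> fin_cases m2 <;> fin_cases m3 <;>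
    simp only [pow_zero, pow_one, one_mul, h.u_a1, h.u_a2, h.u_a3, h.y_a3, h.a1_a1, h.a2_a2,
      mul_add, mul_sub, mul_smul_comm, smul_add, smul_sub, mul_zero, smul_zero] <;>
    repeat first
      | exact e0 ‹_› | exact e1 ‹_› | exact e2 ‹_› | exact e3 ‹_›
      | exact e12 ‹_› | exact e13 ‹_› | exact e23 ‹_› | exact e123 ‹_›
      | exact zero_mem _
      | apply add_mem | apply sub_mem | apply Submodule.smul_mem | apply neg_mem

lemma one_mem_spanPBW (a1 a2 a3 u y z w : A) : (1 : A) ∈ spanPBW k a1 a2 a3 u y z w :=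
  Submodule.subset_span ⟨((0, 0, 0), 0, 0, 0, 0), by simp⟩

/-- If the generators generate the algebra, the PBW monomials span it. -/
lemma spanPBW_eq_top [CharZero k] (hc : c ≠ 0) (h : DefiningRules c a1 a2 a3 u y z w)
    (hgen : Algebra.adjoin k {a1, a2, a3, u} = ⊤) : spanPBW k a1 a2 a3 u y z w = ⊤ := by
  refine Submodule.eq_top_iff'.2 fun b ↦ ?_
  have hb : b ∈ Algebra.adjoin k {a1, a2, a3, u} := hgen ▸ Algebra.mem_top
  suffices ∀ v ∈ spanPBW k a1 a2 a3 u y z w, b * v ∈ spanPBW k a1 a2 a3 u y z w by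
    simpa using this 1 (one_mem_spanPBW a1 a2 a3 u y z w)
  induction hb using Algebra.adjoin_induction with
  | mem x hx =>
    intro v hv
    rcases hx with rfl | rfl | rfl | rfl
    exacts [h.a1_mul_mem_spanPBW hv, h.a2_mul_mem_spanPBW hv, h.a3_mul_mem_spanPBW hv,
      h.u_mul_mem_spanPBW hc hv]
  | algebraMap r =>
    intro v hv
    rw [← Algebra.smul_def]
    exact Submodule.smul_mem _ _ hv
  | add x y _ _ hx hy =>
    intro v hv
    rw [add_mul]
    exact add_mem (hx v hv) (hy v hv)
  | mul x y _ _ hx hy =>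
    intro v hv
    rw [mul_assoc]
    exact hx _ (hy v hv)

end DefiningRules
end Spanning

section Representation

variable {k : Type*} [Field k]

/-- The action of the generators of the free algebra on `Λ(x1, x2, x3) ⊗ ⟨1, w⟩ ⊗ J ⊗ ⟨1, x4⟩`,
with `J` the Jordan plane. -/
def freeRep (q : k) :
    FreeAlgebra k (Fin 4) →ₐ[k] Module.End k (Fin 8 → Fin 4 → ℕ × ℕ →₀ k) :=
  FreeAlgebra.lift k ![extX1, extX2, extX3,
    extX4 q⁻¹ twW (twJ q⁻¹ jordanY) (twJ q⁻¹ jordanZ) (twU q⁻¹ jordanY (jordanF q⁻¹))]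

lemma freeRep_x1 (q : k) : freeRep q (x1 k) = extX1 := by simp [freeRep, x1]

lemma freeRep_x2 (q : k) : freeRep q (x2 k) = extX2 := by simp [freeRep, x2]

lemma freeRep_x3 (q : k) : freeRep q (x3 k) = extX3 := by simp [freeRep, x3]

lemma freeRep_x4 (q : k) : freeRep q (x4 k) =
    extX4 q⁻¹ twW (twJ q⁻¹ jordanY) (twJ q⁻¹ jordanZ) (twU q⁻¹ jordanY (jordanF q⁻¹)) := by
  simp [freeRep, x4]

lemma freeRep_z2 (q : k) : freeRep q (z2 k q) = extZ2 q⁻¹ twW (twJ q⁻¹ jordanY) := by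
  simp only [z2, map_sub, map_mul, map_smul, map_add, freeRep_x1, freeRep_x2, freeRep_x4,
    extX4_extX2]

lemma freeRep_z3 (q : k) : freeRep q (z3 k q) = extZ3 q⁻¹ twW (twJ q⁻¹ jordanZ) := by
  simp only [z3, map_sub, map_mul, map_smul, map_add, freeRep_x2, freeRep_x3, freeRep_x4,
    extX4_extX3]

lemma freeRep_w (q : k) : freeRep q (w k q) = extW q⁻¹ twW := by
  simp only [w, map_mul, map_smul, map_add, freeRep_x2, freeRep_x3, freeRep_z2, extZ2_extX3]

lemma freeRep_rels [CharZero k] {q : k} (hq : q ≠ 0) {r : FreeAlgebra k (Fin 4)}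
    (hr : r ∈ rels k q) : freeRep q r = 0 := by
  have h := (isTwistedJordan q⁻¹).isTwisted
  rcases hr with rfl | rfl | rfl | rfl | rfl | rfl | rfl | rfl | rfl | rfl <;>
    simp only [map_pow, map_sub, map_add, map_mul, map_smul, freeRep_x1, freeRep_x2, freeRep_x3,
      freeRep_x4, freeRep_z2, freeRep_z3, freeRep_w]
  · exact extX1_sq
  · exact extX2_sq
  · exact extX3_sq
  · exact extX1_extX2
  · exact extX1_extX3
  · exact extX2_extX3
  · exact extX4_sq h
  · rw [extX4_extX1, smul_smul, mul_inv_cancel₀ hq, one_smul, sub_self]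
  · exact extZ3_extZ2 h
  · exact extZ2_extW h

/-- The representation of the quotient algebra induced by `freeRep`. -/
def rep [CharZero k] {q : k} (hq : q ≠ 0) :
    RingQuot (rel k q) →ₐ[k] Module.End k (Fin 8 → Fin 4 → ℕ × ℕ →₀ k) :=
  RingQuot.liftAlgHom k ⟨freeRep q, by rintro _ _ ⟨hr, rfl⟩; rw [freeRep_rels hq hr, map_zero]⟩

/-- The position of a PBW monomial in the basis of the space of the representation. -/
def Idx.position (i : Idx) : (_ : Fin 8) × (_ : Fin 4) × (ℕ × ℕ) :=
  ⟨⟨4 * i.m1 + 2 * i.m2 + i.m3, by omega⟩, ⟨2 * i.p + i.m4, by omega⟩, (i.n2, i.n3)⟩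

lemma Idx.position_injective : Function.Injective Idx.position := by
  rintro ⟨a, b, c, d, e, f, g⟩ ⟨a', b', c', d', e', f', g'⟩ h
  simp only [Idx.position, Sigma.mk.injEq, heq_eq_eq, Fin.mk.injEq, Prod.mk.injEq] at h
  simp only [Idx.mk.injEq, Fin.ext_iff]
  omega

lemma twJ_single_zero_one {P : Type*} [AddCommGroup P] [Module k P] (c : k) (t : Module.End k P)
    (e : Fin 2) (n : P) :
    twJ c t (Pi.single ⟨e, by omega⟩ n) = Pi.single ⟨e, by omega⟩ (t n) := by
  ext i; fin_cases e <;> fin_cases i <;> simp [twJ]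

lemma twJ_pow_single_zero_one {P : Type*} [AddCommGroup P] [Module k P] (c : k)
    (t : Module.End k P) (e : Fin 2) (b : ℕ) (n : P) :
    (twJ c t ^ b) (Pi.single ⟨e, by omega⟩ n) = Pi.single ⟨e, by omega⟩ ((t ^ b) n) := by
  induction b with
  | zero => simp
  | succ b ih => simp only [pow_succ', Module.End.mul_apply, ih, twJ_single_zero_one]

lemma twW_pow_single {P : Type*} [AddCommGroup P] [Module k P] (p e : Fin 2) (n : P) :
    ((twW : Module.End k (Fin 4 → P)) ^ (p : ℕ)) (Pi.single ⟨e, by omega⟩ n) =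
      Pi.single ⟨2 * p + e, by omega⟩ n := by
  ext i; fin_cases p <;> fin_cases e <;> fin_cases i <;> simp [twW]

lemma twU_pow_single {P : Type*} [AddCommGroup P] [Module k P] (c : k) (y f : Module.End k P)
    (e : Fin 2) {n : P} (hn : f n = n) :
    (twU c y f ^ (e : ℕ)) (Pi.single 0 n) = Pi.single ⟨e, by omega⟩ n := by
  ext i; fin_cases e <;> fin_cases i <;> simp [twU, hn]

section ExteriorSingle

variable {N : Type*} [AddCommGroup N] [Module k N] (c : k) (w y z u : Module.End k N)

lemma pow_single_zero {F : Module.End k (Fin 8 → N)} {f : Module.End k N}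
    (h : ∀ n, F (Pi.single 0 n) = Pi.single 0 (f n)) (b : ℕ) (n : N) :
    (F ^ b) (Pi.single 0 n) = Pi.single 0 ((f ^ b) n) := by
  induction b with
  | zero => simp
  | succ b ih => simp only [pow_succ', Module.End.mul_apply, ih, h]

lemma extX4_single_zero (n : N) : extX4 c w y z u (Pi.single 0 n) = Pi.single 0 (u n) := by
  ext i; fin_cases i <;> simp [extX4]

lemma extZ2_single_zero (n : N) : extZ2 c w y (Pi.single 0 n) = Pi.single 0 (y n) := by
  ext i; fin_cases i <;> simp [extZ2]

lemma extZ3_single_zero (n : N) : extZ3 c w z (Pi.single 0 n) = Pi.single 0 (z n) := by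
  ext i; fin_cases i <;> simp [extZ3]

lemma extW_single_zero (n : N) : extW c w (Pi.single 0 n) = Pi.single 0 (w n) := by
  ext i; fin_cases i <;> simp [extW]

lemma ext_pow_single_zero (m1 m2 m3 : Fin 2) (n : N) :
    ((extX1 : Module.End k (Fin 8 → N)) ^ (m1 : ℕ)) (((extX2 : Module.End k (Fin 8 → N)) ^ (m2 : ℕ))
      (((extX3 : Module.End k (Fin 8 → N)) ^ (m3 : ℕ)) (Pi.single 0 n))) =
    Pi.single ⟨4 * m1 + 2 * m2 + m3, by omega⟩ n := by
  ext i
  fin_cases m1 <;> fin_cases m2 <;> fin_cases m3 <;> fin_cases i <;>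
    simp [extX1, extX2, extX3]

end ExteriorSingle

lemma jordanF_one (c : k) :
    jordanF c (Finsupp.single (0, 0) (1 : k)) = Finsupp.single (0, 0) 1 := by
  simp [jordanF_single]

/-- The image of the vacuum vector under a PBW monomial is a vector of the standard basis. -/
lemma rep_mon [CharZero k] {q : k} (hq : q ≠ 0) (i : Idx) :
    rep hq (mon k q i) (Pi.single 0 (Pi.single 0 (Finsupp.single (0, 0) 1))) =
      Pi.basis (fun _ : Fin 8 ↦ Pi.basis fun _ : Fin 4 ↦ Finsupp.basisSingleOne (R := k))
        i.position := by
  rw [mon, rep, RingQuot.liftAlgHom_mkAlgHom_apply]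
  simp only [map_mul, map_pow, freeRep_x1, freeRep_x2, freeRep_x3, freeRep_x4, freeRep_z2,
    freeRep_z3, freeRep_w, Module.End.mul_apply]
  rw [pow_single_zero (extX4_single_zero _ _ _ _ _), twU_pow_single _ _ _ _ (jordanF_one _),
    pow_single_zero (extZ3_single_zero _ _ _), twJ_pow_single_zero_one, jordanZ_pow_single,
    pow_single_zero (extZ2_single_zero _ _ _), twJ_pow_single_zero_one, jordanY_pow_single,
    pow_single_zero (extW_single_zero _ _), twW_pow_single, ext_pow_single_zero]
  simp [Idx.position, Pi.basis_apply]

lemma linearIndependent_mon [CharZero k] {q : k} (hq : q ≠ 0) :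
    LinearIndependent k (mon k q) := by
  let v : Fin 8 → Fin 4 → ℕ × ℕ →₀ k := Pi.single 0 (Pi.single 0 (Finsupp.single (0, 0) 1))
  have h := (Pi.basis (fun _ : Fin 8 ↦ Pi.basis fun _ : Fin 4 ↦
    Finsupp.basisSingleOne (R := k))).linearIndependent.comp _ Idx.position_injective
  have e : (fun i ↦ rep hq (mon k q i) v) = _ := funext fun i ↦ rep_mon hq i
  refine LinearIndependent.of_comp ((LinearMap.applyₗ v).comp (rep hq).toLinearMap) ?_
  change LinearIndependent k fun i ↦ rep hq (mon k q i) v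
  rw [e]
  exact h

end Representation

section Quotient

variable {k : Type*} [Field k]

lemma mkAlgHom_rels {q : k} {r : FreeAlgebra k (Fin 4)} (hr : r ∈ rels k q) :
    RingQuot.mkAlgHom k (rel k q) r = 0 := by
  rw [RingQuot.mkAlgHom_rel k (s := rel k q) (show rel k q r 0 from ⟨hr, rfl⟩), map_zero]

lemma DefiningRules.of_relations {A : Type*} [Ring A] [Algebra k A] {q : k} (hq : q ≠ 0)
    {a1 a2 a3 u y z w : A} (hy : y = u * a2 - q⁻¹ • ((a2 + a1) * u))
    (hz : z = u * a3 - q⁻¹ • ((a3 + a2) * u)) (hw : w = y * a3 + q⁻¹ • ((a3 + a2) * y))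
    (h11 : a1 ^ 2 = 0) (h22 : a2 ^ 2 = 0) (h33 : a3 ^ 2 = 0) (h12 : a1 * a2 + a2 * a1 = 0)
    (h13 : a1 * a3 + a3 * a1 = 0) (h23 : a2 * a3 + a3 * a2 = 0) (h44 : u ^ 2 = 0)
    (h14 : a1 * u - q • (u * a1) = 0) (hzy : z * y - y * z + (2 : k)⁻¹ • y ^ 2 = 0)
    (hyw : y * w + q⁻¹ • (w * y) = 0) : DefiningRules q⁻¹ a1 a2 a3 u y z w := by
  rw [pow_two] at h11 h22 h33 h44 hzy
  have h41 : u * a1 = q⁻¹ • (a1 * u) := by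
    rw [sub_eq_zero.1 h14, smul_smul, inv_mul_cancel₀ hq, one_smul]
  constructor <;> intro v
  · rw [← mul_assoc, h11, zero_mul]
  · rw [← mul_assoc, h22, zero_mul]
  · rw [← mul_assoc, h33, zero_mul]
  · rw [← mul_assoc, eq_neg_of_add_eq_zero_right h12, neg_mul, mul_assoc]
  · rw [← mul_assoc, eq_neg_of_add_eq_zero_right h13, neg_mul, mul_assoc]
  · rw [← mul_assoc, eq_neg_of_add_eq_zero_right h23, neg_mul, mul_assoc]
  · rw [← mul_assoc, h44, zero_mul]
  · rw [← mul_assoc, h41, smul_mul_assoc, mul_assoc]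
  · rw [hy]
    simp only [sub_mul, smul_mul_assoc, add_mul, mul_assoc]
    module
  · rw [hz]
    simp only [sub_mul, smul_mul_assoc, add_mul, mul_assoc]
    module
  · rw [hw]
    simp only [smul_mul_assoc, add_mul, mul_assoc]
    module
  · have := congrArg (· * v) hzy
    simp only [add_mul, sub_mul, smul_mul_assoc, mul_assoc, zero_mul] at this
    linear_combination (norm := module) this
  · rw [← mul_assoc, eq_neg_of_add_eq_zero_left hyw, neg_mul, smul_mul_assoc, mul_assoc, neg_smul]

lemma definingRules {q : k} (hq : q ≠ 0) :
    DefiningRules q⁻¹ (RingQuot.mkAlgHom k (rel k q) (x1 k)) (RingQuot.mkAlgHom k (rel k q) (x2 k))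
      (RingQuot.mkAlgHom k (rel k q) (x3 k)) (RingQuot.mkAlgHom k (rel k q) (x4 k))
      (RingQuot.mkAlgHom k (rel k q) (z2 k q)) (RingQuot.mkAlgHom k (rel k q) (z3 k q))
      (RingQuot.mkAlgHom k (rel k q) (w k q)) := by
  have h : ∀ r ∈ rels k q, RingQuot.mkAlgHom k (rel k q) r = 0 := fun _ ↦ mkAlgHom_rels
  simp only [rels, Set.mem_insert_iff, Set.mem_singleton_iff, forall_eq_or_imp, forall_eq,
    map_add, map_sub, map_mul, map_smul, map_pow] at h
  obtain ⟨h11, h22, h33, h12, h13, h23, h44, h14, hzy, hyw⟩ := h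
  refine .of_relations hq ?_ ?_ ?_ h11 h22 h33 h12 h13 h23 h44 h14 hzy hyw
  · simp [z2]
  · simp [z3]
  · simp [w]

lemma adjoin_generators (q : k) :
    Algebra.adjoin k {RingQuot.mkAlgHom k (rel k q) (x1 k), RingQuot.mkAlgHom k (rel k q) (x2 k),
      RingQuot.mkAlgHom k (rel k q) (x3 k), RingQuot.mkAlgHom k (rel k q) (x4 k)} = ⊤ := by
  have h : Set.range (FreeAlgebra.ι k) = {x1 k, x2 k, x3 k, x4 k} := by
    ext a
    simp [Fin.exists_fin_succ, x1, x2, x3, x4, eq_comm]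
  have := congrArg (Subalgebra.map (RingQuot.mkAlgHom k (rel k q)))
    (FreeAlgebra.adjoin_range_ι (R := k) (X := Fin 4))
  rwa [AlgHom.map_adjoin, h, Algebra.map_top,
    (AlgHom.range_eq_top _).2 (RingQuot.mkAlgHom_surjective k (rel k q)), Set.image_insert_eq,
    Set.image_insert_eq, Set.image_insert_eq, Set.image_singleton] at this

lemma span_mon [CharZero k] {q : k} (hq : q ≠ 0) :
    Submodule.span k (Set.range (mon k q)) = ⊤ := by
  rw [← (definingRules hq).spanPBW_eq_top (inv_ne_zero hq) (adjoin_generators q),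
    DefiningRules.spanPBW]
  congr 1
  ext b
  constructor
  · rintro ⟨i, rfl⟩
    exact ⟨((i.m1, i.m2, i.m3), i.p, i.n2, i.n3, i.m4), by simp [mon, mul_assoc]⟩
  · rintro ⟨⟨⟨m1, m2, m3⟩, p, a, b, e⟩, rfl⟩
    exact ⟨⟨m1, m2, m3, p, a, b, e⟩, by simp [mon, mul_assoc]⟩

end Quotient

theorem statement0 [IsAlgClosed k] [CharZero k] (hq : q ≠ 0) :
    LinearIndependent k (mon k q) ∧
      Submodule.span k (Set.range (mon k q)) = ⊤ := by
  exact ⟨linearIndependent_mon hq, span_mon hq⟩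

end Stmt0
end
end

section
/- Let A be any associative k-algebra containing elements x1,x2,x3,x4 that satisfy x_i² = 0 and x_i·x_j = −x_j·x_i for all i ≠ j in {1,2,3}, together with x4² = 0 and x1·x4 = q·x4·x1. Then the following identities hold in A: z2·x2 = −q⁻¹·(x2+x1)·z2; z3·x2 = −w − q⁻¹·(x2+x1)·z3; x4·z2 = −q⁻¹·z2·x4; z3·x3 = −q⁻¹·(x3+x2)·z3; x4·z3 = −q⁻¹·(z3+z2)·x4; w·x2 = q⁻¹·(x2+x1)·w; w·x3 = q⁻¹·(x3+x2)·w. If in addition z3·z2 − z2·z3 + (1/2)·z2² = 0 holds in A, then x4·w = −q⁻²·w·x4 + (q⁻¹/2)·z2². If moreover z2·w + q⁻¹·w·z2 = 0 also holds in A, then z3·w = −q⁻¹·w·z3 and w² = 0. -/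
/- Statement 1: auxiliary relations in any algebra with the basic relations of 𝔅(𝔈_{3,−}(q))
   (proof of Theorem 4.2 of the paper). -/

theorem statement1 {k A : Type*} [Field k] [IsAlgClosed k] [CharZero k]
    [Ring A] [Algebra k A]
    (q : k) (hq : q ≠ 0) (x1 x2 x3 x4 z2 z3 w : A)
    (hz2 : z2 = x4 * x2 - q⁻¹ • ((x2 + x1) * x4))
    (hz3 : z3 = x4 * x3 - q⁻¹ • ((x3 + x2) * x4))
    (hw : w = z2 * x3 + q⁻¹ • ((x3 + x2) * z2))
    (h1 : x1 ^ 2 = 0) (h2 : x2 ^ 2 = 0) (h3 : x3 ^ 2 = 0)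
    (h12 : x1 * x2 = -(x2 * x1)) (h13 : x1 * x3 = -(x3 * x1))
    (h23 : x2 * x3 = -(x3 * x2))
    (h4 : x4 ^ 2 = 0) (h14 : x1 * x4 = q • (x4 * x1)) :
    (z2 * x2 = -(q⁻¹ • ((x2 + x1) * z2))) ∧
    (z3 * x2 = -w - q⁻¹ • ((x2 + x1) * z3)) ∧
    (x4 * z2 = -(q⁻¹ • (z2 * x4))) ∧
    (z3 * x3 = -(q⁻¹ • ((x3 + x2) * z3))) ∧
    (x4 * z3 = -(q⁻¹ • ((z3 + z2) * x4))) ∧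
    (w * x2 = q⁻¹ • ((x2 + x1) * w)) ∧
    (w * x3 = q⁻¹ • ((x3 + x2) * w)) ∧
    (z3 * z2 - z2 * z3 + (2 : k)⁻¹ • z2 ^ 2 = 0 →
      x4 * w = -((q ^ 2)⁻¹ • (w * x4)) + (q⁻¹ * (2 : k)⁻¹) • z2 ^ 2) ∧
    (z3 * z2 - z2 * z3 + (2 : k)⁻¹ • z2 ^ 2 = 0 →
      z2 * w + q⁻¹ • (w * z2) = 0 →
      z3 * w = -(q⁻¹ • (w * z3)) ∧ w ^ 2 = 0) := by
  have hx4x1 : x4 * x1 = q⁻¹ • (x1 * x4) := by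
    rw [h14, smul_smul, inv_mul_cancel₀ hq, one_smul]
  have hp : q⁻¹ ≠ 0 := inv_ne_zero hq
  rw [← inv_pow]
  generalize q⁻¹ = p at *
  simp only [pow_two] at *
  have h12sq : (x2 + x1) * (x2 + x1) = 0 := by
    linear_combination (norm := noncomm_ring) h1 + h2 + h12
  have h23sq : (x3 + x2) * (x3 + x2) = 0 := by
    linear_combination (norm := noncomm_ring) h2 + h3 + h23
  have hanti : (x3 + x2) * (x2 + x1) + (x2 + x1) * (x3 + x2) = 0 := by
    linear_combination (norm := (noncomm_ring; module)) (2 : k) • h2 + h23 + h12 + h13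
  have z2x2 : z2 * x2 = -(p • ((x2 + x1) * z2)) := by
    subst hz2
    linear_combination (norm := (noncomm_ring; module)) x4 * h2 - (p * p) • (h12sq * x4)
  have z3x2 : z3 * x2 = -w - p • ((x2 + x1) * z3) := by
    subst hw hz2 hz3
    linear_combination (norm := (noncomm_ring; module)) x4 * h23 - (p * p) • (hanti * x4)
  have x4z2 : x4 * z2 = -(p • (z2 * x4)) := by
    subst hz2
    linear_combination (norm := (noncomm_ring; module))
      h4 * x2 - p • (hx4x1 * x4) - (p * p) • (x2 * h4) - (2 : k) • (p * p) • (x1 * h4)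
  have z3x3 : z3 * x3 = -(p • ((x3 + x2) * z3)) := by
    subst hz3
    linear_combination (norm := (noncomm_ring; module)) x4 * h3 - (p * p) • (h23sq * x4)
  have x4z3 : x4 * z3 = -(p • ((z3 + z2) * x4)) := by
    subst hz3 hz2
    linear_combination (norm := (noncomm_ring; module))
      h4 * x3 - (p * p) • ((x3 + (2 : k) • x2 + x1) * h4)
  have z2x3 : z2 * x3 = w - p • ((x3 + x2) * z2) := by
    rw [hw, add_sub_cancel_right]
  have wx2 : w * x2 = p • ((x2 + x1) * w) := by
    linear_combination (norm := (noncomm_ring; module))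
      hw * x2 - p • ((x2 + x1) * hw) + z2 * h23 + p • ((x3 + x2) * z2x2) - z2x2 * x3
      - (p * p) • (hanti * z2)
  have wx3 : w * x3 = p • ((x3 + x2) * w) := by
    linear_combination (norm := (noncomm_ring; module))
      hw * x3 - p • ((x3 + x2) * hw) + z2 * h3 - (p * p) • (h23sq * z2)
  refine ⟨z2x2, z3x2, x4z2, z3x3, x4z3, wx2, wx3, fun hz => ?_, fun hz hzw => ⟨?_, ?_⟩⟩
  · have x4x2 : x4 * x2 = z2 + p • ((x2 + x1) * x4) := by rw [hz2, sub_add_cancel]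
    have x4x3 : x4 * x3 = z3 + p • ((x3 + x2) * x4) := by rw [hz3, sub_add_cancel]
    linear_combination (norm := (noncomm_ring; module))
      x4 * hw + x4z2 * x3 - p • (z2 * x4x3) + p • ((x4x3 + x4x2) * z2) + (p * p) •
      ((x3 + (2 : k) • x2 + x1) * x4z2) + p • hz - (p * p) • (z2x2 * x4) - (p * p) • (z2x3 * x4)
  · linear_combination (norm := (noncomm_ring; module))
      z3 * hw + hz * x3 + z2 * z3x3 + p • ((z3x3 + z3x2) * z2) + p • (hw * z3) - p • (z2x2 * z3)
      - (p * p) • ((x3 + (2 : k) • x2 + x1) * hz) - (2 : k)⁻¹ • (z2 * z2x3)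
      + (2 : k)⁻¹ • p • (z2x3 * z2) + (2 : k)⁻¹ • p • (z2x2 * z2) - (2 : k)⁻¹ • hzw
  · have hww : (p * 2) • (w * w) = 0 := by
      linear_combination (norm := (noncomm_ring; module))
        p • (w * hw) + hzw * x3 - z2 * wx3 + (p * p) • ((wx3 + wx2) * z2) - p • (z2x3 * w)
        - p • (z2x2 * w) + (p * p) • ((x3 + (2 : k) • x2 + x1) * hzw)
    exact (smul_eq_zero_iff_right (mul_ne_zero hp two_ne_zero)).1 hww
end

section
/- Let B be the quotient of the free associative algebra k⟨x1,x2,x3,x4⟩ by the two-sided ideal generated by: x_i·x_j + x_j·x_i for i ≠ j in {1,2,3}; x_i² for i ∈ {1,2,3}; x4·x1 − q⁻¹·x1·x4; x4·x42 − q⁻¹·x42·x4; x4·x443 − q⁻¹·x443·x4; x443·x42 + q⁻¹·x42·x443; x443·x43 + q⁻¹·(x43 + 2·x42)·x443; x4·w − q⁻³·w·x4 + 2·q⁻²·x42·u; x43·u − u·x43 + x42·u; x42·w + q⁻¹·w·x42; x43·w + q⁻¹·w·x43. Then the images in B of the monomials x1^{m1}·x2^{m2}·x3^{m3}·v^{p1}·x42^{p2}·w^{p3}·u^{p4}·x43^{p5}·x443^{p6}·x4^{p7},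 where m1,m2,m3,p2,p3,p6 ∈ {0,1} and p1,p4,p5,p7 ∈ ℕ, form a k-vector space basis of B. -/
/- Statement 2: PBW basis of the Nichols algebra 𝔅(𝔈_{3,+}(q)) (Theorem 4.3 of the paper). -/

noncomputable section
namespace Stmt2

variable (k : Type*) [Field k] (q : k)

def x1 : FreeAlgebra k (Fin 4) := FreeAlgebra.ι k 0
def x2 : FreeAlgebra k (Fin 4) := FreeAlgebra.ι k 1
def x3 : FreeAlgebra k (Fin 4) := FreeAlgebra.ι k 2
def x4 : FreeAlgebra k (Fin 4) := FreeAlgebra.ι k 3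

/-- x42 := x4·x2 − q⁻¹·(x2+x1)·x4 -/
def x42 : FreeAlgebra k (Fin 4) := x4 k * x2 k - q⁻¹ • ((x2 k + x1 k) * x4 k)
/-- x43 := x4·x3 − q⁻¹·(x3+x2)·x4 -/
def x43 : FreeAlgebra k (Fin 4) := x4 k * x3 k - q⁻¹ • ((x3 k + x2 k) * x4 k)
/-- x443 := x4·x43 − q⁻¹·(x43+x42)·x4 -/
def x443 : FreeAlgebra k (Fin 4) :=
  x4 k * x43 k q - q⁻¹ • ((x43 k q + x42 k q) * x4 k)
/-- v := x42·x3 + q⁻¹·(x3+x2)·x42 -/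
def v : FreeAlgebra k (Fin 4) := x42 k q * x3 k + q⁻¹ • ((x3 k + x2 k) * x42 k q)
/-- u := x43·x42 + x42·x43 -/
def u : FreeAlgebra k (Fin 4) := x43 k q * x42 k q + x42 k q * x43 k q
/-- w := x43·v − q⁻¹·v·x43 -/
def w : FreeAlgebra k (Fin 4) := x43 k q * v k q - q⁻¹ • (v k q * x43 k q)

/-- The defining relations. -/
def rels : Set (FreeAlgebra k (Fin 4)) :=
  { x1 k * x2 k + x2 k * x1 k,
    x1 k * x3 k + x3 k * x1 k,
    x2 k * x3 k + x3 k * x2 k,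
    x1 k ^ 2, x2 k ^ 2, x3 k ^ 2,
    x4 k * x1 k - q⁻¹ • (x1 k * x4 k),
    x4 k * x42 k q - q⁻¹ • (x42 k q * x4 k),
    x4 k * x443 k q - q⁻¹ • (x443 k q * x4 k),
    x443 k q * x42 k q + q⁻¹ • (x42 k q * x443 k q),
    x443 k q * x43 k q + q⁻¹ • ((x43 k q + (2 : k) • x42 k q) * x443 k q),
    x4 k * w k q - (q ^ 3)⁻¹ • (w k q * x4 k) + ((2 : k) * (q ^ 2)⁻¹) • (x42 k q * u k q),
    x43 k q * u k q - u k q * x43 k q + x42 k q * u k q,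
    x42 k q * w k q + q⁻¹ • (w k q * x42 k q),
    x43 k q * w k q + q⁻¹ • (w k q * x43 k q) }

def rel (a b : FreeAlgebra k (Fin 4)) : Prop := a ∈ rels k q ∧ b = 0

/-- The index set of the PBW monomials. -/
structure Idx where
  m1 : Fin 2
  m2 : Fin 2
  m3 : Fin 2
  p1 : ℕ
  p2 : Fin 2
  p3 : Fin 2
  p4 : ℕ
  p5 : ℕ
  p6 : Fin 2
  p7 : ℕ

/-- The PBW monomials x1^{m1}·x2^{m2}·x3^{m3}·v^{p1}·x42^{p2}·w^{p3}·u^{p4}·x43^{p5}·x443^{p6}·x4^{p7}. -/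
def mon (i : Idx) : RingQuot (rel k q) :=
  RingQuot.mkAlgHom k (rel k q)
    (x1 k ^ (i.m1 : ℕ) * x2 k ^ (i.m2 : ℕ) * x3 k ^ (i.m3 : ℕ) * v k q ^ i.p1 *
      x42 k q ^ (i.p2 : ℕ) * w k q ^ (i.p3 : ℕ) * u k q ^ i.p4 * x43 k q ^ i.p5 *
      x443 k q ^ (i.p6 : ℕ) * x4 k ^ i.p7)

section Rewriting

/-- Words in the ten PBW generators `x₁, x₂, x₃, v, x₄₂, w, u, x₄₃, x₄₄₃, x₄`, in this order. -/
abbrev Word := List (Fin 10)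

/-- A formal sum of terms `c * q ^ n • w`, each stored as `(c, n, w)`. -/
abbrev Poly := List (ℤ × ℤ × Word)

/-- A rule `(a, b, r)` rewrites the two-letter word `a b` to `r`. -/
abbrev Rule := Fin 10 × Fin 10 × Poly

/-- The sum `x * p * y`. -/
def wrap (x y : Word) (p : Poly) : Poly := p.map fun t => (t.1, t.2.1, x ++ t.2.2 ++ y)

/-- The sum `c * q ^ n • p`. -/
def scale (c n : ℤ) (p : Poly) : Poly := p.map fun t => (c * t.1, n + t.2.1, t.2.2)

def lookup : List Rule → Fin 10 → Fin 10 → Option Poly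
  | [], _, _ => none
  | (a', b', r) :: tbl, a, b => if a' = a then if b' = b then some r else lookup tbl a b
      else lookup tbl a b

/-- Rewrite the leftmost reducible pair of a word. -/
def rewrite (tbl : List Rule) : Word → Option Poly
  | [] => none
  | [_] => none
  | a :: b :: l => match lookup tbl a b with
    | some r => some (wrap [] l r)
    | none => (rewrite tbl (b :: l)).map (wrap [a] [])

/-- Add a term, merging it with a like term and dropping zero coefficients. -/
def insertTerm (c n : ℤ) (l : Word) : Poly → Poly
  | [] => [(c, n, l)]
  | (c', n', l') :: p => if n = n' ∧ l = l' then if c + c' = 0 then p else (c + c', n, l) :: p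
      else (c', n', l') :: insertTerm c n l p

def merge (p₁ p₂ : Poly) : Poly := p₁.foldr (fun t p => insertTerm t.1 t.2.1 t.2.2 p) p₂

def reduceStep (tbl : List Rule) : Poly → Poly
  | [] => []
  | (c, n, l) :: p => match rewrite tbl l with
    | none => insertTerm c n l (reduceStep tbl p)
    | some r => merge (scale c n r) (reduceStep tbl p)

def reduce (tbl : List Rule) : ℕ → Poly → Poly
  | 0, p => p
  | n + 1, p => reduce tbl n (reduceStep tbl p)

/-- The difference of the two ways of rewriting `a b c`, where `a b` rewrites to `r` and `b c` to
`s`. -/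
def overlap (a c : Fin 10) (r s : Poly) : Poly := wrap [] [c] r ++ scale (-1) 0 (wrap [a] [] s)

variable {k : Type*} [Field k] {q : k} {M : Type*} [AddCommGroup M] [Module k M]

/-- The value of a formal sum when words are evaluated by `φ`. -/
def evalPoly (q : k) (φ : Word → M) (p : Poly) : M :=
  (p.map fun t => ((t.1 : k) * q ^ t.2.1) • φ t.2.2).sum

@[simp] lemma evalPoly_nil (φ : Word → M) : evalPoly q φ [] = 0 := rfl

@[simp] lemma evalPoly_cons (φ : Word → M) (t : ℤ × ℤ × Word) (p : Poly) :
    evalPoly q φ (t :: p) = ((t.1 : k) * q ^ t.2.1) • φ t.2.2 + evalPoly q φ p := by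
  simp [evalPoly]

lemma evalPoly_append (φ : Word → M) (p₁ p₂ : Poly) :
    evalPoly q φ (p₁ ++ p₂) = evalPoly q φ p₁ + evalPoly q φ p₂ := by
  simp [evalPoly]

lemma evalPoly_wrap (φ : Word → M) (x y : Word) (p : Poly) :
    evalPoly q φ (wrap x y p) = evalPoly q (fun l => φ (x ++ l ++ y)) p := by
  simp [evalPoly, wrap, Function.comp_def]

lemma evalPoly_scale (hq : q ≠ 0) (φ : Word → M) (c n : ℤ) (p : Poly) :
    evalPoly q φ (scale c n p) = ((c : k) * q ^ n) • evalPoly q φ p := by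
  induction p with
  | nil => simp [scale]
  | cons t p ih =>
    rw [evalPoly_cons, smul_add, ← ih, smul_smul]
    simp only [scale, List.map_cons, evalPoly_cons, Int.cast_mul, zpow_add₀ hq]
    congr 2
    ring

lemma evalPoly_congr {φ ψ : Word → M} {p : Poly} (h : ∀ t ∈ p, φ t.2.2 = ψ t.2.2) :
    evalPoly q φ p = evalPoly q ψ p := by
  unfold evalPoly
  congr 1
  exact List.map_congr_left fun t ht => by rw [h t ht]

lemma map_evalPoly {M' : Type*} [AddCommGroup M'] [Module k M'] (f : M →ₗ[k] M') (φ : Word → M)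
    (p : Poly) : f (evalPoly q φ p) = evalPoly q (fun l => f (φ l)) p := by
  induction p with
  | nil => simp
  | cons t p ih => simp [ih]

lemma evalPoly_mem {S : Submodule k M} {φ : Word → M} {p : Poly} (h : ∀ t ∈ p, φ t.2.2 ∈ S) :
    evalPoly q φ p ∈ S := by
  refine S.toAddSubmonoid.list_sum_mem fun x hx => ?_
  obtain ⟨t, ht, rfl⟩ := List.mem_map.1 hx
  exact S.smul_mem _ (h t ht)

lemma evalPoly_comm (φ : Word → Word → M) (p₁ p₂ : Poly) :
    evalPoly q (fun l => evalPoly q (φ l) p₂) p₁ =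
      evalPoly q (fun l' => evalPoly q (fun l => φ l l') p₁) p₂ := by
  induction p₁ with
  | nil =>
    simp [evalPoly]
  | cons t p ih =>
    rw [evalPoly_cons, ih]
    clear ih
    induction p₂ with
    | nil => simp
    | cons s p₂ ih =>
      simp only [evalPoly_cons] at ih ⊢
      rw [← ih]
      simp only [smul_add, smul_smul]
      rw [mul_comm]
      abel

lemma evalPoly_insertTerm (φ : Word → M) (c n : ℤ) (l : Word) (p : Poly) :
    evalPoly q φ (insertTerm c n l p) = ((c : k) * q ^ n) • φ l + evalPoly q φ p := by
  induction p with
  | nil => simp [insertTerm]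
  | cons t p ih =>
    obtain ⟨c', n', l'⟩ := t
    unfold insertTerm
    split_ifs with h h0
    · obtain ⟨rfl, rfl⟩ := h
      have : (c : k) + c' = 0 := by rw [← Int.cast_add, h0, Int.cast_zero]
      rw [evalPoly_cons, ← add_assoc, ← add_smul, ← add_mul, this]
      simp
    · obtain ⟨rfl, rfl⟩ := h
      simp only [evalPoly_cons, Int.cast_add, add_mul, add_smul, add_assoc]
    · rw [evalPoly_cons, ih, evalPoly_cons, add_left_comm]

lemma evalPoly_merge (φ : Word → M) (p₁ p₂ : Poly) :
    evalPoly q φ (merge p₁ p₂) = evalPoly q φ p₁ + evalPoly q φ p₂ := by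
  induction p₁ with
  | nil => simp [merge]
  | cons t p ih =>
    rw [evalPoly_cons, add_assoc, ← ih, ← evalPoly_insertTerm]
    rfl

variable {S : Word → Prop}

lemma forall_mem_insertTerm {c n : ℤ} {l : Word} {p : Poly} (hl : S l) (hp : ∀ t ∈ p, S t.2.2) :
    ∀ t ∈ insertTerm c n l p, S t.2.2 := by
  induction p with
  | nil => simpa [insertTerm] using hl
  | cons t p ih =>
    have hp' := List.forall_mem_cons.1 hp
    unfold insertTerm
    split_ifs
    · exact hp'.2
    · exact List.forall_mem_cons.2 ⟨hl, hp'.2⟩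
    · exact List.forall_mem_cons.2 ⟨hp'.1, ih hp'.2⟩

lemma forall_mem_merge {p₁ p₂ : Poly} (h₁ : ∀ t ∈ p₁, S t.2.2) (h₂ : ∀ t ∈ p₂, S t.2.2) :
    ∀ t ∈ merge p₁ p₂, S t.2.2 := by
  induction p₁ with
  | nil => exact h₂
  | cons t p ih =>
    have h := List.forall_mem_cons.1 h₁
    exact forall_mem_insertTerm h.1 (ih h.2)

lemma forall_mem_scale {c n : ℤ} {p : Poly} (h : ∀ t ∈ p, S t.2.2) :
    ∀ t ∈ scale c n p, S t.2.2 := by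
  exact List.forall_mem_map.2 h

lemma forall_mem_wrap {x y : Word} {p : Poly} (h : ∀ t ∈ p, S (x ++ t.2.2 ++ y)) :
    ∀ t ∈ wrap x y p, S t.2.2 := by
  exact List.forall_mem_map.2 h

lemma reduceStep_spec (hq : q ≠ 0) {tbl : List Rule} {φ : Word → M}
    (h : ∀ l p, rewrite tbl l = some p → S l →
      φ l = evalPoly q φ p ∧ ∀ t ∈ p, S t.2.2) {p : Poly} (hp : ∀ t ∈ p, S t.2.2) :
    evalPoly q φ (reduceStep tbl p) = evalPoly q φ p ∧ ∀ t ∈ reduceStep tbl p, S t.2.2 := by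
  induction p with
  | nil => simp [reduceStep]
  | cons t p ih =>
    obtain ⟨c, n, l⟩ := t
    obtain ⟨hl, hp⟩ := List.forall_mem_cons.1 hp
    obtain ⟨ih₁, ih₂⟩ := ih hp
    cases hr : rewrite tbl l with
    | none =>
      simp only [reduceStep, hr]
      exact ⟨by rw [evalPoly_insertTerm, ih₁, evalPoly_cons], forall_mem_insertTerm hl ih₂⟩
    | some r =>
      obtain ⟨h₁, h₂⟩ := h l r hr hl
      simp only [reduceStep, hr]
      exact ⟨by rw [evalPoly_merge, evalPoly_scale hq, ih₁, evalPoly_cons, ← h₁],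
        forall_mem_merge (forall_mem_scale h₂) ih₂⟩

lemma evalPoly_reduce (hq : q ≠ 0) {tbl : List Rule} {φ : Word → M}
    (h : ∀ l p, rewrite tbl l = some p → S l →
      φ l = evalPoly q φ p ∧ ∀ t ∈ p, S t.2.2) (fuel : ℕ) {p : Poly} (hp : ∀ t ∈ p, S t.2.2) :
    evalPoly q φ (reduce tbl fuel p) = evalPoly q φ p := by
  induction fuel generalizing p with
  | zero => rfl
  | succ n ih =>
    obtain ⟨h₁, h₂⟩ := reduceStep_spec hq h hp
    rw [reduce, ih h₂, h₁]

lemma mem_of_lookup {tbl : List Rule} {a b : Fin 10} {r : Poly} (h : lookup tbl a b = some r) :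
    (a, b, r) ∈ tbl := by
  induction tbl with
  | nil => simp [lookup] at h
  | cons e tbl ih =>
    obtain ⟨a', b', r'⟩ := e
    unfold lookup at h
    split_ifs at h with ha hb
    · simp_all
    · exact List.mem_cons_of_mem _ (ih h)
    · exact List.mem_cons_of_mem _ (ih h)

lemma exists_of_rewrite {tbl : List Rule} {l : Word} {p : Poly} (h : rewrite tbl l = some p) :
    ∃ x a b r y, l = x ++ a :: b :: y ∧ lookup tbl a b = some r ∧ p = wrap x y r := by
  induction l generalizing p with
  | nil => simp [rewrite] at h
  | cons a l ih =>
    cases l with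
    | nil => simp [rewrite] at h
    | cons b l =>
      rw [rewrite] at h
      split at h
      · rename_i r hr
        exact ⟨[], a, b, r, l, rfl, hr, (Option.some.inj h).symm⟩
      · obtain ⟨p', hp', rfl⟩ := Option.map_eq_some_iff.1 h
        obtain ⟨x, a', b', r, y, hl, hr, rfl⟩ := ih hp'
        exact ⟨a :: x, a', b', r, y, by rw [hl]; rfl, hr, by simp [wrap]⟩

lemma rewrite_eq_none_iff {tbl : List Rule} {l : Word} :
    rewrite tbl l = none ↔ l.IsChain fun a b => lookup tbl a b = none := by
  induction l with
  | nil => simp [rewrite]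
  | cons a l ih =>
    cases l with
    | nil => simp [rewrite]
    | cons b l =>
      rw [rewrite, List.isChain_cons_cons, ← ih]
      cases lookup tbl a b <;> simp

end Rewriting

section Table

/-- A new rule `(a, b, r)`, the three-letter word whose overlap ambiguity yields it, and the
coefficient `c * q ^ n` with which `a b - r` occurs in the reduced ambiguity. -/
abbrev Derivation := Rule × (Fin 10 × Fin 10 × Fin 10) × ℤ × ℤ

def baseRules : List Rule :=
  [(1, 0, [(-1, 0, [0, 1])]),
   (2, 0, [(-1, 0, [0, 2])]),
   (2, 1, [(-1, 0, [1, 2])]),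
   (0, 0, []),
   (1, 1, []),
   (2, 2, []),
   (9, 0, [(1, -1, [0, 9])]),
   (9, 1, [(1, -1, [0, 9]), (1, -1, [1, 9]), (1, 0, [4])]),
   (9, 2, [(1, -1, [1, 9]), (1, -1, [2, 9]), (1, 0, [7])]),
   (9, 7, [(1, -1, [4, 9]), (1, -1, [7, 9]), (1, 0, [8])]),
   (4, 2, [(-1, -1, [1, 4]), (-1, -1, [2, 4]), (1, 0, [3])]),
   (7, 4, [(-1, 0, [4, 7]), (1, 0, [6])]),
   (7, 3, [(1, -1, [3, 7]), (1, 0, [5])]),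
   (9, 4, [(1, -1, [4, 9])]),
   (9, 8, [(1, -1, [8, 9])]),
   (8, 4, [(-1, -1, [4, 8])]),
   (8, 7, [(-2, -1, [4, 8]), (-1, -1, [7, 8])]),
   (9, 5, [(-2, -2, [4, 6]), (1, -3, [5, 9])]),
   (7, 6, [(-1, 0, [4, 6]), (1, 0, [6, 7])]),
   (5, 4, [(-1, 1, [4, 5])]),
   (7, 5, [(-1, -1, [5, 7])])]

def derivations : List Derivation :=
  [((8, 8, []), (9, 8, 7), (2, -1)),
   ((4, 0, [(-1, -1, [0, 4])]), (9, 1, 0), (1, 0)),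
   ((3, 0, [(1, -1, [0, 3])]), (4, 2, 0), (1, 0)),
   ((6, 5, [(1, -2, [5, 6])]), (7, 5, 4), (1, 1)),
   ((7, 0, [(-1, -1, [0, 7])]), (9, 2, 0), (1, 0)),
   ((5, 0, [(-1, -2, [0, 5])]), (7, 3, 0), (1, 0)),
   ((6, 0, [(1, -2, [0, 6])]), (7, 4, 0), (1, 0)),
   ((8, 0, [(-1, -2, [0, 8])]), (9, 7, 0), (1, 0)),
   ((3, 2, [(1, -1, [1, 3]), (1, -1, [2, 3])]), (4, 2, 2), (1, 0)),
   ((4, 1, [(-1, -1, [0, 4]), (-1, -1, [1, 4])]), (9, 1, 1), (1, 0)),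
   ((4, 4, []), (9, 4, 1), (2, -1)),
   ((4, 3, [(1, -1, [3, 4])]), (4, 4, 2), (-1, 0)),
   ((6, 3, [(1, -2, [3, 6])]), (7, 4, 3), (1, 0)),
   ((6, 4, [(1, 0, [4, 6])]), (7, 4, 4), (1, 0)),
   ((8, 6, [(1, -2, [6, 8])]), (8, 7, 4), (-1, 0)),
   ((9, 6, [(1, -2, [6, 9])]), (9, 7, 4), (-1, 0)),
   ((3, 1, [(1, -1, [0, 3]), (1, -1, [1, 3])]), (4, 2, 1), (1, 0)),
   ((7, 2, [(-1, -1, [1, 7]), (-1, -1, [2, 7])]), (9, 2, 2), (1, 0)),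
   ((8, 5, [(-1, -4, [5, 8]), (2, -3, [6, 6])]), (9, 7, 5), (1, 0)),
   ((9, 3, [(1, -2, [3, 9]), (1, -1, [6])]), (9, 4, 2), (-1, 0)),
   ((6, 1, [(2, -2, [0, 6]), (1, -2, [1, 6])]), (9, 3, 1), (1, -1)),
   ((8, 3, [(1, -3, [3, 8]), (-2, -2, [4, 6])]), (9, 7, 3), (1, 0)),
   ((7, 1, [(-1, -1, [0, 7]), (-1, -1, [1, 7]), (-1, 0, [3])]), (9, 2, 1), (1, 0)),
   ((5, 1, [(-2, -2, [0, 5]), (-1, -2, [1, 5])]), (7, 3, 1), (1, 0)),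
   ((5, 3, [(1, -1, [3, 5])]), (7, 5, 1), (1, -1)),
   ((5, 5, []), (7, 5, 3), (-2, -1)),
   ((8, 1, [(-2, -2, [0, 8]), (-1, -2, [1, 8]), (-2, -1, [6])]), (9, 7, 1), (1, 0)),
   ((5, 2, [(-1, -2, [0, 5]), (-2, -2, [1, 5]), (-1, -2, [2, 5]), (-1, -1, [3, 3])]), (7, 3, 2),
      (1, 0)),
   ((6, 2, [(1, -2, [0, 6]), (2, -2, [1, 6]), (1, -2, [2, 6]), (1, -1, [3, 4]), (1, 0, [5])]),
      (7, 4, 2), (1, 0)),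
   ((8, 2, [(-1, -2, [0, 8]), (-2, -2, [1, 8]), (-1, -2, [2, 8]), (-2, -1, [4, 7]),
      (-2, -1, [7, 7])]), (9, 7, 2), (1, 0))]

/-- All the rewriting rules. -/
def rules : List Rule := derivations.foldl (fun tbl d => d.1 :: tbl) baseRules

/-- Whether the ambiguity of a derivation reduces to `c * q ^ n` times its rule. -/
def checkDerivation (tbl : List Rule) : Derivation → Bool
  | ((a, b, r), (x, y, z), c, n) => match lookup tbl x y, lookup tbl y z with
    | some s, some s' => c ≠ 0 ∧ reduce tbl 20
        (overlap x z s s' ++ scale (-c) n ((1, 0, [a, b]) :: scale (-1) 0 r)) = []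
    | _, _ => false

def checkDerivations : List Rule → List Derivation → Bool
  | _, [] => true
  | tbl, d :: ds => checkDerivation tbl d && checkDerivations (d.1 :: tbl) ds

def checkOverlap (tbl : List Rule) (a b c : Fin 10) : Bool :=
  match lookup tbl a b, lookup tbl b c with
    | some r, some s => reduce tbl 20 (overlap a c r s) = []
    | _, _ => true

lemma checkDerivations_base : checkDerivations baseRules derivations = true := by
  decide +kernel

lemma checkOverlap_rules : ∀ a b c, checkOverlap rules a b c = true := by
  decide +kernel

end Table

section NormalForm

/-- The total degree of each generator as an element of the free algebra. -/
def weight : Fin 10 → ℕ := ![1, 1, 1, 3, 2, 5, 4, 2, 3, 1]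

def degree (l : Word) : ℕ := (l.map weight).sum

/-- A numerical form of the lexicographic order on words of equal degree. -/
def rank : Word → ℕ
  | [] => 0
  | a :: l => (a + 1) * 11 ^ degree (a :: l) + rank l

/-- The order on words for which all the rewriting rules are decreasing. -/
def Smaller (l l' : Word) : Prop := degree l = degree l' ∧ rank l < rank l'

instance : DecidableRel Smaller := fun _ _ => inferInstanceAs (Decidable (_ ∧ _))

lemma degree_append (l l' : Word) : degree (l ++ l') = degree l + degree l' := by
  simp [degree]

lemma rank_append (l l' : Word) : rank (l ++ l') = rank l * 11 ^ degree l' + rank l' := by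
  induction l with
  | nil => simp [rank]
  | cons a l ih =>
    rw [List.cons_append, rank, rank, ih, ← List.cons_append, degree_append, pow_add]
    ring

lemma Smaller.append {l l' : Word} (h : Smaller l l') (x y : Word) :
    Smaller (x ++ l ++ y) (x ++ l' ++ y) := by
  refine ⟨by simp only [degree_append, h.1], ?_⟩
  simp only [rank_append, h.1]
  gcongr
  exact h.2

lemma Smaller.trans {l l' l'' : Word} (h : Smaller l l') (h' : Smaller l' l'') : Smaller l l'' :=
  ⟨h.1.trans h'.1, h.2.trans h'.2⟩

lemma smaller_of_mem_rules :
    ∀ e ∈ rules, ∀ t ∈ e.2.2, Smaller t.2.2 [e.1, e.2.1] := by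
  decide +kernel

lemma smaller_of_lookup {a b : Fin 10} {r : Poly} (h : lookup rules a b = some r) :
    ∀ t ∈ r, Smaller t.2.2 [a, b] :=
  smaller_of_mem_rules _ (mem_of_lookup h)

lemma smaller_of_rewrite {l : Word} {p : Poly} (h : rewrite rules l = some p) :
    ∀ t ∈ p, Smaller t.2.2 l := by
  obtain ⟨x, a, b, r, y, rfl, hr, rfl⟩ := exists_of_rewrite h
  refine forall_mem_wrap (S := fun l => Smaller l _) fun t ht => ?_
  simpa using (smaller_of_lookup hr t ht).append x y

variable {k : Type*} [Field k] (q : k)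

/-- Normal forms of words, computed with a bounded number of rewriting steps. -/
def boundedNormalForm : ℕ → Word → (Word →₀ k)
  | 0, l => Finsupp.single l 1
  | n + 1, l => match rewrite rules l with
    | none => Finsupp.single l 1
    | some p => evalPoly q (boundedNormalForm n) p

def normalForm (l : Word) : Word →₀ k := boundedNormalForm q (rank l + 1) l

lemma boundedNormalForm_eq {n m : ℕ} {l : Word} (hn : rank l < n) (hm : rank l < m) :
    boundedNormalForm q n l = boundedNormalForm q m l := by
  induction n generalizing m l with
  | zero => omega
  | succ n ih =>
    obtain ⟨m, rfl⟩ := Nat.exists_eq_succ_of_ne_zero (Nat.ne_zero_of_lt hm)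
    rw [boundedNormalForm, boundedNormalForm]
    split
    · rfl
    · rename_i p hp
      refine evalPoly_congr fun t ht => ?_
      have := (smaller_of_rewrite hp t ht).2
      exact ih (by omega) (by omega)

lemma normalForm_of_rewrite_eq_none {l : Word} (h : rewrite rules l = none) :
    normalForm q l = Finsupp.single l 1 := by
  simp [normalForm, boundedNormalForm, h]

lemma normalForm_of_rewrite_eq_some {l : Word} {p : Poly} (h : rewrite rules l = some p) :
    normalForm q l = evalPoly q (normalForm q) p := by
  rw [normalForm, boundedNormalForm, h]
  refine evalPoly_congr fun t ht => boundedNormalForm_eq q ?_ ?_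
  · exact (smaller_of_rewrite h t ht).2
  · exact Nat.lt_succ_self _

/-- Rewriting any reducible pair of `l` leaves its normal form unchanged. -/
def Invariant (l : Word) : Prop :=
  ∀ x a b r y, l = x ++ a :: b :: y → lookup rules a b = some r →
    normalForm q l = evalPoly q (normalForm q) (wrap x y r)

variable {q}

lemma evalPoly_overlap (hq : q ≠ 0) {x y : Word} {a b c : Fin 10} {r s : Poly}
    (hr : lookup rules a b = some r) (hs : lookup rules b c = some s)
    (ih : ∀ l, rank l < rank (x ++ [a, b, c] ++ y) → Invariant q l) :
    evalPoly q (normalForm q) (wrap x (c :: y) r) =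
      evalPoly q (normalForm q) (wrap (x ++ [a]) y s) := by
  have hred : reduce rules 20 (overlap a c r s) = [] := by
    simpa [checkOverlap, hr, hs] using checkOverlap_rules a b c
  have key : evalPoly q (fun l => normalForm q (x ++ l ++ y)) (overlap a c r s) = 0 := by
    rw [← evalPoly_reduce hq (S := fun l => Smaller l [a, b, c]) (tbl := rules) _ 20, hred]
    · rfl
    · refine List.forall_mem_append.2
        ⟨forall_mem_wrap (S := fun l => Smaller l [a, b, c]) fun t ht => ?_,
        forall_mem_scale (S := fun l => Smaller l [a, b, c])
          (forall_mem_wrap (S := fun l => Smaller l [a, b, c]) fun t ht => ?_)⟩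
      · exact (smaller_of_lookup hr t ht).append [] [c]
      · simpa using (smaller_of_lookup hs t ht).append [a] []
    · intro l p hp hl
      refine ⟨?_, fun t ht => (smaller_of_rewrite hp t ht).trans hl⟩
      obtain ⟨u, a', b', r', z, rfl, hr', rfl⟩ := exists_of_rewrite hp
      rw [ih _ (hl.append x y).2 (x ++ u) a' b' r' (z ++ y) (by simp) hr', evalPoly_wrap,
        evalPoly_wrap]
      simp
  rw [overlap, evalPoly_append, evalPoly_scale hq, evalPoly_wrap, evalPoly_wrap] at key
  rw [evalPoly_wrap, evalPoly_wrap]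
  simpa [add_neg_eq_zero] using key

lemma evalPoly_wrap_eq_of_length_le (hq : q ≠ 0) {l : Word}
    (ih : ∀ l', rank l' < rank l → Invariant q l') {x x' y y' : Word} {a a' b b' : Fin 10}
    {r r' : Poly} (hl : l = x ++ a :: b :: y) (hl' : l = x' ++ a' :: b' :: y')
    (hr : lookup rules a b = some r) (hr' : lookup rules a' b' = some r')
    (hx : x.length ≤ x'.length) :
    evalPoly q (normalForm q) (wrap x y r) = evalPoly q (normalForm q) (wrap x' y' r') := by
  obtain ⟨z, rfl, hz⟩ : ∃ z, x' = x ++ z ∧ a :: b :: y = z ++ a' :: b' :: y' := by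
    rcases List.append_eq_append_iff.1 (hl.symm.trans hl') with ⟨z, h₁, h₂⟩ | ⟨z, rfl, h₂⟩
    · exact ⟨z, h₁, h₂⟩
    · obtain rfl : z = [] := by
        rw [← List.length_eq_zero_iff]
        simp only [List.length_append] at hx
        omega
      exact ⟨[], by simp, by simpa using h₂.symm⟩
  match z with
  | [] =>
    simp only [List.nil_append, List.cons.injEq] at hz
    obtain ⟨rfl, rfl, rfl⟩ := hz
    obtain rfl : r = r' := Option.some.inj (hr.symm.trans hr')
    simp
  | [c] =>
    simp only [List.cons_append, List.nil_append, List.cons.injEq] at hz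
    obtain ⟨rfl, rfl, rfl⟩ := hz
    refine evalPoly_overlap hq hr hr' fun l' h => ih l' (h.trans_eq ?_)
    rw [hl]
    simp
  | c :: d :: z =>
    simp only [List.cons_append, List.cons.injEq] at hz
    obtain ⟨rfl, rfl, rfl⟩ := hz
    have h₁ : evalPoly q (fun t => normalForm q (x ++ t ++ (z ++ a' :: b' :: y'))) r =
        evalPoly q (fun t => evalPoly q (fun s => normalForm q (x ++ t ++ z ++ s ++ y')) r') r := by
      refine evalPoly_congr fun t ht => ?_
      rw [ih _ _ (x ++ t.2.2 ++ z) a' b' r' y' (by simp) hr', evalPoly_wrap]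
      rw [hl]
      simpa using ((smaller_of_lookup hr t ht).append x (z ++ a' :: b' :: y')).2
    have h₂ : evalPoly q (fun s => normalForm q (x ++ a :: b :: z ++ s ++ y')) r' =
        evalPoly q (fun s => evalPoly q (fun t => normalForm q (x ++ t ++ z ++ s ++ y')) r) r' := by
      refine evalPoly_congr fun s hs => ?_
      rw [ih _ _ x a b r (z ++ s.2.2 ++ y') (by simp) hr, evalPoly_wrap]
      · simp
      rw [hl]
      simpa using ((smaller_of_lookup hr' s hs).append (x ++ a :: b :: z) y').2
    rw [evalPoly_wrap, evalPoly_wrap, h₁, evalPoly_comm, h₂]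

lemma invariant (hq : q ≠ 0) (l : Word) : Invariant q l := by
  induction h : rank l using Nat.strong_induction_on generalizing l with
  | _ n ih =>
    subst h
    replace ih : ∀ l', rank l' < rank l → Invariant q l' := fun l' h => ih _ h l' rfl
    intro x a b r y hl hr
    cases hp : rewrite rules l with
    | none =>
      rw [rewrite_eq_none_iff, hl, List.isChain_append, List.isChain_cons_cons, hr] at hp
      simp at hp
    | some p =>
      rw [normalForm_of_rewrite_eq_some q hp]
      obtain ⟨x', a', b', r', y', hl', hr', rfl⟩ := exists_of_rewrite hp
      rcases le_total x'.length x.length with h | h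
      · exact evalPoly_wrap_eq_of_length_le hq ih hl' hl hr' hr h
      · exact (evalPoly_wrap_eq_of_length_le hq ih hl hl' hr hr' h).symm

variable (q) in
/-- Left multiplication by a generator on formal sums of words modulo the rewriting rules. -/
def leftMul (a : Fin 10) : Module.End k (Word →₀ k) :=
  Finsupp.linearCombination k fun l => normalForm q (a :: l)

lemma leftMul_single (a : Fin 10) (l : Word) :
    leftMul q a (Finsupp.single l 1) = normalForm q (a :: l) := by
  simp [leftMul]

lemma leftMul_normalForm (hq : q ≠ 0) (a : Fin 10) (l : Word) :
    leftMul q a (normalForm q l) = normalForm q (a :: l) := by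
  induction h : rank l using Nat.strong_induction_on generalizing l with
  | _ n ih =>
    subst h
    cases hp : rewrite rules l with
    | none => rw [normalForm_of_rewrite_eq_none q hp, leftMul_single]
    | some p =>
      rw [normalForm_of_rewrite_eq_some q hp, map_evalPoly,
        evalPoly_congr (ψ := fun l => normalForm q (a :: l))
          fun t ht => ih _ (smaller_of_rewrite hp t ht).2 _ rfl]
      obtain ⟨x, b, c, r, y, rfl, hr, rfl⟩ := exists_of_rewrite hp
      rw [← List.cons_append, invariant hq _ (a :: x) b c r y rfl hr, evalPoly_wrap, evalPoly_wrap]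
      rfl

/-- The product of the values of the letters of a word. -/
def evalWord {A : Type*} [Monoid A] (g : Fin 10 → A) (l : Word) : A := (l.map g).prod

lemma evalWord_leftMul_single (hq : q ≠ 0) {l : Word} (hl : l ≠ []) (l' : Word) :
    evalWord (leftMul q) l (Finsupp.single l' 1) = normalForm q (l ++ l') := by
  induction l with
  | nil => exact absurd rfl hl
  | cons a l ih =>
    rw [evalWord, List.map_cons, List.prod_cons, Module.End.mul_apply]
    cases l with
    | nil => simp [leftMul_single]
    | cons b l =>
      rw [← evalWord, ih (List.cons_ne_nil _ _), leftMul_normalForm hq]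
      rfl

lemma evalWord_leftMul_of_rewrite_eq_none (hq : q ≠ 0) {l : Word} (hl : rewrite rules l = none) :
    evalWord (leftMul q) l (Finsupp.single [] 1) = Finsupp.single l 1 := by
  cases l with
  | nil => rfl
  | cons a l =>
    rw [evalWord_leftMul_single hq (List.cons_ne_nil _ _), List.append_nil,
      normalForm_of_rewrite_eq_none q hl]

lemma leftMul_mul_leftMul (hq : q ≠ 0) {a b : Fin 10} {r : Poly}
    (hr : lookup rules a b = some r) :
    leftMul q a * leftMul q b = evalPoly q (evalWord (leftMul q)) r := by
  refine Finsupp.lhom_ext' fun l => LinearMap.ext_ring ?_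
  have hne : ∀ t ∈ r, t.2.2 ≠ [] := by
    intro t ht h
    have h₁ := (smaller_of_lookup hr t ht).1
    have h₂ : 0 < weight a := by fin_cases a <;> decide
    rw [h] at h₁
    simp [degree] at h₁
    omega
  have h₁ : (leftMul q a * leftMul q b) (Finsupp.single l 1) = normalForm q (a :: b :: l) := by
    rw [Module.End.mul_apply, leftMul_single, leftMul_normalForm hq]
  have h₂ : evalPoly q (evalWord (leftMul q)) r (Finsupp.single l 1) =
      normalForm q (a :: b :: l) := by
    rw [invariant hq (a :: b :: l) [] a b r l rfl hr, evalPoly_wrap]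
    refine (map_evalPoly (LinearMap.applyₗ (R := k) (Finsupp.single l 1))
      (evalWord (leftMul q)) r).trans ?_
    exact evalPoly_congr fun t ht => evalWord_leftMul_single hq (hne t ht) l
  exact h₁.trans h₂.symm

end NormalForm

section Algebra

variable {k : Type*} [Field k] {q : k} {A : Type*} [Ring A] [Algebra k A] {g : Fin 10 → A}

lemma evalWord_append (l l' : Word) : evalWord g (l ++ l') = evalWord g l * evalWord g l' := by
  simp [evalWord]

lemma evalPoly_evalWord_wrap (x y : Word) (p : Poly) :
    evalPoly q (evalWord g) (wrap x y p) =
      evalWord g x * evalPoly q (evalWord g) p * evalWord g y := by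
  have h := map_evalPoly (q := q) (LinearMap.mulLeftRight k (evalWord g x, evalWord g y))
    (evalWord g) p
  simp only [LinearMap.mulLeftRight_apply] at h
  simp only [evalPoly_wrap, evalWord_append, h]

variable (q g) in
/-- The rules hold for the elements `g` of an algebra. -/
def Valid (tbl : List Rule) : Prop :=
  ∀ e ∈ tbl, g e.1 * g e.2.1 = evalPoly q (evalWord g) e.2.2

lemma Valid.evalWord_of_rewrite {tbl : List Rule} (h : Valid q g tbl) {l : Word} {p : Poly}
    (hp : rewrite tbl l = some p) : evalWord g l = evalPoly q (evalWord g) p := by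
  obtain ⟨x, a, b, r, y, rfl, hr, rfl⟩ := exists_of_rewrite hp
  rw [evalPoly_evalWord_wrap, ← h _ (mem_of_lookup hr), List.append_cons, List.append_cons]
  simp [evalWord, mul_assoc]

lemma Valid.cons_of_checkDerivation [CharZero k] (hq : q ≠ 0) {tbl : List Rule}
    (h : Valid q g tbl) {d : Derivation} (hd : checkDerivation tbl d = true) :
    Valid q g (d.1 :: tbl) := by
  obtain ⟨⟨a, b, r⟩, ⟨x, y, z⟩, c, n⟩ := d
  cases hs : lookup tbl x y with
  | none => simp [checkDerivation, hs] at hd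
  | some s =>
  cases hs' : lookup tbl y z with
  | none => simp [checkDerivation, hs, hs'] at hd
  | some s' =>
    simp only [checkDerivation, hs, hs'] at hd
    obtain ⟨hc, hred⟩ := of_decide_eq_true hd
    have key := evalPoly_reduce hq (S := fun _ => True) (tbl := tbl) (φ := evalWord g)
      (fun l p hp _ => ⟨h.evalWord_of_rewrite hp, fun _ _ => trivial⟩) 20
      (p := overlap x z s s' ++ scale (-c) n ((1, 0, [a, b]) :: scale (-1) 0 r))
      (fun _ _ => trivial)
    rw [hred, overlap] at key
    simp only [evalPoly_append, evalPoly_scale hq, evalPoly_cons, evalPoly_evalWord_wrap,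
      ← h _ (mem_of_lookup hs), ← h _ (mem_of_lookup hs'), evalPoly_nil] at key
    have hab : g a * g b = evalPoly q (evalWord g) r := by
      have hcn : ((c : k) * q ^ n) ≠ 0 :=
        mul_ne_zero (Int.cast_ne_zero.2 hc) (zpow_ne_zero _ hq)
      refine smul_right_injective A hcn ?_
      simp only [evalWord, List.map_cons, List.map_nil, List.prod_cons, List.prod_nil, mul_one,
        one_mul, Int.cast_neg, Int.cast_one, zpow_zero, one_smul, neg_smul, neg_mul, mul_assoc,
        add_neg_cancel, zero_add] at key
      rw [← sub_eq_zero, ← smul_sub, sub_eq_add_neg, ← neg_eq_zero]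
      exact key.symm
    exact List.forall_mem_cons.2 ⟨hab, h⟩

lemma Valid.foldl_of_checkDerivations [CharZero k] (hq : q ≠ 0) {tbl : List Rule}
    (h : Valid q g tbl) {ds : List Derivation} (hd : checkDerivations tbl ds = true) :
    Valid q g (ds.foldl (fun tbl d => d.1 :: tbl) tbl) := by
  induction ds generalizing tbl with
  | nil => exact h
  | cons d ds ih =>
    obtain ⟨h₁, h₂⟩ := Bool.and_eq_true_iff.1 hd
    exact ih (h.cons_of_checkDerivation hq h₁) h₂

lemma Valid.rules [CharZero k] (hq : q ≠ 0) (h : Valid q g baseRules) : Valid q g rules :=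
  h.foldl_of_checkDerivations hq checkDerivations_base

lemma Valid.evalWord_mem_span (h : Valid q g Stmt2.rules) (l : Word) :
    evalWord g l ∈
      Submodule.span k (evalWord g '' {l | rewrite Stmt2.rules l = none}) := by
  induction hn : rank l using Nat.strong_induction_on generalizing l with
  | _ n ih =>
    subst hn
    cases hp : rewrite Stmt2.rules l with
    | none => exact Submodule.subset_span ⟨l, hp, rfl⟩
    | some p =>
      rw [h.evalWord_of_rewrite hp]
      exact evalPoly_mem fun t ht => ih _ (smaller_of_rewrite hp t ht).2 _ rfl

end Algebra

section Exponents

/-- The word of a PBW monomial. -/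
def Idx.word (i : Idx) : Word :=
  List.replicate i.m1 0 ++ List.replicate i.m2 1 ++ List.replicate i.m3 2 ++
    List.replicate i.p1 3 ++ List.replicate i.p2 4 ++ List.replicate i.p3 5 ++
    List.replicate i.p4 6 ++ List.replicate i.p5 7 ++ List.replicate i.p6 8 ++
    List.replicate i.p7 9

lemma Idx.word_injective : Function.Injective Idx.word := by
  intro i j h
  have hc : ∀ a, i.word.count a = j.word.count a := fun a => by rw [h]
  obtain ⟨m1, m2, m3, p1, p2, p3, p4, p5, p6, p7⟩ := i
  obtain ⟨m1', m2', m3', p1', p2', p3', p4', p5', p6', p7'⟩ := j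
  simp only [Idx.word, List.count_append, List.count_replicate] at hc
  have h0 := hc 0
  have h1 := hc 1
  have h2 := hc 2
  have h3 := hc 3
  have h4 := hc 4
  have h5 := hc 5
  have h6 := hc 6
  have h7 := hc 7
  have h8 := hc 8
  have h9 := hc 9
  simp at h0 h1 h2 h3 h4 h5 h6 h7 h8 h9
  simp only [Idx.mk.injEq]
  omega

/-- The generators occurring with exponent at most one. -/
def squareFree : List (Fin 10) := [0, 1, 2, 4, 5, 8]

lemma lookup_rules_eq_none_iff :
    ∀ a b, lookup rules a b = none ↔ a < b ∨ a = b ∧ a ∉ squareFree := by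
  decide +kernel

lemma rewrite_rules_eq_none_iff {l : Word} :
    rewrite rules l = none ↔ l.Pairwise fun a b => a < b ∨ a = b ∧ a ∉ squareFree := by
  have : IsTrans (Fin 10) fun a b => a < b ∨ a = b ∧ a ∉ squareFree := by
    refine ⟨fun a b c hab hbc => ?_⟩
    rcases hab with hab | ⟨rfl, ha⟩
    · rcases hbc with hbc | ⟨rfl, -⟩
      · exact Or.inl (hab.trans hbc)
      · exact Or.inl hab
    · exact hbc
  simp only [rewrite_eq_none_iff, lookup_rules_eq_none_iff, List.isChain_iff_pairwise]

lemma pairwise_replicate_append_iff {n : ℕ} {a : Fin 10} {l : Word} (hl : ∀ b ∈ l, a < b) :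
    (List.replicate n a ++ l).Pairwise (fun a b => a < b ∨ a = b ∧ a ∉ squareFree) ↔
      (n ≤ 1 ∨ a ∉ squareFree) ∧
        l.Pairwise (fun a b => a < b ∨ a = b ∧ a ∉ squareFree) := by
  simp only [List.pairwise_append, List.pairwise_replicate, List.mem_replicate]
  grind

lemma exists_eq_replicate_append {a : Fin 10} {l : Word}
    (h : l.Pairwise (fun a b => a < b ∨ a = b ∧ a ∉ squareFree)) (hl : ∀ b ∈ l, a ≤ b) :
    ∃ n l', l = List.replicate n a ++ l' ∧ (∀ b ∈ l', a < b) ∧ (n ≤ 1 ∨ a ∉ squareFree) ∧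
      l'.Pairwise (fun a b => a < b ∨ a = b ∧ a ∉ squareFree) := by
  obtain ⟨n, l', rfl, hl'⟩ : ∃ n l', l = List.replicate n a ++ l' ∧ ∀ b ∈ l', a < b := by
    induction l with
    | nil => exact ⟨0, [], rfl, by simp⟩
    | cons c l ih =>
      rw [List.pairwise_cons] at h
      rcases (hl c List.mem_cons_self).eq_or_lt with rfl | hc
      · obtain ⟨n, l', rfl, hl'⟩ := ih h.2 fun b hb => hl b (List.mem_cons_of_mem _ hb)
        exact ⟨n + 1, l', rfl, hl'⟩
      · refine ⟨0, c :: l, rfl, List.forall_mem_cons.2 ⟨hc, fun b hb => ?_⟩⟩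
        rcases h.1 b hb with hcb | ⟨rfl, -⟩
        · exact hc.trans hcb
        · exact hc
  exact ⟨n, l', rfl, hl', (pairwise_replicate_append_iff hl').1 h⟩

lemma Idx.rewrite_word (i : Idx) : rewrite rules i.word = none := by
  have h : ∀ m : Fin 2, (m : ℕ) ≤ 1 := by decide
  rw [rewrite_rules_eq_none_iff, Idx.word]
  simp only [List.append_assoc]
  rw [← List.append_nil (List.replicate i.p7 9)]
  repeat rw [pairwise_replicate_append_iff (by simp +contextual [or_imp])]
  simp [h, squareFree]

lemma exists_word_eq {l : Word} (h : rewrite rules l = none) : ∃ i : Idx, i.word = l := by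
  rw [rewrite_rules_eq_none_iff] at h
  obtain ⟨n0, l, rfl, hl, h0, h⟩ := exists_eq_replicate_append (a := 0) h (by simp)
  obtain ⟨n1, l, rfl, hl, h1, h⟩ := exists_eq_replicate_append (a := 1) h hl
  obtain ⟨n2, l, rfl, hl, h2, h⟩ := exists_eq_replicate_append (a := 2) h hl
  obtain ⟨n3, l, rfl, hl, h3, h⟩ := exists_eq_replicate_append (a := 3) h hl
  obtain ⟨n4, l, rfl, hl, h4, h⟩ := exists_eq_replicate_append (a := 4) h hl
  obtain ⟨n5, l, rfl, hl, h5, h⟩ := exists_eq_replicate_append (a := 5) h hl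
  obtain ⟨n6, l, rfl, hl, h6, h⟩ := exists_eq_replicate_append (a := 6) h hl
  obtain ⟨n7, l, rfl, hl, h7, h⟩ := exists_eq_replicate_append (a := 7) h hl
  obtain ⟨n8, l, rfl, hl, h8, h⟩ := exists_eq_replicate_append (a := 8) h hl
  obtain ⟨n9, l, rfl, hl, h9, h⟩ := exists_eq_replicate_append (a := 9) h hl
  obtain rfl : l = [] := List.eq_nil_iff_forall_not_mem.2 fun b hb => by
    have := hl b hb
    omega
  simp only [squareFree, List.mem_cons, List.not_mem_nil, true_or, or_true, not_true, or_false,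
    Fin.isValue] at h0 h1 h2 h4 h5 h8
  refine ⟨⟨⟨n0, ?_⟩, ⟨n1, ?_⟩, ⟨n2, ?_⟩, n3, ⟨n4, ?_⟩, ⟨n5, ?_⟩, n6, n7, ⟨n8, ?_⟩, n9⟩, ?_⟩
  on_goal 7 => simp [Idx.word]
  all_goals omega

end Exponents

section Presentation

variable {k : Type*} [Field k] {q : k}

variable (k q) in
/-- The PBW generators in the free algebra. -/
def generator : Fin 10 → FreeAlgebra k (Fin 4) :=
  ![x1 k, x2 k, x3 k, v k q, x42 k q, w k q, u k q, x43 k q, x443 k q, x4 k]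

lemma mkAlgHom_eq_zero {a : FreeAlgebra k (Fin 4)} (ha : a ∈ rels k q) :
    RingQuot.mkAlgHom k (rel k q) a = 0 := by
  rw [RingQuot.mkAlgHom_rel k (show rel k q a 0 from ⟨ha, rfl⟩), map_zero]

/-- The base rules say that the derived generators are given by their defining formulas and that
the defining relations hold. -/
lemma valid_baseRules_iff {A : Type*} [Ring A] [Algebra k A] (hq : q ≠ 0)
    (f : FreeAlgebra k (Fin 4) →ₐ[k] A) {g : Fin 10 → A} (h0 : f (x1 k) = g 0)
    (h1 : f (x2 k) = g 1) (h2 : f (x3 k) = g 2) (h9 : f (x4 k) = g 9) :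
    Valid q g baseRules ↔ (∀ a, f (generator k q a) = g a) ∧ ∀ a ∈ rels k q, f a = 0 := by
  simp only [Valid, baseRules, List.forall_mem_cons, List.not_mem_nil, false_imp_iff, forall_const,
    and_true, evalPoly_cons, evalPoly_nil, evalWord, List.map_cons, List.map_nil, List.prod_cons,
    List.prod_nil, mul_one, add_zero, Int.cast_neg, Int.cast_one, Int.cast_ofNat, zpow_neg,
    zpow_ofNat, one_mul, neg_mul, neg_smul]
  constructor
  · rintro ⟨r1, r2, r3, r4, r5, r6, r7, e42, e43, e443, ev, eu, ew, r8, r9, r10, r11, r12, r13,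
      r14, r15⟩
    have h4 : f (x42 k q) = g 4 := by
      simp only [x42, map_sub, map_smul, map_mul, map_add, h0, h1, h9, e42, add_mul]
      module
    have h7 : f (x43 k q) = g 7 := by
      simp only [x43, map_sub, map_smul, map_mul, map_add, h1, h2, h9, e43, add_mul]
      module
    have h8 : f (x443 k q) = g 8 := by
      simp only [x443, map_sub, map_smul, map_mul, map_add, h4, h7, h9, e443, add_mul]
      module
    have h3 : f (v k q) = g 3 := by
      simp only [v, map_smul, map_mul, map_add, h1, h2, h4, ev, add_mul]
      module
    have h6 : f (u k q) = g 6 := by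
      simp only [u, map_mul, map_add, h4, h7, eu]
      module
    have h5 : f (w k q) = g 5 := by
      simp only [w, map_sub, map_smul, map_mul, h3, h7, ew]
      module
    refine ⟨fun a => by fin_cases a <;> assumption, ?_⟩
    simp only [rels, Set.mem_insert_iff, Set.mem_singleton_iff, forall_eq_or_imp, forall_eq,
      map_add, map_sub, map_mul, map_smul, pow_two, h0, h1, h2, h4, h5, h6, h7, h8,
      h9, r1, r2, r3, r4, r5, r6, r7, r8, r9, r10, r11, r12, r13, r14, r15, add_mul,
      smul_mul_assoc]
    refine ⟨?_, ?_, ?_, trivial, trivial, trivial, ?_, ?_, ?_, ?_, ?_, ?_, ?_, ?_, ?_⟩ <;>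
      match_scalars <;> field_simp <;> ring
  · rintro ⟨hg, hr⟩
    have h3 := hg 3
    have h4 := hg 4
    have h5 := hg 5
    have h6 := hg 6
    have h7 := hg 7
    have h8 := hg 8
    change f (v k q) = g 3 at h3
    change f (x42 k q) = g 4 at h4
    change f (w k q) = g 5 at h5
    change f (u k q) = g 6 at h6
    change f (x43 k q) = g 7 at h7
    change f (x443 k q) = g 8 at h8
    simp only [rels, Set.mem_insert_iff, Set.mem_singleton_iff, forall_eq_or_imp, forall_eq,
      map_add, map_sub, map_mul, map_smul, pow_two, h0, h1, h2, h4, h5, h6, h7, h8,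
      h9, add_mul, smul_mul_assoc] at hr
    obtain ⟨r1, r2, r3, r4, r5, r6, r7, r8, r9, r10, r11, r12, r13, r14, r15⟩ := hr
    have e42 := h4
    have e43 := h7
    have e443 := h8
    have ev := h3
    have eu := h6
    have ew := h5
    simp only [x42, map_sub, map_smul, map_mul, map_add, h0, h1, h9, add_mul] at e42
    simp only [x43, map_sub, map_smul, map_mul, map_add, h1, h2, h9, add_mul] at e43
    simp only [x443, map_sub, map_smul, map_mul, map_add, h4, h7, h9, add_mul] at e443
    simp only [v, map_smul, map_mul, map_add, h1, h2, h4, add_mul] at ev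
    simp only [u, map_mul, map_add, h4, h7] at eu
    simp only [w, map_sub, map_smul, map_mul, h3, h7] at ew
    refine ⟨?_, ?_, ?_, r4, r5, r6, ?_, ?_, ?_, ?_, ?_, ?_, ?_, ?_, ?_, ?_, ?_, ?_, ?_, ?_, ?_⟩
    · linear_combination (norm := module) r1
    · linear_combination (norm := module) r2
    · linear_combination (norm := module) r3
    · linear_combination (norm := module) r7
    · linear_combination (norm := module) e42
    · linear_combination (norm := module) e43
    · linear_combination (norm := module) e443
    · linear_combination (norm := module) ev
    · linear_combination (norm := module) eu
    · linear_combination (norm := module) ew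
    · linear_combination (norm := module) r8
    · linear_combination (norm := module) r9
    · linear_combination (norm := module) r10
    · linear_combination (norm := module) r11
    · linear_combination (norm := module) r12
    · linear_combination (norm := module) r13
    · linear_combination (norm := (match_scalars <;> field_simp <;> ring)) q • r14
    · linear_combination (norm := module) r15

lemma mon_eq (i : Idx) :
    mon k q i = evalWord (fun a => RingQuot.mkAlgHom k (rel k q) (generator k q a)) i.word := by
  simp [mon, evalWord, Idx.word, generator, mul_assoc]

lemma linearIndependent_mon (hq : q ≠ 0) : LinearIndependent k (mon k q) := by
  have hvalid : Valid q (leftMul q) baseRules := fun e he => by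
    have hmem : ∀ e ∈ baseRules, lookup rules e.1 e.2.1 = some e.2.2 := by decide +kernel
    exact leftMul_mul_leftMul hq (hmem e he)
  let f : FreeAlgebra k (Fin 4) →ₐ[k] Module.End k (Word →₀ k) :=
    FreeAlgebra.lift k ![leftMul q 0, leftMul q 1, leftMul q 2, leftMul q 9]
  obtain ⟨hg, hr⟩ := (valid_baseRules_iff hq f (FreeAlgebra.lift_ι_apply _ _)
    (FreeAlgebra.lift_ι_apply _ _) (FreeAlgebra.lift_ι_apply _ _)
    (FreeAlgebra.lift_ι_apply _ _)).1 hvalid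
  let F : RingQuot (rel k q) →ₐ[k] Module.End k (Word →₀ k) :=
    RingQuot.liftAlgHom k ⟨f, fun a b hab => by rw [hab.2, map_zero, hr a hab.1]⟩
  let ψ : RingQuot (rel k q) →ₗ[k] (Word →₀ k) :=
    LinearMap.applyₗ (R := k) (Finsupp.single [] 1) ∘ₗ F.toLinearMap
  have hψ : ψ ∘ mon k q = fun i : Idx => Finsupp.single i.word 1 := by
    ext1 i
    have hF : F (mon k q i) = evalWord (leftMul q) i.word := by
      simp only [mon_eq, evalWord, map_list_prod, List.map_map]
      congr 2
      ext1 a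
      simp [F, hg]
    change F (mon k q i) (Finsupp.single [] 1) = _
    rw [hF, evalWord_leftMul_of_rewrite_eq_none hq i.rewrite_word]
  refine LinearIndependent.of_comp ψ ?_
  rw [hψ]
  exact (Finsupp.linearIndependent_single_one k Word).comp Idx.word Idx.word_injective

lemma span_evalWord (q : k) : Submodule.span k (Set.range
    (evalWord fun a => RingQuot.mkAlgHom k (rel k q) (generator k q a))) = ⊤ := by
  set π := RingQuot.mkAlgHom k (rel k q)
  set S := Submodule.span k (Set.range (evalWord fun a => π (generator k q a)))
  have hmul : ∀ a ∈ S, ∀ b ∈ S, a * b ∈ S := by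
    intro a ha b hb
    have hab := Submodule.mul_mem_mul ha hb
    rw [Submodule.span_mul_span] at hab
    refine Submodule.span_mono ?_ hab
    rintro _ ⟨_, ⟨l, rfl⟩, _, ⟨l', rfl⟩, rfl⟩
    exact ⟨l ++ l', evalWord_append l l'⟩
  have hgen : ∀ a, π (generator k q a) ∈ S := fun a =>
    Submodule.subset_span ⟨[a], by simp [evalWord]⟩
  refine eq_top_iff.2 fun b _ => ?_
  obtain ⟨a, rfl⟩ := RingQuot.mkAlgHom_surjective k (rel k q) b
  induction a using FreeAlgebra.induction with
  | grade0 r =>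
    rw [AlgHom.commutes, Algebra.algebraMap_eq_smul_one]
    exact S.smul_mem r (Submodule.subset_span ⟨[], by simp [evalWord]⟩)
  | grade1 i =>
    fin_cases i
    exacts [hgen 0, hgen 1, hgen 2, hgen 9]
  | mul a b ha hb =>
    rw [map_mul]
    exact hmul _ (ha trivial) _ (hb trivial)
  | add a b ha hb =>
    rw [map_add]
    exact S.add_mem (ha trivial) (hb trivial)

lemma span_mon [CharZero k] (hq : q ≠ 0) : Submodule.span k (Set.range (mon k q)) = ⊤ := by
  have hvalid := Valid.rules hq ((valid_baseRules_iff hq (RingQuot.mkAlgHom k (rel k q))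
    (g := fun a => RingQuot.mkAlgHom k (rel k q) (generator k q a)) rfl rfl rfl rfl).2
    ⟨fun _ => rfl, fun _ => mkAlgHom_eq_zero⟩)
  rw [eq_top_iff, ← span_evalWord, Submodule.span_le]
  rintro _ ⟨l, rfl⟩
  refine Submodule.span_mono ?_ (hvalid.evalWord_mem_span l)
  rintro _ ⟨l', hl', rfl⟩
  obtain ⟨i, rfl⟩ := exists_word_eq hl'
  exact ⟨i, mon_eq i⟩

end Presentation

theorem statement2 [IsAlgClosed k] [CharZero k] (hq : q ≠ 0) :
    LinearIndependent k (mon k q) ∧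
      Submodule.span k (Set.range (mon k q)) = ⊤ :=
  ⟨linearIndependent_mon hq, span_mon hq⟩

end Stmt2
end
end

section
/- Let A be any associative k-algebra containing elements x1,x2,x3,x4 that satisfy x_i·x_j = −x_j·x_i and x_i² = 0 for i ≠ j in {1,2,3}, together with x4·x1 = q⁻¹·x1·x4, x4·x42 = q⁻¹·x42·x4 and x4·x443 = q⁻¹·x443·x4. Then the following identities hold in A: x42·x2 = −q⁻¹·(x2+x1)·x42; x43·x3 = −q⁻¹·(x3+x2)·x43; x43·x2 = −v − q⁻¹·(x2+x1)·x43; x42² = 0; x4·v = q⁻²·v·x4 + q⁻¹·u; v·x2 = q⁻¹·(x2+x1)·v; v·x3 = q⁻¹·(x3+x2)·v; x443·x3 = −q⁻²·(x3 + 2·x2 + x1)·x443 − 2·q⁻¹·x43² − 2·q⁻¹·x42·x43; x443·x2 = −q⁻²·(x2 + 2·x1)·x443 − 2·q⁻¹·u; x42·v = q⁻¹·v·x42; u·x2 = q⁻²·(x2 + 2·x1)·u; u·x3 = w + q⁻¹·v·x42 + q⁻²·(x3 + 2·x2 + x1)·u; u·x42 = x42·u. -/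
theorem statement3 {k A : Type*} [Field k] [IsAlgClosed k] [CharZero k]
    [Ring A] [Algebra k A]
    (q : k) (hq : q ≠ 0) (x1 x2 x3 x4 x42 x43 x443 v u w : A)
    (hx42 : x42 = x4 * x2 - q⁻¹ • ((x2 + x1) * x4))
    (hx43 : x43 = x4 * x3 - q⁻¹ • ((x3 + x2) * x4))
    (hx443 : x443 = x4 * x43 - q⁻¹ • ((x43 + x42) * x4))
    (hv : v = x42 * x3 + q⁻¹ • ((x3 + x2) * x42))
    (hu : u = x43 * x42 + x42 * x43)
    (hw : w = x43 * v - q⁻¹ • (v * x43))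
    (h12 : x1 * x2 = -(x2 * x1)) (h13 : x1 * x3 = -(x3 * x1))
    (h23 : x2 * x3 = -(x3 * x2))
    (h1 : x1 ^ 2 = 0) (h2 : x2 ^ 2 = 0) (h3 : x3 ^ 2 = 0)
    (h41 : x4 * x1 = q⁻¹ • (x1 * x4))
    (h442 : x4 * x42 = q⁻¹ • (x42 * x4))
    (h4443 : x4 * x443 = q⁻¹ • (x443 * x4)) :
    (x42 * x2 = -(q⁻¹ • ((x2 + x1) * x42))) ∧
    (x43 * x3 = -(q⁻¹ • ((x3 + x2) * x43))) ∧
    (x43 * x2 = -v - q⁻¹ • ((x2 + x1) * x43)) ∧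
    (x42 ^ 2 = 0) ∧
    (x4 * v = (q ^ 2)⁻¹ • (v * x4) + q⁻¹ • u) ∧
    (v * x2 = q⁻¹ • ((x2 + x1) * v)) ∧
    (v * x3 = q⁻¹ • ((x3 + x2) * v)) ∧
    (x443 * x3 = -((q ^ 2)⁻¹ • ((x3 + (2 : k) • x2 + x1) * x443))
        - ((2 : k) * q⁻¹) • x43 ^ 2 - ((2 : k) * q⁻¹) • (x42 * x43)) ∧
    (x443 * x2 = -((q ^ 2)⁻¹ • ((x2 + (2 : k) • x1) * x443)) - ((2 : k) * q⁻¹) • u) ∧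
    (x42 * v = q⁻¹ • (v * x42)) ∧
    (u * x2 = (q ^ 2)⁻¹ • ((x2 + (2 : k) • x1) * u)) ∧
    (u * x3 = w + q⁻¹ • (v * x42) + (q ^ 2)⁻¹ • ((x3 + (2 : k) • x2 + x1) * u)) ∧
    (u * x42 = x42 * u) := by
  have rule {a b c : A} (h : a * b = c) : a * b = c ∧ ∀ z, a * (b * z) = c * z :=
    ⟨h, fun z => by rw [← mul_assoc, h]⟩
  have mulLeft {a b c : A} (h : a * b = c) : x4 * a * b = x4 * c := by rw [mul_assoc, h]
  simp only [← inv_pow]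
  have hp : q⁻¹ ≠ 0 := inv_ne_zero hq
  generalize q⁻¹ = p at *
  rw [pow_two] at h1 h2 h3
  have h21 : x2 * x1 = -(x1 * x2) := by rw [h12, neg_neg]
  have h31 : x3 * x1 = -(x1 * x3) := by rw [h13, neg_neg]
  have h32 : x3 * x2 = -(x2 * x3) := by rw [h23, neg_neg]
  have h42 : x4 * x2 = x42 + p • ((x2 + x1) * x4) := by rw [hx42, sub_add_cancel]
  have h43 : x4 * x3 = x43 + p • ((x3 + x2) * x4) := by rw [hx43, sub_add_cancel]
  have h443 : x4 * x43 = x443 + p • ((x43 + x42) * x4) := by rw [hx443, sub_add_cancel]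
  clear hx42 hx43 hx443
  subst hv hu hw
  -- Rewriting rules that order a monomial: `x1, x2, x3` increasing, `x4` to the right.
  have rules := And.intro (rule h21) <| And.intro (rule h31) <| And.intro (rule h32) <|
    And.intro (rule h1) <| And.intro (rule h2) (rule h3)
  have rules4 := And.intro (rule h41) <| And.intro (rule h42) <| And.intro (rule h43) <|
    And.intro (rule h442) (rule h443)
  -- Multiplying the quadratic relations of `x1, x2, x3` by `x4` on the left.
  obtain ⟨e421, e431, e422, e433, e432⟩ :
      x42 * x1 = -(p • (x1 * x42)) ∧ x43 * x1 = -(p • (x1 * x43)) ∧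
      x42 * x2 = -(p • ((x2 + x1) * x42)) ∧ x43 * x3 = -(p • ((x3 + x2) * x43)) ∧
      x43 * x2 = -(x42 * x3 + p • ((x3 + x2) * x42)) - p • ((x2 + x1) * x43) := by
    have r21 := mulLeft h21
    have r31 := mulLeft h31
    have r22 := mulLeft h2
    have r33 := mulLeft h3
    have r32 := mulLeft h32
    simp only [mul_add, add_mul, smul_mul_assoc, mul_smul_comm, smul_add, smul_smul, mul_assoc,
      neg_mul, mul_neg, smul_neg, mul_zero, zero_mul, smul_zero, rules4, rules]
      at r21 r31 r22 r33 r32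
    simp only [add_mul, smul_add]
    refine ⟨?_, ?_, ?_, ?_, ?_⟩
    · linear_combination (norm := module) r21
    · linear_combination (norm := module) r31
    · linear_combination (norm := module) r22
    · linear_combination (norm := module) r33
    · linear_combination (norm := module) r32
  have rules' := And.intro rules <| And.intro (rule e421) <| And.intro (rule e431) <|
    And.intro (rule e422) <| And.intro (rule e433) (rule e432)
  -- Multiplying the resulting relations by `x4` once more.
  have e4242 : x42 * x42 = 0 := by
    have r := mulLeft e422
    simp only [mul_add, add_mul, smul_mul_assoc, mul_smul_comm, smul_add, smul_smul, mul_assoc,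
      neg_mul, mul_neg, smul_neg, rules4, rules'] at r
    have h : (2 * p) • (x42 * x42) = 0 := by linear_combination (norm := module) r
    exact (smul_eq_zero.mp h).resolve_left (mul_ne_zero two_ne_zero hp)
  have rules'' := And.intro rules' (rule e4242)
  have r433 := mulLeft e433
  have r432 := mulLeft e432
  simp only [mul_add, add_mul, mul_sub, sub_mul, smul_mul_assoc, mul_smul_comm, smul_add, smul_sub,
    smul_smul, mul_assoc, neg_mul, mul_neg, smul_neg, smul_zero, rules4, rules''] at r433 r432
  refine ⟨e422, e433, e432, ?_, ?_, ?_, ?_, ?_, ?_, ?_, ?_, ?_, ?_⟩ <;>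
    simp only [pow_two, mul_add, add_mul, mul_sub, sub_mul, smul_mul_assoc, mul_smul_comm,
      smul_add, smul_sub, smul_smul, mul_assoc, neg_mul, mul_neg, smul_neg, mul_zero, zero_mul,
      smul_zero, rules4, rules'']
  · module
  · module
  · module
  · linear_combination (norm := module) r433
  · linear_combination (norm := module) r432
  · module
  · module
  · module
  · module
end

section
/- Let B be the quotient of the free associative algebra k⟨x1,y,x2,x3⟩ by the two-sided ideal generated by: x1², y², x1·y + y·x1; x1·x2 − q12·x2·x1; z², x2·z − q12⁻¹·z·x2; x1·x3 − q13·x3·x1; w², x3·w − q13⁻¹·w·x3; x2·x3 − q23·x3·x2; x3·z − q23⁻¹·q13⁻¹·z·x3. Then the images in B of the monomials x1^{m1}·y^{m}·x2^{m2}·z^{n}·x3^{m3}·w^{p}, where m1,m,n,p ∈ {0,1} and m2,m3 ∈ ℕ, form a k-vector space basis of B. -/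
/- Statement 5: PBW basis of the Nichols algebra 𝔅(𝔈_{+,+}(q†,a)) (Theorem 5.3(a) of the paper). -/

noncomputable section
namespace Stmt5

variable (k : Type*) [Field k] (q12 q13 q23 : k)

def x1 : FreeAlgebra k (Fin 4) := FreeAlgebra.ι k 0
/-- `y` stands for the generator x_{3/2} of the paper. -/
def y : FreeAlgebra k (Fin 4) := FreeAlgebra.ι k 1
def x2 : FreeAlgebra k (Fin 4) := FreeAlgebra.ι k 2
def x3 : FreeAlgebra k (Fin 4) := FreeAlgebra.ι k 3

/-- z := y·x2 − q12·x2·y -/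
def z : FreeAlgebra k (Fin 4) := y k * x2 k - q12 • (x2 k * y k)
/-- w := y·x3 − q13·x3·y -/
def w : FreeAlgebra k (Fin 4) := y k * x3 k - q13 • (x3 k * y k)

def rels : Set (FreeAlgebra k (Fin 4)) :=
  { x1 k ^ 2, y k ^ 2, x1 k * y k + y k * x1 k,
    x1 k * x2 k - q12 • (x2 k * x1 k),
    z k q12 ^ 2,
    x2 k * z k q12 - q12⁻¹ • (z k q12 * x2 k),
    x1 k * x3 k - q13 • (x3 k * x1 k),
    w k q13 ^ 2,
    x3 k * w k q13 - q13⁻¹ • (w k q13 * x3 k),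
    x2 k * x3 k - q23 • (x3 k * x2 k),
    x3 k * z k q12 - (q23⁻¹ * q13⁻¹) • (z k q12 * x3 k) }

def rel (a b : FreeAlgebra k (Fin 4)) : Prop := a ∈ rels k q12 q13 q23 ∧ b = 0

/-- The index set of the PBW monomials. -/
structure Idx where
  m1 : Fin 2
  m : Fin 2
  m2 : ℕ
  n : Fin 2
  m3 : ℕ
  p : Fin 2

/-- The PBW monomials x1^{m1}·y^{m}·x2^{m2}·z^{n}·x3^{m3}·w^{p}. -/
def mon (i : Idx) : RingQuot (rel k q12 q13 q23) :=
  RingQuot.mkAlgHom k (rel k q12 q13 q23)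
    (x1 k ^ (i.m1 : ℕ) * y k ^ (i.m : ℕ) * x2 k ^ i.m2 * z k q12 ^ (i.n : ℕ) *
      x3 k ^ i.m3 * w k q13 ^ (i.p : ℕ))

/-- Elements `a1, b, a2, a3` of an algebra satisfying the defining relations, with `u` and `v` in the
roles of `z` and `w`. -/
structure Sat {A : Type*} [Ring A] [Algebra k A] (a1 b a2 a3 u v : A) : Prop where
  u_eq : u = b * a2 - q12 • (a2 * b)
  v_eq : v = b * a3 - q13 • (a3 * b)
  a1_sq : a1 * a1 = 0
  b_sq : b * b = 0
  a1_b : a1 * b + b * a1 = 0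
  a1_a2 : a1 * a2 = q12 • (a2 * a1)
  u_sq : u * u = 0
  a2_u : a2 * u = q12⁻¹ • (u * a2)
  a1_a3 : a1 * a3 = q13 • (a3 * a1)
  v_sq : v * v = 0
  a3_v : a3 * v = q13⁻¹ • (v * a3)
  a2_a3 : a2 * a3 = q23 • (a3 * a2)
  a3_u : a3 * u = (q23⁻¹ * q13⁻¹) • (u * a3)

section Commutation

variable {k q12 q13 q23} {A : Type*} [Ring A] [Algebra k A] {a1 b a2 a3 u v : A}

theorem mul_pow_mul_of_skew {a b : A} {c : k} (h : a * b = c • (b * a)) (n : ℕ) (t : A) :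
    a * (b ^ n * t) = c ^ n • (b ^ n * (a * t)) := by
  induction n generalizing t with
  | zero => simp
  | succ n ih =>
    rw [pow_succ, mul_assoc, ih, ← mul_assoc a, h, pow_succ]
    simp only [smul_mul_assoc, mul_smul_comm, smul_smul, mul_assoc]

theorem skew_symm {a b : A} {c : k} (hc : c ≠ 0) (h : a * b = c • (b * a)) :
    b * a = c⁻¹ • (a * b) := by
  rw [h, smul_smul, inv_mul_cancel₀ hc, one_smul]

theorem Sat.b_a1 (h : Sat k q12 q13 q23 a1 b a2 a3 u v) : b * a1 = (-1 : k) • (a1 * b) := by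
  rw [neg_one_smul, eq_neg_iff_add_eq_zero, add_comm, h.a1_b]

theorem Sat.b_u (h : Sat k q12 q13 q23 a1 b a2 a3 u v) : b * u = -q12 • (u * b) := by
  rw [h.u_eq]
  linear_combination (norm := (simp only [mul_sub, sub_mul, mul_smul_comm, smul_mul_assoc,
    mul_assoc, mul_zero, zero_mul]; module)) h.b_sq * a2 - q12 ^ 2 • (a2 * h.b_sq)

theorem Sat.v_a2 (h : Sat k q12 q13 q23 a1 b a2 a3 u v) (h13 : q13 ≠ 0) (h23 : q23 ≠ 0) :
    v * a2 = (q12 * q23⁻¹) • (a2 * v) := by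
  have h6 := h.a3_u
  rw [h.u_eq] at h6
  rw [h.v_eq]
  linear_combination (norm := skip)
    -q13 • h6 - q23⁻¹ • (b * h.a2_a3) + (q12 * q23⁻¹ * q13) • (h.a2_a3 * b)
  simp only [mul_sub, sub_mul, mul_smul_comm, smul_mul_assoc, mul_assoc]
  match_scalars <;> field_simp <;> ring

theorem Sat.v_u (h : Sat k q12 q13 q23 a1 b a2 a3 u v) (h13 : q13 ≠ 0) :
    v * u = (-(q12 * q23⁻¹ * q13⁻¹)) • (u * v) := by
  rw [h.v_eq]
  linear_combination (norm := skip)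
    b * h.a3_u - q13 • (a3 * h.b_u) + (q23⁻¹ * q13⁻¹) • (h.b_u * a3) + (q13 * q12) • (h.a3_u * b)
  simp only [mul_sub, sub_mul, mul_smul_comm, smul_mul_assoc, mul_assoc]
  match_scalars <;> field_simp <;> ring

end Commutation

/-- The vector of the model module standing for `x1^a·y^b·x2^c·z^d·x3^e·w^f`; it vanishes when one of
`a, b, d, f` exceeds `1`. -/
def E (a b c d e f : ℕ) : Idx →₀ k :=
  if h : a < 2 ∧ b < 2 ∧ d < 2 ∧ f < 2 then
    Finsupp.single ⟨⟨a, h.1⟩, ⟨b, h.2.1⟩, c, ⟨d, h.2.2.1⟩, e, ⟨f, h.2.2.2⟩⟩ 1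
  else 0

theorem single_eq_E (i : Idx) :
    Finsupp.single i 1 = E k i.m1 i.m i.m2 i.n i.m3 i.p := by
  simp only [E, Fin.is_lt, and_self, dite_true]

theorem E_eq_zero {a b c d e f : ℕ} (h : ¬(a < 2 ∧ b < 2 ∧ d < 2 ∧ f < 2)) :
    E k a b c d e f = 0 :=
  dif_neg h

theorem E_two_left (a b c d e f : ℕ) : E k (a + 1 + 1) b c d e f = 0 :=
  E_eq_zero k (by omega)

theorem E_two_y (a b c d e f : ℕ) : E k a (b + 1 + 1) c d e f = 0 :=
  E_eq_zero k (by omega)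

theorem E_two_z (a b c d e f : ℕ) : E k a b c (d + 1 + 1) e f = 0 :=
  E_eq_zero k (by omega)

theorem E_two_w (a b c d e f : ℕ) : E k a b c d e (f + 1 + 1) = 0 :=
  E_eq_zero k (by omega)

variable {k} in
/-- Two linear maps on the model agree if they agree on the vectors `E` of `y`-degree `0` and `1`. -/
theorem hom_ext_E {V : Type*} [AddCommGroup V] [Module k V] {S T : (Idx →₀ k) →ₗ[k] V}
    (h0 : ∀ a c d e f, S (E k a 0 c d e f) = T (E k a 0 c d e f))
    (h1 : ∀ a c d e f, S (E k a (0 + 1) c d e f) = T (E k a (0 + 1) c d e f)) : S = T := by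
  refine Finsupp.lhom_ext' fun i => LinearMap.ext_ring ?_
  simp only [LinearMap.comp_apply, Finsupp.lsingle_apply, single_eq_E]
  obtain ⟨a, b, c, d, e, f⟩ := i
  fin_cases b
  · exact h0 _ _ _ _ _
  · exact h1 _ _ _ _ _

variable {k} in
/-- The operator on the model sending `E a b c d e f` to `F a b c d e f`. -/
def opOf (F : ℕ → ℕ → ℕ → ℕ → ℕ → ℕ → (Idx →₀ k)) : Module.End k (Idx →₀ k) :=
  Finsupp.linearCombination k fun i : Idx => F i.m1 i.m i.m2 i.n i.m3 i.p

variable {k} in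
theorem opOf_E {F : ℕ → ℕ → ℕ → ℕ → ℕ → ℕ → (Idx →₀ k)} {a b c d e f : ℕ}
    (hF : ¬(a < 2 ∧ b < 2 ∧ d < 2 ∧ f < 2) → F a b c d e f = 0) :
    opOf F (E k a b c d e f) = F a b c d e f := by
  by_cases h : a < 2 ∧ b < 2 ∧ d < 2 ∧ f < 2
  · simp [opOf, E, h]
  · rw [hF h, E_eq_zero k h, map_zero]

/-- Left multiplication by `x1` on the model. -/
def X1 : Module.End k (Idx →₀ k) :=
  opOf fun a b c d e f => E k (a + 1) b c d e f

/-- Left multiplication by `y` on the model. -/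
def Y : Module.End k (Idx →₀ k) :=
  opOf fun a b c d e f => (-1 : k) ^ a • E k a (b + 1) c d e f

/-- Left multiplication by `x2` on the model. -/
def X2 : Module.End k (Idx →₀ k) :=
  opOf fun a b c d e f =>
    if b = 0 then q12⁻¹ ^ a • E k a 0 (c + 1) d e f
    else q12⁻¹ ^ (a + 1) • (E k a b (c + 1) d e f - q12 ^ c • E k a (b - 1) c (d + 1) e f)

/-- Left multiplication by `x3` on the model. -/
def X3 : Module.End k (Idx →₀ k) :=
  opOf fun a b c d e f =>
    if b = 0 then
      (q13⁻¹ ^ a * (q23⁻¹ ^ c * (q23⁻¹ * q13⁻¹) ^ d)) • E k a 0 c d (e + 1) f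
    else q13⁻¹ ^ (a + 1) • ((q23⁻¹ ^ c * (q23⁻¹ * q13⁻¹) ^ d) • E k a b c d (e + 1) f -
      ((q12 * q23⁻¹) ^ c * ((-(q12 * q23⁻¹ * q13⁻¹)) ^ d * q13 ^ e)) •
        E k a (b - 1) c d e (f + 1))

theorem X1_E (a b c d e f : ℕ) : X1 k (E k a b c d e f) = E k (a + 1) b c d e f :=
  opOf_E fun h => E_eq_zero k (by omega)

theorem Y_E (a b c d e f : ℕ) :
    Y k (E k a b c d e f) = (-1 : k) ^ a • E k a (b + 1) c d e f :=
  opOf_E fun h => by rw [E_eq_zero k (by omega), smul_zero]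

theorem X2_E_zero (a c d e f : ℕ) :
    X2 k q12 (E k a 0 c d e f) = q12⁻¹ ^ a • E k a 0 (c + 1) d e f :=
  (opOf_E fun h => by simp [E_eq_zero k (c := c + 1) (e := e) h]).trans (if_pos rfl)

theorem X2_E_one (a c d e f : ℕ) :
    X2 k q12 (E k a (0 + 1) c d e f) =
      q12⁻¹ ^ (a + 1) • (E k a (0 + 1) (c + 1) d e f - q12 ^ c • E k a 0 c (d + 1) e f) :=
  (opOf_E fun h => by
    rw [if_neg (by omega), E_eq_zero k h, E_eq_zero k (by omega)]; simp).trans (if_neg (by omega))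

theorem X3_E_zero (a c d e f : ℕ) :
    X3 k q12 q13 q23 (E k a 0 c d e f) =
      (q13⁻¹ ^ a * (q23⁻¹ ^ c * (q23⁻¹ * q13⁻¹) ^ d)) • E k a 0 c d (e + 1) f :=
  (opOf_E fun h => by simp [E_eq_zero k (c := c) (e := e + 1) h]).trans (if_pos rfl)

theorem X3_E_one (a c d e f : ℕ) :
    X3 k q12 q13 q23 (E k a (0 + 1) c d e f) =
      q13⁻¹ ^ (a + 1) • ((q23⁻¹ ^ c * (q23⁻¹ * q13⁻¹) ^ d) • E k a (0 + 1) c d (e + 1) f -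
      ((q12 * q23⁻¹) ^ c * ((-(q12 * q23⁻¹ * q13⁻¹)) ^ d * q13 ^ e)) •
        E k a 0 c d e (f + 1)) :=
  (opOf_E fun h => by
    rw [if_neg (by omega), E_eq_zero k h, E_eq_zero k (by omega)]; simp).trans (if_neg (by omega))

/-- Left multiplication by `z` on the model. -/
def Z : Module.End k (Idx →₀ k) := Y k * X2 k q12 - q12 • (X2 k q12 * Y k)

/-- Left multiplication by `w` on the model. -/
def W : Module.End k (Idx →₀ k) := Y k * X3 k q12 q13 q23 - q13 • (X3 k q12 q13 q23 * Y k)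

theorem Z_E_zero (h12 : q12 ≠ 0) (a c d e f : ℕ) :
    Z k q12 (E k a 0 c d e f) =
      ((-1) ^ a * q12⁻¹ ^ a * q12 ^ c) • E k a 0 c (d + 1) e f := by
  simp only [Z, LinearMap.sub_apply, LinearMap.smul_apply, Module.End.mul_apply, Y_E, X2_E_zero,
    X2_E_one, map_smul, pow_succ]
  match_scalars <;> field_simp
  ring

theorem Z_E_one (a c d e f : ℕ) :
    Z k q12 (E k a (0 + 1) c d e f) =
      (-(-1) ^ a * q12⁻¹ ^ (a + 1) * q12 ^ c) • E k a (0 + 1) c (d + 1) e f := by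
  simp only [Z, LinearMap.sub_apply, LinearMap.smul_apply, Module.End.mul_apply, Y_E, X2_E_one,
    map_smul, map_sub, E_two_y, map_zero]
  module

theorem W_E_zero (h13 : q13 ≠ 0) (a c d e f : ℕ) :
    W k q12 q13 q23 (E k a 0 c d e f) =
      ((-1) ^ a * q13⁻¹ ^ a * ((q12 * q23⁻¹) ^ c * ((-(q12 * q23⁻¹ * q13⁻¹)) ^ d * q13 ^ e))) •
        E k a 0 c d e (f + 1) := by
  simp only [W, LinearMap.sub_apply, LinearMap.smul_apply, Module.End.mul_apply, Y_E, X3_E_zero,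
    X3_E_one, map_smul, pow_succ]
  generalize (q12 * q23⁻¹) ^ c * ((-(q12 * q23⁻¹ * q13⁻¹)) ^ d * q13 ^ e) = s
  generalize q23⁻¹ ^ c * (q23⁻¹ * q13⁻¹) ^ d = t
  match_scalars <;> field_simp
  ring

theorem W_E_one (a c d e f : ℕ) :
    W k q12 q13 q23 (E k a (0 + 1) c d e f) =
      (-(-1) ^ a * q13⁻¹ ^ (a + 1) *
        ((q12 * q23⁻¹) ^ c * ((-(q12 * q23⁻¹ * q13⁻¹)) ^ d * q13 ^ e))) •
        E k a (0 + 1) c d e (f + 1) := by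
  simp only [W, LinearMap.sub_apply, LinearMap.smul_apply, Module.End.mul_apply, Y_E, X3_E_one,
    map_smul, map_sub, E_two_y, map_zero]
  module

theorem sat_model (h12 : q12 ≠ 0) (h13 : q13 ≠ 0) (h23 : q23 ≠ 0) :
    Sat k q12 q13 q23 (X1 k) (Y k) (X2 k q12) (X3 k q12 q13 q23) (Z k q12)
      (W k q12 q13 q23) where
  u_eq := rfl
  v_eq := rfl
  a1_sq := by
    apply hom_ext_E <;> intros <;>
      simp only [Module.End.mul_apply, LinearMap.zero_apply, X1_E, E_two_left]
  b_sq := by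
    apply hom_ext_E <;> intros <;>
      simp only [Module.End.mul_apply, LinearMap.zero_apply, map_smul, Y_E, E_two_y, smul_zero,
        map_zero]
  a1_b := by
    apply hom_ext_E <;> intros <;>
      simp only [LinearMap.add_apply, Module.End.mul_apply, LinearMap.zero_apply, map_smul, Y_E,
        X1_E] <;> module
  a1_a2 := by
    apply hom_ext_E <;> intros <;>
      simp only [LinearMap.smul_apply, Module.End.mul_apply, map_smul, map_sub, pow_succ, X1_E, X2_E_zero,
        X2_E_one] <;> match_scalars <;> field_simp
  u_sq := by
    apply hom_ext_E <;> intros <;>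
      simp only [Module.End.mul_apply, LinearMap.zero_apply, map_smul, Z_E_zero k q12 h12, Z_E_one,
        E_two_z, smul_zero]
  a2_u := by
    apply hom_ext_E <;> intros <;>
      simp only [LinearMap.smul_apply, Module.End.mul_apply, map_smul, map_sub, pow_succ, X2_E_zero,
        X2_E_one, Z_E_zero k q12 h12, Z_E_one, E_two_z, smul_zero, sub_zero] <;>
      match_scalars <;> field_simp
  a1_a3 := by
    apply hom_ext_E <;> intros <;>
      simp only [LinearMap.smul_apply, Module.End.mul_apply, map_smul, map_sub, pow_succ, X1_E, X3_E_zero,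
        X3_E_one] <;> match_scalars <;> field_simp
  v_sq := by
    apply hom_ext_E <;> intros <;>
      simp only [Module.End.mul_apply, LinearMap.zero_apply, map_smul, W_E_zero k q12 q13 q23 h13,
        W_E_one, E_two_w, smul_zero]
  a3_v := by
    apply hom_ext_E <;> intros <;>
      simp only [LinearMap.smul_apply, Module.End.mul_apply, map_smul, map_sub, pow_succ, X3_E_zero,
        X3_E_one, W_E_zero k q12 q13 q23 h13, W_E_one, E_two_w, smul_zero, sub_zero] <;>
      match_scalars <;> field_simp
  a2_a3 := by
    apply hom_ext_E <;> intros <;>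
      simp only [LinearMap.smul_apply, Module.End.mul_apply, map_smul, map_sub, pow_succ, X2_E_zero,
        X2_E_one, X3_E_zero, X3_E_one] <;> match_scalars <;> field_simp
  a3_u := by
    apply hom_ext_E <;> intros <;>
      simp only [LinearMap.smul_apply, Module.End.mul_apply, map_smul, map_sub, pow_succ, X3_E_zero,
        X3_E_one, Z_E_zero k q12 h12, Z_E_one] <;>
      match_scalars <;> field_simp

/-- The quotient map from the free algebra. -/
abbrev quot : FreeAlgebra k (Fin 4) →ₐ[k] RingQuot (rel k q12 q13 q23) :=
  RingQuot.mkAlgHom k (rel k q12 q13 q23)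

theorem quot_eq_zero {r : FreeAlgebra k (Fin 4)} (hr : r ∈ rels k q12 q13 q23) :
    quot k q12 q13 q23 r = 0 := by
  simpa using RingQuot.mkAlgHom_rel k (s := rel k q12 q13 q23) ⟨hr, rfl⟩

theorem sat_quot :
    Sat k q12 q13 q23 (quot k q12 q13 q23 (x1 k)) (quot k q12 q13 q23 (y k))
      (quot k q12 q13 q23 (x2 k)) (quot k q12 q13 q23 (x3 k)) (quot k q12 q13 q23 (z k q12))
      (quot k q12 q13 q23 (w k q13)) where
  u_eq := by simp only [z, map_sub, map_smul, map_mul]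
  v_eq := by simp only [w, map_sub, map_smul, map_mul]
  a1_sq := by
    rw [← map_mul, ← pow_two]
    exact quot_eq_zero k q12 q13 q23 (r := x1 k ^ 2) (by simp [rels])
  b_sq := by
    rw [← map_mul, ← pow_two]
    exact quot_eq_zero k q12 q13 q23 (r := y k ^ 2) (by simp [rels])
  a1_b := by
    simpa only [map_add, map_mul] using
      quot_eq_zero k q12 q13 q23 (r := x1 k * y k + y k * x1 k) (by simp [rels])
  a1_a2 := by
    simpa only [map_sub, map_smul, map_mul, sub_eq_zero] using
      quot_eq_zero k q12 q13 q23 (r := x1 k * x2 k - q12 • (x2 k * x1 k)) (by simp [rels])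
  u_sq := by
    rw [← map_mul, ← pow_two]
    exact quot_eq_zero k q12 q13 q23 (r := z k q12 ^ 2) (by simp [rels])
  a2_u := by
    simpa only [map_sub, map_smul, map_mul, sub_eq_zero] using
      quot_eq_zero k q12 q13 q23 (r := x2 k * z k q12 - q12⁻¹ • (z k q12 * x2 k)) (by simp [rels])
  a1_a3 := by
    simpa only [map_sub, map_smul, map_mul, sub_eq_zero] using
      quot_eq_zero k q12 q13 q23 (r := x1 k * x3 k - q13 • (x3 k * x1 k)) (by simp [rels])
  v_sq := by
    rw [← map_mul, ← pow_two]
    exact quot_eq_zero k q12 q13 q23 (r := w k q13 ^ 2) (by simp [rels])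
  a3_v := by
    simpa only [map_sub, map_smul, map_mul, sub_eq_zero] using
      quot_eq_zero k q12 q13 q23 (r := x3 k * w k q13 - q13⁻¹ • (w k q13 * x3 k)) (by simp [rels])
  a2_a3 := by
    simpa only [map_sub, map_smul, map_mul, sub_eq_zero] using
      quot_eq_zero k q12 q13 q23 (r := x2 k * x3 k - q23 • (x3 k * x2 k)) (by simp [rels])
  a3_u := by
    simpa only [map_sub, map_smul, map_mul, sub_eq_zero] using
      quot_eq_zero k q12 q13 q23
        (r := x3 k * z k q12 - (q23⁻¹ * q13⁻¹) • (z k q12 * x3 k)) (by simp [rels])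

/-- The action of the free algebra on the model. -/
def freeAct : FreeAlgebra k (Fin 4) →ₐ[k] Module.End k (Idx →₀ k) :=
  FreeAlgebra.lift k ![X1 k, Y k, X2 k q12, X3 k q12 q13 q23]

theorem freeAct_x1 : freeAct k q12 q13 q23 (x1 k) = X1 k := by simp [freeAct, x1]

theorem freeAct_y : freeAct k q12 q13 q23 (y k) = Y k := by simp [freeAct, y]

theorem freeAct_x2 : freeAct k q12 q13 q23 (x2 k) = X2 k q12 := by simp [freeAct, x2]

theorem freeAct_x3 : freeAct k q12 q13 q23 (x3 k) = X3 k q12 q13 q23 := by simp [freeAct, x3]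

theorem freeAct_z : freeAct k q12 q13 q23 (z k q12) = Z k q12 := by
  simp only [z, Z, map_sub, map_smul, map_mul, freeAct_y, freeAct_x2]

theorem freeAct_w : freeAct k q12 q13 q23 (w k q13) = W k q12 q13 q23 := by
  simp only [w, W, map_sub, map_smul, map_mul, freeAct_y, freeAct_x3]

theorem freeAct_rel (h12 : q12 ≠ 0) (h13 : q13 ≠ 0) (h23 : q23 ≠ 0)
    ⦃r s : FreeAlgebra k (Fin 4)⦄ (h : rel k q12 q13 q23 r s) :
    freeAct k q12 q13 q23 r = freeAct k q12 q13 q23 s := by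
  obtain ⟨hr, rfl⟩ := h
  have hs := sat_model k q12 q13 q23 h12 h13 h23
  simp only [rels, Set.mem_insert_iff, Set.mem_singleton_iff] at hr
  rcases hr with rfl | rfl | rfl | rfl | rfl | rfl | rfl | rfl | rfl | rfl | rfl <;>
    simp only [map_sub, map_add, map_smul, map_mul, map_zero, pow_two, freeAct_x1, freeAct_y,
      freeAct_x2, freeAct_x3, freeAct_z, freeAct_w, sub_eq_zero]
  exacts [hs.a1_sq, hs.b_sq, hs.a1_b, hs.a1_a2, hs.u_sq, hs.a2_u, hs.a1_a3, hs.v_sq, hs.a3_v,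
    hs.a2_a3, hs.a3_u]

theorem freeAct_monomial (h12 : q12 ≠ 0) (h13 : q13 ≠ 0) (a b c d e f : ℕ) :
    freeAct k q12 q13 q23
      (x1 k ^ a * y k ^ b * x2 k ^ c * z k q12 ^ d * x3 k ^ e * w k q13 ^ f) (E k 0 0 0 0 0 0) =
      E k a b c d e f := by
  have hw : ∀ n, (W k q12 q13 q23 ^ n) (E k 0 0 0 0 0 0) = E k 0 0 0 0 0 n := fun n => by
    induction n with
    | zero => simp
    | succ n ih => simp [pow_succ', ih, W_E_zero k q12 q13 q23 h13]
  have hx3 : ∀ n, (X3 k q12 q13 q23 ^ n) (E k 0 0 0 0 0 f) = E k 0 0 0 0 n f := fun n => by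
    induction n with
    | zero => simp
    | succ n ih => simp [pow_succ', ih, X3_E_zero]
  have hz : ∀ n, (Z k q12 ^ n) (E k 0 0 0 0 e f) = E k 0 0 0 n e f := fun n => by
    induction n with
    | zero => simp
    | succ n ih => simp [pow_succ', ih, Z_E_zero k q12 h12]
  have hx2 : ∀ n, (X2 k q12 ^ n) (E k 0 0 0 d e f) = E k 0 0 n d e f := fun n => by
    induction n with
    | zero => simp
    | succ n ih => simp [pow_succ', ih, X2_E_zero]
  have hy : ∀ n, (Y k ^ n) (E k 0 0 c d e f) = E k 0 n c d e f := fun n => by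
    induction n with
    | zero => simp
    | succ n ih => simp [pow_succ', ih, Y_E]
  have hx1 : ∀ n, (X1 k ^ n) (E k 0 b c d e f) = E k n b c d e f := fun n => by
    induction n with
    | zero => simp
    | succ n ih => simp [pow_succ', ih, X1_E]
  simp only [map_mul, map_pow, freeAct_x1, freeAct_y, freeAct_x2, freeAct_x3, freeAct_z, freeAct_w,
    Module.End.mul_apply, hw, hx3, hz, hx2, hy, hx1]

/-- The linear map from the model to the quotient algebra given by the PBW monomials. -/
abbrev monMap : (Idx →₀ k) →ₗ[k] RingQuot (rel k q12 q13 q23) :=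
  Finsupp.linearCombination k (mon k q12 q13 q23)

theorem monMap_E (a b c d e f : ℕ) :
    monMap k q12 q13 q23 (E k a b c d e f) =
      quot k q12 q13 q23 (x1 k) ^ a * (quot k q12 q13 q23 (y k) ^ b *
        (quot k q12 q13 q23 (x2 k) ^ c * (quot k q12 q13 q23 (z k q12) ^ d *
          (quot k q12 q13 q23 (x3 k) ^ e * quot k q12 q13 q23 (w k q13) ^ f)))) := by
  have hs := sat_quot k q12 q13 q23
  by_cases h : a < 2 ∧ b < 2 ∧ d < 2 ∧ f < 2
  · simp [E, h, mon, mul_assoc]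
  · have hpow : ∀ {t : RingQuot (rel k q12 q13 q23)} {n : ℕ}, t * t = 0 → 2 ≤ n → t ^ n = 0 :=
      fun ht hn => pow_eq_zero_of_le hn (by rw [pow_two, ht])
    rw [E_eq_zero k h, map_zero]
    have h' : 2 ≤ a ∨ 2 ≤ b ∨ 2 ≤ d ∨ 2 ≤ f := by omega
    rcases h' with h' | h' | h' | h'
    · simp [hpow hs.a1_sq h']
    · simp [hpow hs.b_sq h']
    · simp [hpow hs.u_sq h']
    · simp [hpow hs.v_sq h']

theorem monMap_comp_X1 :
    monMap k q12 q13 q23 ∘ₗ X1 k =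
      LinearMap.mulLeft k (quot k q12 q13 q23 (x1 k)) ∘ₗ monMap k q12 q13 q23 := by
  apply hom_ext_E <;> intros <;>
    simp only [LinearMap.comp_apply, LinearMap.mulLeft_apply, X1_E, monMap_E, pow_succ', mul_assoc]

theorem monMap_comp_Y :
    monMap k q12 q13 q23 ∘ₗ Y k =
      LinearMap.mulLeft k (quot k q12 q13 q23 (y k)) ∘ₗ monMap k q12 q13 q23 := by
  have hs := sat_quot k q12 q13 q23
  apply hom_ext_E <;> intros <;>
    simp only [LinearMap.comp_apply, LinearMap.mulLeft_apply, Y_E, monMap_E, map_smul,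
      mul_pow_mul_of_skew hs.b_a1, pow_succ', mul_assoc]

theorem monMap_comp_X2 (h12 : q12 ≠ 0) :
    monMap k q12 q13 q23 ∘ₗ X2 k q12 =
      LinearMap.mulLeft k (quot k q12 q13 q23 (x2 k)) ∘ₗ monMap k q12 q13 q23 := by
  have hs := sat_quot k q12 q13 q23
  have hux := skew_symm (inv_ne_zero h12) hs.a2_u
  rw [inv_inv] at hux
  apply hom_ext_E
  · intros
    simp only [LinearMap.comp_apply, LinearMap.mulLeft_apply, X2_E_zero, monMap_E, map_smul,
      mul_pow_mul_of_skew (skew_symm h12 hs.a1_a2), pow_succ', pow_zero, one_mul, mul_assoc]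
  · intros
    have hxy : ∀ t, quot k q12 q13 q23 (x2 k) * (quot k q12 q13 q23 (y k) * t) =
        q12⁻¹ • (quot k q12 q13 q23 (y k) * (quot k q12 q13 q23 (x2 k) * t) -
          quot k q12 q13 q23 (z k q12) * t) := fun t => by
      rw [hs.u_eq, sub_mul, smul_mul_assoc, mul_assoc, mul_assoc, sub_sub_cancel, smul_smul,
        inv_mul_cancel₀ h12, one_smul]
    simp only [LinearMap.comp_apply, LinearMap.mulLeft_apply, X2_E_one, monMap_E, map_smul, map_sub,
      mul_pow_mul_of_skew (skew_symm h12 hs.a1_a2), mul_pow_mul_of_skew hux, zero_add,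
      pow_zero, one_mul, hxy, pow_succ', mul_assoc, mul_sub, mul_smul_comm]
    module

theorem monMap_comp_X3 (h13 : q13 ≠ 0) (h23 : q23 ≠ 0) :
    monMap k q12 q13 q23 ∘ₗ X3 k q12 q13 q23 =
      LinearMap.mulLeft k (quot k q12 q13 q23 (x3 k)) ∘ₗ monMap k q12 q13 q23 := by
  have hs := sat_quot k q12 q13 q23
  have hvx := skew_symm (inv_ne_zero h13) hs.a3_v
  rw [inv_inv] at hvx
  apply hom_ext_E
  · intros
    simp only [LinearMap.comp_apply, LinearMap.mulLeft_apply, X3_E_zero, monMap_E, map_smul,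
      mul_pow_mul_of_skew (skew_symm h13 hs.a1_a3), mul_pow_mul_of_skew (skew_symm h23 hs.a2_a3),
      mul_pow_mul_of_skew hs.a3_u, pow_succ', pow_zero, one_mul, mul_assoc, mul_smul_comm,
      smul_smul]
  · intros
    have hxy : ∀ t, quot k q12 q13 q23 (x3 k) * (quot k q12 q13 q23 (y k) * t) =
        q13⁻¹ • (quot k q12 q13 q23 (y k) * (quot k q12 q13 q23 (x3 k) * t) -
          quot k q12 q13 q23 (w k q13) * t) := fun t => by
      rw [hs.v_eq, sub_mul, smul_mul_assoc, mul_assoc, mul_assoc, sub_sub_cancel, smul_smul,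
        inv_mul_cancel₀ h13, one_smul]
    simp only [LinearMap.comp_apply, LinearMap.mulLeft_apply, X3_E_one, monMap_E, map_smul, map_sub,
      mul_pow_mul_of_skew (skew_symm h13 hs.a1_a3), mul_pow_mul_of_skew (skew_symm h23 hs.a2_a3),
      mul_pow_mul_of_skew hs.a3_u, mul_pow_mul_of_skew (hs.v_a2 h13 h23),
      mul_pow_mul_of_skew (hs.v_u h13), mul_pow_mul_of_skew hvx, zero_add,
      pow_zero, one_mul, hxy, pow_succ', mul_assoc, mul_sub, mul_smul_comm]
    module

theorem monMap_freeAct (h12 : q12 ≠ 0) (h13 : q13 ≠ 0) (h23 : q23 ≠ 0)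
    (r : FreeAlgebra k (Fin 4)) (t : Idx →₀ k) :
    monMap k q12 q13 q23 (freeAct k q12 q13 q23 r t) =
      quot k q12 q13 q23 r * monMap k q12 q13 q23 t := by
  induction r generalizing t with
  | grade0 c => simp [Algebra.algebraMap_eq_smul_one]
  | grade1 i =>
    fin_cases i
    · change monMap k q12 q13 q23 (freeAct k q12 q13 q23 (x1 k) t) = _
      rw [freeAct_x1]
      exact LinearMap.congr_fun (monMap_comp_X1 k q12 q13 q23) t
    · change monMap k q12 q13 q23 (freeAct k q12 q13 q23 (y k) t) = _
      rw [freeAct_y]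
      exact LinearMap.congr_fun (monMap_comp_Y k q12 q13 q23) t
    · change monMap k q12 q13 q23 (freeAct k q12 q13 q23 (x2 k) t) = _
      rw [freeAct_x2]
      exact LinearMap.congr_fun (monMap_comp_X2 k q12 q13 q23 h12) t
    · change monMap k q12 q13 q23 (freeAct k q12 q13 q23 (x3 k) t) = _
      rw [freeAct_x3]
      exact LinearMap.congr_fun (monMap_comp_X3 k q12 q13 q23 h13 h23) t
  | mul r s hr hs => rw [map_mul, map_mul, Module.End.mul_apply, hr, hs, mul_assoc]
  | add r s hr hs => rw [map_add, map_add, LinearMap.add_apply, map_add, hr, hs, add_mul]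

theorem statement5 [IsAlgClosed k] [CharZero k]
    (h12 : q12 ≠ 0) (h13 : q13 ≠ 0) (h23 : q23 ≠ 0) :
    LinearIndependent k (mon k q12 q13 q23) ∧
      Submodule.span k (Set.range (mon k q12 q13 q23)) = ⊤ := by
  constructor
  · let act := RingQuot.liftAlgHom k
      ⟨freeAct k q12 q13 q23, freeAct_rel k q12 q13 q23 h12 h13 h23⟩
    let evalOne : RingQuot (rel k q12 q13 q23) →ₗ[k] (Idx →₀ k) :=
      LinearMap.applyₗ (E k 0 0 0 0 0 0) ∘ₗ act.toLinearMap
    have hmon : ⇑evalOne ∘ mon k q12 q13 q23 = fun i => Finsupp.single i 1 := by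
      funext i
      rw [single_eq_E, ← freeAct_monomial k q12 q13 q23 h12 h13]
      simp only [evalOne, act, mon, Function.comp_apply, LinearMap.comp_apply,
        AlgHom.toLinearMap_apply, LinearMap.applyₗ_apply_apply, RingQuot.liftAlgHom_mkAlgHom_apply]
    refine LinearIndependent.of_comp evalOne ?_
    rw [hmon]
    exact Finsupp.linearIndependent_single_one k Idx
  · rw [← Finsupp.range_linearCombination, LinearMap.range_eq_top]
    intro r
    obtain ⟨r, rfl⟩ := RingQuot.mkAlgHom_surjective k (rel k q12 q13 q23) r
    refine ⟨freeAct k q12 q13 q23 r (E k 0 0 0 0 0 0), ?_⟩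
    rw [monMap_freeAct k q12 q13 q23 h12 h13 h23, monMap_E]
    simp

end Stmt5
end
end

section
/- Let B be the quotient of the free associative algebra k⟨x1,y,x2,x3⟩ by the two-sided ideal generated by: x1², y², x1·y + y·x1; x1·x2 − q12·x2·x1; x2², x2·z + q12⁻¹·z·x2; x1·x3 − q13·x3·x1; x2·x3 − q23·x3·x2; x3·z − q23⁻¹·q13⁻¹·z·x3; x3²; x3·w + q13⁻¹·w·x3. Then the images in B of the monomials x1^{m1}·y^{m}·x2^{m2}·z^{n}·x3^{m3}·w^{p}, where m1,m,m2,m3 ∈ {0,1} and n,p ∈ ℕ, form a k-vector space basis of B. -/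
/- Statement 8: PBW basis of the Nichols algebra 𝔅(𝔈_{−,−}(q†,a)) (Theorem 5.3(d) of the paper). -/

noncomputable section
namespace Stmt8

variable (k : Type*) [Field k] (q12 q13 q23 : k)

def x1 : FreeAlgebra k (Fin 4) := FreeAlgebra.ι k 0
/-- `y` stands for the generator x_{3/2} of the paper. -/
def y : FreeAlgebra k (Fin 4) := FreeAlgebra.ι k 1
def x2 : FreeAlgebra k (Fin 4) := FreeAlgebra.ι k 2
def x3 : FreeAlgebra k (Fin 4) := FreeAlgebra.ι k 3

/-- z := y·x2 − q12·x2·y -/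
def z : FreeAlgebra k (Fin 4) := y k * x2 k - q12 • (x2 k * y k)
/-- w := y·x3 − q13·x3·y -/
def w : FreeAlgebra k (Fin 4) := y k * x3 k - q13 • (x3 k * y k)

def rels : Set (FreeAlgebra k (Fin 4)) :=
  { x1 k ^ 2, y k ^ 2, x1 k * y k + y k * x1 k,
    x1 k * x2 k - q12 • (x2 k * x1 k),
    x2 k ^ 2,
    x2 k * z k q12 + q12⁻¹ • (z k q12 * x2 k),
    x1 k * x3 k - q13 • (x3 k * x1 k),
    x2 k * x3 k - q23 • (x3 k * x2 k),
    x3 k * z k q12 - (q23⁻¹ * q13⁻¹) • (z k q12 * x3 k),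
    x3 k ^ 2,
    x3 k * w k q13 + q13⁻¹ • (w k q13 * x3 k) }

def rel (a b : FreeAlgebra k (Fin 4)) : Prop := a ∈ rels k q12 q13 q23 ∧ b = 0

/-- The index set of the PBW monomials. -/
structure Idx where
  m1 : Fin 2
  m : Fin 2
  m2 : Fin 2
  n : ℕ
  m3 : Fin 2
  p : ℕ

/-- The PBW monomials x1^{m1}·y^{m}·x2^{m2}·z^{n}·x3^{m3}·w^{p}. -/
def mon (i : Idx) : RingQuot (rel k q12 q13 q23) :=
  RingQuot.mkAlgHom k (rel k q12 q13 q23)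
    (x1 k ^ (i.m1 : ℕ) * y k ^ (i.m : ℕ) * x2 k ^ (i.m2 : ℕ) * z k q12 ^ i.n *
      x3 k ^ (i.m3 : ℕ) * w k q13 ^ i.p)

section PBW

variable {k}

/-- The free vector space on the PBW monomials. -/
abbrev PBWSpace (k : Type*) [Field k] := Idx →₀ k

/-- The basis vector of `PBWSpace k` attached to an exponent vector. -/
abbrev basisVec (k : Type*) [Field k] (m1 m m2 : Fin 2) (n : ℕ) (m3 : Fin 2) (p : ℕ) :
    PBWSpace k := Finsupp.single ⟨m1, m, m2, n, m3, p⟩ 1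

/-- Left multiplication by `x1` on PBW monomials. -/
def leftX1 (k : Type*) [Field k] : Idx → PBWSpace k
  | ⟨0, m, m2, n, m3, p⟩ => basisVec k 1 m m2 n m3 p
  | ⟨1, _, _, _, _, _⟩ => 0

/-- Left multiplication by `y` on PBW monomials. -/
def leftY (k : Type*) [Field k] : Idx → PBWSpace k
  | ⟨m1, 0, m2, n, m3, p⟩ => (-1 : k) ^ (m1 : ℕ) • basisVec k m1 1 m2 n m3 p
  | ⟨_, 1, _, _, _, _⟩ => 0

/-- Left multiplication by `x2` on PBW monomials. -/
def leftX2 (q12 : k) : Idx → PBWSpace k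
  | ⟨m1, 0, 0, n, m3, p⟩ => q12⁻¹ ^ (m1 : ℕ) • basisVec k m1 0 1 n m3 p
  | ⟨_, 0, 1, _, _, _⟩ => 0
  | ⟨m1, 1, 0, n, m3, p⟩ => q12⁻¹ ^ (m1 : ℕ) •
      q12⁻¹ • (basisVec k m1 1 1 n m3 p - basisVec k m1 0 0 (n + 1) m3 p)
  | ⟨m1, 1, 1, n, m3, p⟩ => q12⁻¹ ^ (m1 : ℕ) • basisVec k m1 0 1 (n + 1) m3 p

/-- The product `x3 * x2 ^ m2 * z ^ n * x3 ^ m3 * w ^ p`, preceded by `x1 ^ m1 * y ^ m`. -/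
def insertX3 (q13 q23 : k) (m1 m : Fin 2) (m2 : Fin 2) (n : ℕ) : Fin 2 → ℕ → PBWSpace k
  | 0, p => (q23⁻¹ ^ (m2 : ℕ) * (q23⁻¹ * q13⁻¹) ^ n) • basisVec k m1 m m2 n 1 p
  | 1, _ => 0

/-- The product `w * x2 ^ m2 * z ^ n * x3 ^ m3 * w ^ p`, preceded by `x1 ^ m1`. -/
def insertW (q12 q13 q23 : k) (m1 m2 : Fin 2) (n : ℕ) (m3 : Fin 2) (p : ℕ) : PBWSpace k :=
  ((q12 * q23⁻¹) ^ (m2 : ℕ) * (-(q12 * q13⁻¹ * q23⁻¹)) ^ n * (-q13) ^ (m3 : ℕ)) •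
    basisVec k m1 0 m2 n m3 (p + 1)

/-- Left multiplication by `x3` on PBW monomials. -/
def leftX3 (q12 q13 q23 : k) : Idx → PBWSpace k
  | ⟨m1, 0, m2, n, m3, p⟩ => q13⁻¹ ^ (m1 : ℕ) • insertX3 q13 q23 m1 0 m2 n m3 p
  | ⟨m1, 1, m2, n, m3, p⟩ => q13⁻¹ ^ (m1 : ℕ) •
      q13⁻¹ • (insertX3 q13 q23 m1 1 m2 n m3 p - insertW q12 q13 q23 m1 m2 n m3 p)

/-- The generators acting on `PBWSpace k`. -/
def genAction : Fin 4 → Module.End k (PBWSpace k) :=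
  ![Finsupp.linearCombination k (leftX1 k), Finsupp.linearCombination k (leftY k),
    Finsupp.linearCombination k (leftX2 q12), Finsupp.linearCombination k (leftX3 q12 q13 q23)]

/-- The free algebra acting on `PBWSpace k`. -/
def freeAction : FreeAlgebra k (Fin 4) →ₐ[k] Module.End k (PBWSpace k) :=
  FreeAlgebra.lift k (genAction q12 q13 q23)

lemma freeAction_x1 :
    freeAction q12 q13 q23 (x1 k) = Finsupp.linearCombination k (leftX1 k) := by
  simp [freeAction, x1, genAction]

lemma freeAction_y :
    freeAction q12 q13 q23 (y k) = Finsupp.linearCombination k (leftY k) := by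
  simp [freeAction, y, genAction]

lemma freeAction_x2 :
    freeAction q12 q13 q23 (x2 k) = Finsupp.linearCombination k (leftX2 q12) := by
  simp [freeAction, x2, genAction]

lemma freeAction_x3 :
    freeAction q12 q13 q23 (x3 k) = Finsupp.linearCombination k (leftX3 q12 q13 q23) := by
  simp [freeAction, x3, genAction]

variable {q12 q13 q23}

set_option maxHeartbeats 4000000 in
lemma freeAction_eq_zero (h12 : q12 ≠ 0) (h13 : q13 ≠ 0) (h23 : q23 ≠ 0)
    {a : FreeAlgebra k (Fin 4)} (ha : a ∈ rels k q12 q13 q23) :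
    freeAction q12 q13 q23 a = 0 := by
  refine Finsupp.lhom_ext fun i b => ?_
  rw [← mul_one b, ← smul_eq_mul, ← Finsupp.smul_single, map_smul, map_smul]
  congr 1
  obtain ⟨m1, m, m2, n, m3, p⟩ := i
  simp only [rels, Set.mem_insert_iff, Set.mem_singleton_iff] at ha
  rcases ha with rfl | rfl | rfl | rfl | rfl | rfl | rfl | rfl | rfl | rfl | rfl <;>
  simp only [z, w, map_add, map_sub, map_smul, map_mul, pow_two,
    freeAction_x1, freeAction_y, freeAction_x2, freeAction_x3, LinearMap.add_apply,
    LinearMap.sub_apply, LinearMap.smul_apply, Module.End.mul_apply, LinearMap.zero_apply] <;>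
  fin_cases m1 <;> fin_cases m <;> fin_cases m2 <;> fin_cases m3 <;>
  simp [leftX1, leftY, leftX2, leftX3, insertX3, insertW, Finsupp.linearCombination_single,
    -Finsupp.smul_single, -smul_eq_zero, basisVec] <;>
  (try match_scalars) <;> (try simp only [mul_pow, pow_succ, inv_pow,
    neg_pow (q12 * q13⁻¹ * q23⁻¹)]) <;>
  (try field_simp) <;> (try ring)

/-- The action of the quotient algebra on `PBWSpace k`. -/
def quotAction (h12 : q12 ≠ 0) (h13 : q13 ≠ 0) (h23 : q23 ≠ 0) :
    RingQuot (rel k q12 q13 q23) →ₐ[k] Module.End k (PBWSpace k) :=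
  RingQuot.liftAlgHom k ⟨freeAction q12 q13 q23, fun {a b} h => by
    rw [freeAction_eq_zero h12 h13 h23 h.1, h.2, map_zero]⟩

lemma freeAction_z_apply (h12 : q12 ≠ 0) (n : ℕ) (m3 : Fin 2) (p : ℕ) :
    freeAction q12 q13 q23 (z k q12) (basisVec k 0 0 0 n m3 p) =
      basisVec k 0 0 0 (n + 1) m3 p := by
  simp [z, freeAction_y, freeAction_x2, leftY, leftX2, h12, Finsupp.linearCombination_single,
    -Finsupp.smul_single]

lemma freeAction_w_apply (h13 : q13 ≠ 0) (p : ℕ) :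
    freeAction q12 q13 q23 (w k q13) (basisVec k 0 0 0 0 0 p) =
      basisVec k 0 0 0 0 0 (p + 1) := by
  simp [w, freeAction_y, freeAction_x3, leftY, leftX3, insertX3, insertW, h13,
    Finsupp.linearCombination_single, -Finsupp.smul_single]

lemma freeAction_z_pow_apply (h12 : q12 ≠ 0) (n : ℕ) (m3 : Fin 2) (p : ℕ) :
    (freeAction q12 q13 q23 (z k q12) ^ n) (basisVec k 0 0 0 0 m3 p) =
      basisVec k 0 0 0 n m3 p := by
  induction n with
  | zero => simp
  | succ n ih => rw [pow_succ', Module.End.mul_apply, ih, freeAction_z_apply h12]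

lemma freeAction_w_pow_apply (h13 : q13 ≠ 0) (p : ℕ) :
    (freeAction q12 q13 q23 (w k q13) ^ p) (basisVec k 0 0 0 0 0 0) =
      basisVec k 0 0 0 0 0 p := by
  induction p with
  | zero => simp
  | succ p ih => rw [pow_succ', Module.End.mul_apply, ih, freeAction_w_apply h13]

lemma quotAction_mon_apply (h12 : q12 ≠ 0) (h13 : q13 ≠ 0) (h23 : q23 ≠ 0) (i : Idx) :
    quotAction h12 h13 h23 (mon k q12 q13 q23 i) (basisVec k 0 0 0 0 0 0) =
      Finsupp.single i 1 := by
  obtain ⟨m1, m, m2, n, m3, p⟩ := i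
  have h3 : (freeAction q12 q13 q23 (x3 k) ^ (m3 : ℕ)) (basisVec k 0 0 0 0 0 p) =
      basisVec k 0 0 0 0 m3 p := by
    fin_cases m3 <;> simp [freeAction_x3, leftX3, insertX3, Finsupp.linearCombination_single]
  have h2 : (freeAction q12 q13 q23 (x2 k) ^ (m2 : ℕ)) (basisVec k 0 0 0 n m3 p) =
      basisVec k 0 0 m2 n m3 p := by
    fin_cases m2 <;> simp [freeAction_x2, leftX2, Finsupp.linearCombination_single]
  have hy : (freeAction q12 q13 q23 (y k) ^ (m : ℕ)) (basisVec k 0 0 m2 n m3 p) =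
      basisVec k 0 m m2 n m3 p := by
    fin_cases m <;> simp [freeAction_y, leftY, Finsupp.linearCombination_single]
  have h1 : (freeAction q12 q13 q23 (x1 k) ^ (m1 : ℕ)) (basisVec k 0 m m2 n m3 p) =
      basisVec k m1 m m2 n m3 p := by
    fin_cases m1 <;> simp [freeAction_x1, leftX1, Finsupp.linearCombination_single]
  simp only [quotAction, mon, RingQuot.liftAlgHom_mkAlgHom_apply, map_mul, map_pow,
    Module.End.mul_apply]
  rw [freeAction_w_pow_apply h13, h3, freeAction_z_pow_apply h12, h2, hy, h1]

lemma linearIndependent_mon (h12 : q12 ≠ 0) (h13 : q13 ≠ 0) (h23 : q23 ≠ 0) :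
    LinearIndependent k (mon k q12 q13 q23) := by
  refine LinearIndependent.of_comp
    ((LinearMap.applyₗ (basisVec k 0 0 0 0 0 0)).comp (quotAction h12 h13 h23).toLinearMap) ?_
  convert (Finsupp.basisSingleOne (R := k) (ι := Idx)).linearIndependent using 1
  ext1 i
  simpa using quotAction_mon_apply h12 h13 h23 i

section Straightening

variable {A : Type*} [Ring A] [Algebra k A]

lemma mul_mul_of_qcomm {u v : A} {q : k} (h : u * v = q • (v * u)) (t : A) :
    u * (v * t) = q • (v * (u * t)) := by
  rw [← mul_assoc, h, smul_mul_assoc, mul_assoc]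

lemma mul_pow_mul_of_qcomm {u v : A} {q : k} (h : u * v = q • (v * u)) (n : ℕ) (t : A) :
    u * (v ^ n * t) = q ^ n • (v ^ n * (u * t)) := by
  induction n generalizing t with
  | zero => simp
  | succ n ih =>
    rw [pow_succ, mul_assoc, ih, mul_mul_of_qcomm h, mul_smul_comm, smul_smul, ← pow_succ,
      mul_assoc]

lemma mul_mul_of_sq_eq_zero {u : A} (h : u * u = 0) (t : A) : u * (u * t) = 0 := by
  rw [← mul_assoc, h, zero_mul]

/-- The straightening rules that bring a product to PBW form. -/
structure Straightening (q12 q13 q23 : k) (a b c d e f : A) : Prop where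
  aa : a * a = 0
  bb : b * b = 0
  cc : c * c = 0
  dd : d * d = 0
  ba : b * a = (-1 : k) • (a * b)
  ca : c * a = q12⁻¹ • (a * c)
  da : d * a = q13⁻¹ • (a * d)
  cb : c * b = q12⁻¹ • (b * c - e)
  db : d * b = q13⁻¹ • (b * d - f)
  dc : d * c = q23⁻¹ • (c * d)
  ec : e * c = (-q12) • (c * e)
  de : d * e = (q23⁻¹ * q13⁻¹) • (e * d)
  fc : f * c = (q12 * q23⁻¹) • (c * f)
  fe : f * e = (-(q12 * q13⁻¹ * q23⁻¹)) • (e * f)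
  fd : f * d = (-q13) • (d * f)

namespace Straightening

lemma of_relations (h12 : q12 ≠ 0) (h13 : q13 ≠ 0) (h23 : q23 ≠ 0) {a b c d e f : A}
    (he : e = b * c - q12 • (c * b)) (hf : f = b * d - q13 • (d * b))
    (aa : a * a = 0) (bb : b * b = 0) (cc : c * c = 0) (dd : d * d = 0)
    (ab : a * b + b * a = 0) (ac : a * c - q12 • (c * a) = 0) (ad : a * d - q13 • (d * a) = 0)
    (cd : c * d - q23 • (d * c) = 0) (de : d * e - (q23⁻¹ * q13⁻¹) • (e * d) = 0) :
    Straightening q12 q13 q23 a b c d e f := by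
  have hdc : d * c = q23⁻¹ • (c * d) := by
    rw [sub_eq_zero.mp cd, inv_smul_smul₀ h23]
  have hfb : f * b = (-q13⁻¹) • (b * f) := by
    subst hf
    simp only [sub_mul, mul_sub, smul_mul_assoc, mul_smul_comm, mul_assoc, bb,
      mul_mul_of_sq_eq_zero bb, mul_zero]
    match_scalars
    field_simp
  have hfc : f * c = (q12 * q23⁻¹) • (c * f) := by
    have h := sub_eq_zero.mp de
    have h' : d * (b * c) = q12 • (d * (c * b)) +
        (q23⁻¹ * q13⁻¹) • (b * (c * d) - q12 • (c * (b * d))) := by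
      subst he
      simp only [sub_mul, mul_sub, smul_mul_assoc, mul_smul_comm, mul_assoc] at h
      rw [← h]
      abel
    subst hf
    simp only [sub_mul, mul_sub, smul_mul_assoc, mul_smul_comm, mul_assoc, h', hdc,
      mul_mul_of_qcomm hdc]
    match_scalars <;> field_simp
    ring
  refine
    { aa := aa, bb := bb, cc := cc, dd := dd, dc := hdc, fc := hfc, de := sub_eq_zero.mp de
      ba := by rw [neg_one_smul]; exact eq_neg_of_add_eq_zero_right ab
      ca := by rw [sub_eq_zero.mp ac, inv_smul_smul₀ h12]
      da := by rw [sub_eq_zero.mp ad, inv_smul_smul₀ h13]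
      cb := by rw [he, sub_sub_cancel, inv_smul_smul₀ h12]
      db := by rw [hf, sub_sub_cancel, inv_smul_smul₀ h13]
      ec := ?_, fe := ?_, fd := ?_ }
  · subst he
    simp only [sub_mul, mul_sub, smul_mul_assoc, mul_smul_comm, mul_assoc, cc,
      mul_mul_of_sq_eq_zero cc, mul_zero]
    module
  · rw [he]
    simp only [sub_mul, mul_sub, smul_mul_assoc, mul_smul_comm, mul_assoc, hfb, hfc,
      mul_mul_of_qcomm hfb, mul_mul_of_qcomm hfc]
    match_scalars <;> field_simp
  · subst hf
    simp only [sub_mul, mul_sub, smul_mul_assoc, mul_smul_comm, mul_assoc, dd,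
      mul_mul_of_sq_eq_zero dd, mul_zero]
    module

/-- The PBW word with given exponents, associated to the right. -/
def word (a b c d e f : A) (i : Idx) : A :=
  a ^ (i.m1 : ℕ) * (b ^ (i.m : ℕ) * (c ^ (i.m2 : ℕ) * (e ^ i.n * (d ^ (i.m3 : ℕ) * f ^ i.p))))

variable {a b c d e f : A} (h : Straightening q12 q13 q23 a b c d e f)
include h

lemma x1_mul_word (i : Idx) :
    a * word a b c d e f i = Finsupp.linearCombination k (word a b c d e f) (leftX1 k i) := by
  obtain ⟨m1, m, m2, n, m3, p⟩ := i
  fin_cases m1 <;> simp [word, leftX1, Finsupp.linearCombination_single,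
    mul_mul_of_sq_eq_zero h.aa]

lemma y_mul_word (i : Idx) :
    b * word a b c d e f i = Finsupp.linearCombination k (word a b c d e f) (leftY k i) := by
  obtain ⟨m1, m, m2, n, m3, p⟩ := i
  fin_cases m1 <;> fin_cases m <;> simp [word, leftY, Finsupp.linearCombination_single,
    -Finsupp.smul_single, mul_mul_of_sq_eq_zero h.bb, mul_mul_of_qcomm h.ba]

lemma x2_mul_word (h12 : q12 ≠ 0) (i : Idx) :
    c * word a b c d e f i = Finsupp.linearCombination k (word a b c d e f) (leftX2 q12 i) := by
  obtain ⟨m1, m, m2, n, m3, p⟩ := i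
  have hcb (t : A) : c * (b * t) = q12⁻¹ • (b * (c * t) - e * t) := by
    rw [← mul_assoc, h.cb, smul_mul_assoc, sub_mul, mul_assoc]
  have hee (t : A) : e * (e ^ n * t) = e ^ (n + 1) * t := by rw [← mul_assoc, pow_succ']
  fin_cases m1 <;> fin_cases m <;> fin_cases m2 <;>
    simp [word, leftX2, Finsupp.linearCombination_single, h12,
      -Finsupp.smul_single, mul_mul_of_sq_eq_zero h.cc, mul_mul_of_qcomm h.ca,
      mul_mul_of_qcomm h.ec, hcb, hee, mul_sub]

lemma x3_mul_word (i : Idx) :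
    d * word a b c d e f i =
      Finsupp.linearCombination k (word a b c d e f) (leftX3 q12 q13 q23 i) := by
  obtain ⟨m1, m, m2, n, m3, p⟩ := i
  have hdb (t : A) : d * (b * t) = q13⁻¹ • (b * (d * t) - f * t) := by
    rw [← mul_assoc, h.db, smul_mul_assoc, sub_mul, mul_assoc]
  have hff : f * f ^ p = f ^ (p + 1) := (pow_succ' f p).symm
  fin_cases m1 <;> fin_cases m <;> fin_cases m2 <;> fin_cases m3 <;>
    simp only [word, leftX3, insertX3, insertW, Finsupp.linearCombination_single, map_smul,
      map_sub, map_zero, mul_mul_of_sq_eq_zero h.dd, mul_mul_of_qcomm h.da,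
      mul_mul_of_qcomm h.dc, mul_mul_of_qcomm h.fc, mul_mul_of_qcomm h.fd,
      mul_pow_mul_of_qcomm h.de, mul_pow_mul_of_qcomm h.fe, hdb, hff, mul_sub, mul_smul_comm,
      Fin.zero_eta, Fin.mk_one, Fin.val_zero, Fin.val_one, pow_zero, pow_one, one_mul, mul_one,
      smul_zero, mul_zero, one_smul, smul_sub, smul_smul, zero_sub,
      map_neg, smul_neg, mul_neg, mul_comm, Fin.isValue] <;>
    try module

end Straightening

end Straightening

lemma mkAlgHom_eq_zero {a : FreeAlgebra k (Fin 4)} (ha : a ∈ rels k q12 q13 q23) :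
    RingQuot.mkAlgHom k (rel k q12 q13 q23) a = 0 := by
  have h : rel k q12 q13 q23 a 0 := ⟨ha, rfl⟩
  rw [RingQuot.mkAlgHom_rel k h, map_zero]

lemma straightening_mkAlgHom (h12 : q12 ≠ 0) (h13 : q13 ≠ 0) (h23 : q23 ≠ 0) :
    letI π := RingQuot.mkAlgHom k (rel k q12 q13 q23)
    Straightening q12 q13 q23 (π (x1 k)) (π (y k)) (π (x2 k)) (π (x3 k)) (π (z k q12))
      (π (w k q13)) := by
  apply Straightening.of_relations h12 h13 h23 <;>
    simp only [← map_mul, ← map_add, ← map_smul, ← map_sub, ← pow_two, ← map_pow]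
  · rfl
  · rfl
  all_goals
    refine mkAlgHom_eq_zero ?_
    simp only [rels, Set.mem_insert_iff, Set.mem_singleton_iff, true_or, or_true]

lemma mon_eq_word (i : Idx) :
    letI π := RingQuot.mkAlgHom k (rel k q12 q13 q23)
    mon k q12 q13 q23 i = Straightening.word (π (x1 k)) (π (y k)) (π (x2 k)) (π (x3 k))
      (π (z k q12)) (π (w k q13)) i := by
  simp only [mon, Straightening.word, map_mul, map_pow, mul_assoc]

lemma mkAlgHom_ι_mul_mon_mem_span (h12 : q12 ≠ 0) (h13 : q13 ≠ 0) (h23 : q23 ≠ 0) (g : Fin 4)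
    (i : Idx) :
    RingQuot.mkAlgHom k (rel k q12 q13 q23) (FreeAlgebra.ι k g) * mon k q12 q13 q23 i ∈
      Submodule.span k (Set.range (mon k q12 q13 q23)) := by
  have h := straightening_mkAlgHom h12 h13 h23
  rw [← Finsupp.range_linearCombination, funext mon_eq_word]
  fin_cases g
  · exact ⟨_, (h.x1_mul_word i).symm⟩
  · exact ⟨_, (h.y_mul_word i).symm⟩
  · exact ⟨_, (h.x2_mul_word h12 i).symm⟩
  · exact ⟨_, (h.x3_mul_word i).symm⟩

lemma span_mon (h12 : q12 ≠ 0) (h13 : q13 ≠ 0) (h23 : q23 ≠ 0) :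
    Submodule.span k (Set.range (mon k q12 q13 q23)) = ⊤ := by
  set S := Submodule.span k (Set.range (mon k q12 q13 q23))
  have hmul (a : FreeAlgebra k (Fin 4)) :
      ∀ s ∈ S, RingQuot.mkAlgHom k (rel k q12 q13 q23) a * s ∈ S := by
    induction a using FreeAlgebra.induction with
    | grade0 r =>
      intro s hs
      rw [AlgHom.commutes, ← Algebra.smul_def]
      exact S.smul_mem r hs
    | grade1 g =>
      intro s hs
      refine Submodule.span_induction ?_ ?_ ?_ ?_ hs
      · rintro _ ⟨i, rfl⟩
        exact mkAlgHom_ι_mul_mon_mem_span h12 h13 h23 g i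
      · simp
      · intro s t _ _ hs ht
        rw [mul_add]
        exact S.add_mem hs ht
      · intro r s _ hs
        rw [mul_smul_comm]
        exact S.smul_mem r hs
    | mul a b ha hb =>
      intro s hs
      rw [map_mul, mul_assoc]
      exact ha _ (hb _ hs)
    | add a b ha hb =>
      intro s hs
      rw [map_add, add_mul]
      exact S.add_mem (ha _ hs) (hb _ hs)
  have hone : (1 : RingQuot (rel k q12 q13 q23)) ∈ S :=
    Submodule.subset_span ⟨⟨0, 0, 0, 0, 0, 0⟩, by simp [mon]⟩
  refine eq_top_iff.mpr fun b _ => ?_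
  obtain ⟨a, rfl⟩ := RingQuot.mkAlgHom_surjective k (rel k q12 q13 q23) b
  simpa using hmul a 1 hone

end PBW

theorem statement8 [IsAlgClosed k] [CharZero k]
    (h12 : q12 ≠ 0) (h13 : q13 ≠ 0) (h23 : q23 ≠ 0) :
    LinearIndependent k (mon k q12 q13 q23) ∧
      Submodule.span k (Set.range (mon k q12 q13 q23)) = ⊤ := by
  exact ⟨linearIndependent_mon h12 h13 h23, span_mon h12 h13 h23⟩

end Stmt8
end
end

section
/- Let A be any associative k-algebra containing elements x1,y,x2,x3 that satisfy all of the following relations: x1² = y² = 0 and x1·y = −y·x1; x1·x2 = q12·x2·x1; z² = 0 and x2·z = q12⁻¹·z·x2; x1·x3 = q13·x3·x1; w² = 0 and x3·w = q13⁻¹·w·x3; x2·x3 = q23·x3·x2 and x3·z = q23⁻¹·q13⁻¹·z·x3. Then the following identities also hold in A: x1·z = −q12·z·x1; y·z = −q12·z·y; x1·w = −q13·w·x1; y·w = −q13·w·y; w·z = −q12·q13⁻¹·q23⁻¹·z·w; x2·w = q23·q12⁻¹·w·x2. -/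
/- Statement 9: relations (5.10) established in the proof of Theorem 5.3 of the paper,
   valid in any algebra with the defining relations of 𝔅(𝔈_{+,+}(q†,a)). -/

section BraidedCommutator

variable {k A : Type*} [Field k] [Ring A] [Algebra k A]

/-- If `x` anticommutes with `y` and `q`-commutes with `u`, then it `(-q)`-commutes with the
braided commutator of `y` and `u`. -/
theorem mul_braidedCommutator_of_anticomm {q : k} {x y u : A}
    (hxy : x * y = -(y * x)) (hxu : x * u = q • (u * x)) :
    x * (y * u - q • (u * y)) = -(q • ((y * u - q • (u * y)) * x)) := by
  linear_combination (norm := skip)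
    hxy * u - y * hxu - q • (hxu * y) - q ^ 2 • (u * hxy)
  simp only [mul_sub, sub_mul, mul_neg, neg_mul, mul_smul_comm, smul_mul_assoc, mul_assoc]
  module

/-- If `y` squares to zero, then it `(-q)`-commutes with its braided commutators. -/
theorem mul_braidedCommutator_of_sq_eq_zero {q : k} {y : A} (u : A) (hy : y ^ 2 = 0) :
    y * (y * u - q • (u * y)) = -(q • ((y * u - q • (u * y)) * y)) := by
  rw [sq] at hy
  linear_combination (norm := skip) hy * u - q ^ 2 • (u * hy)
  simp only [mul_sub, sub_mul, mul_zero, zero_mul, mul_smul_comm, smul_mul_assoc, mul_assoc]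
  module

/-- A `q`-commutation relation between `v` and the braided commutator of `y` and `u` transfers to
one between `u` and the braided commutator of `y` and `v`. -/
theorem mul_braidedCommutator_of_mul_braidedCommutator {p q r : k}
    (hp : p ≠ 0) (hq : q ≠ 0) (hr : r ≠ 0) {y u v : A} (huv : u * v = r • (v * u))
    (hv : v * (y * u - p • (u * y)) = (r⁻¹ * q⁻¹) • ((y * u - p • (u * y)) * v)) :
    u * (y * v - q • (v * y)) = (r * p⁻¹) • ((y * v - q • (v * y)) * u) := by
  linear_combination (norm := skip)
    (q * r * p⁻¹) • hv - q • (huv * y) + p⁻¹ • (y * huv)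
  simp only [mul_sub, sub_mul, mul_smul_comm, smul_mul_assoc, mul_assoc]
  match_scalars <;> field_simp <;> ring

/-- If `w` commutes up to scalars with `y` and with `u`, then it also does so with their braided
commutator. -/
theorem mul_braidedCommutator_of_comm {p q r : k}
    (hp : p ≠ 0) (hq : q ≠ 0) (hr : r ≠ 0) {y u w : A} (hyw : y * w = -(q • (w * y)))
    (huw : u * w = (r * p⁻¹) • (w * u)) :
    w * (y * u - p • (u * y)) =
      -((p * q⁻¹ * r⁻¹) • ((y * u - p • (u * y)) * w)) := by
  linear_combination (norm := skip)
    q⁻¹ • (hyw * u) + (p * q⁻¹ * r⁻¹) • (y * huw) + (p ^ 2 * r⁻¹) • (huw * y)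
      - (p ^ 2 * r⁻¹ * q⁻¹) • (u * hyw)
  simp only [mul_sub, sub_mul, mul_neg, neg_mul, mul_smul_comm, smul_mul_assoc, mul_assoc]
  match_scalars <;> field_simp <;> ring

end BraidedCommutator

theorem statement9 {k A : Type*} [Field k] [IsAlgClosed k] [CharZero k]
    [Ring A] [Algebra k A]
    (q12 q13 q23 : k) (h12 : q12 ≠ 0) (h13 : q13 ≠ 0) (h23 : q23 ≠ 0)
    (x1 y x2 x3 z w : A)
    (hz : z = y * x2 - q12 • (x2 * y))
    (hw : w = y * x3 - q13 • (x3 * y))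
    (r1 : x1 ^ 2 = 0) (r2 : y ^ 2 = 0) (r3 : x1 * y = -(y * x1))
    (r4 : x1 * x2 = q12 • (x2 * x1))
    (r5 : z ^ 2 = 0) (r6 : x2 * z = q12⁻¹ • (z * x2))
    (r7 : x1 * x3 = q13 • (x3 * x1))
    (r8 : w ^ 2 = 0) (r9 : x3 * w = q13⁻¹ • (w * x3))
    (r10 : x2 * x3 = q23 • (x3 * x2))
    (r11 : x3 * z = (q23⁻¹ * q13⁻¹) • (z * x3)) :
    (x1 * z = -(q12 • (z * x1))) ∧
    (y * z = -(q12 • (z * y))) ∧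
    (x1 * w = -(q13 • (w * x1))) ∧
    (y * w = -(q13 • (w * y))) ∧
    (w * z = -((q12 * q13⁻¹ * q23⁻¹) • (z * w))) ∧
    (x2 * w = (q23 * q12⁻¹) • (w * x2)) := by
  subst hz hw
  have hyw := mul_braidedCommutator_of_sq_eq_zero (q := q13) x3 r2
  have huw := mul_braidedCommutator_of_mul_braidedCommutator h12 h13 h23 r10 r11
  exact ⟨mul_braidedCommutator_of_anticomm r3 r4, mul_braidedCommutator_of_sq_eq_zero x2 r2,
    mul_braidedCommutator_of_anticomm r3 r7, hyw,
    mul_braidedCommutator_of_comm h12 h13 h23 hyw huw, huw⟩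
end
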